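/- Let q be an odd prime and set E = ∏_{p ≥ q, p prime} p²/(p²−1). Then log E ≤ (1/(q log q)) · (1 + 2 log log q / log q) + 4/q³. -/

import Mathlib

section
open Complex Filter Topology Metric

namespace PNT

lemma order_ne_top {f : ℂ → ℂ} (hf : Differentiable ℂ f) (h0 : f 0 ≠ 0) (ρ : ℂ) :
    analyticOrderAt f ρ ≠ ⊤ := by
  intro h
  rw [analyticOrderAt_eq_top] at h
  have := AnalyticOnNhd.eqOn_zero_of_preconnected_of_eventuallyEq_zero
    (f := f) (U := Set.univ) (fun z _ => hf.analyticAt z) isPreconnected_univ (Set.mem_univ ρ) h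
  exact h0 (this (Set.mem_univ 0))

lemma extract_one {f : ℂ → ℂ} (hf : Differentiable ℂ f) (ρ : ℂ) (ht : analyticOrderAt f ρ ≠ ⊤) :
    ∃ g : ℂ → ℂ, Differentiable ℂ g ∧ g ρ ≠ 0 ∧
      ∀ z, f z = (z - ρ) ^ (analyticOrderNatAt f ρ) * g z := by
  obtain ⟨g, hg, hg0, hfg⟩ := ((hf.analyticAt ρ).analyticOrderAt_ne_top).1 ht
  set n := analyticOrderNatAt f ρ
  classical
  let G : ℂ → ℂ := fun z => if z = ρ then g ρ else f z / (z - ρ) ^ n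
  have hGg : G =ᶠ[𝓝 ρ] g := by
    filter_upwards [hfg] with z hz
    by_cases h : z = ρ
    · simp [G, h]
    · have : z - ρ ≠ 0 := sub_ne_zero.2 h
      simp only [G, h, if_false, hz, smul_eq_mul]
      field_simp
  refine ⟨G, ?_, ?_, ?_⟩
  · intro z
    by_cases h : z = ρ
    · subst h
      exact hg.differentiableAt.congr_of_eventuallyEq hGg
    · have h1 : G =ᶠ[𝓝 z] fun z => f z / (z - ρ) ^ n := by
        filter_upwards [isOpen_ne.mem_nhds h] with w hw
        have : w ≠ ρ := hw
        simp [G, this]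
      have : z - ρ ≠ 0 := sub_ne_zero.2 h
      refine DifferentiableAt.congr_of_eventuallyEq ?_ h1
      refine (hf z).div (by fun_prop) (pow_ne_zero _ this)
  · simpa [G] using hg0
  · intro z
    by_cases h : z = ρ
    · have := hfg.self_of_nhds
      simp only [smul_eq_mul] at this
      subst h
      simpa [G] using this
    · have : z - ρ ≠ 0 := sub_ne_zero.2 h
      simp only [G, h, if_false]
      field_simp

lemma extract_finset {f : ℂ → ℂ} (hf : Differentiable ℂ f) (h0 : f 0 ≠ 0) (S : Finset ℂ) :
    ∃ g : ℂ → ℂ, Differentiable ℂ g ∧ (∀ ρ ∈ S, g ρ ≠ 0) ∧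
      ∀ z, f z = (∏ ρ ∈ S, (z - ρ) ^ (analyticOrderNatAt f ρ)) * g z := by
  classical
  induction S using Finset.induction_on with
  | empty => exact ⟨f, hf, by simp, by simp⟩
  | insert a S ha ih =>
    obtain ⟨g, hg, hgS, hfg⟩ := ih
    have hP : ∀ z, AnalyticAt ℂ (fun z => ∏ ρ ∈ S, (z - ρ) ^ (analyticOrderNatAt f ρ)) z := by
      intro z; fun_prop
    have hord : analyticOrderAt f a = analyticOrderAt g a := by
      have h1 : f = (fun z => ∏ ρ ∈ S, (z - ρ) ^ (analyticOrderNatAt f ρ)) * g := by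
        ext z; exact hfg z
      have h2 : analyticOrderAt (fun z => ∏ ρ ∈ S, (z - ρ) ^ (analyticOrderNatAt f ρ)) a = 0 := by
        rw [(hP a).analyticOrderAt_eq_zero]
        refine Finset.prod_ne_zero_iff.2 fun ρ hρ => pow_ne_zero _ (sub_ne_zero.2 ?_)
        rintro rfl; exact ha hρ
      conv_lhs => rw [h1]
      rw [analyticOrderAt_mul (hP a) (hg.analyticAt a), h2, zero_add]
    obtain ⟨k, hk, hk0, hgk⟩ := extract_one hg a (hord ▸ order_ne_top hf h0 a)
    have hn : analyticOrderNatAt g a = analyticOrderNatAt f a := by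
      simp [analyticOrderNatAt, hord]
    refine ⟨k, hk, ?_, ?_⟩
    · intro ρ hρ
      rcases Finset.mem_insert.1 hρ with rfl | hρ
      · exact hk0
      · intro h
        apply hgS ρ hρ
        rw [hgk, h, mul_zero]
    · intro z
      rw [hfg, Finset.prod_insert ha, hgk z, hn]
      ring

lemma zeros_finite {f : ℂ → ℂ} (hf : Differentiable ℂ f) (h0 : f 0 ≠ 0) (R : ℝ) :
    {z : ℂ | ‖z‖ ≤ R ∧ f z = 0}.Finite := by
  by_contra hinf
  have hK : IsCompact (closedBall (0:ℂ) R) := isCompact_closedBall _ _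
  obtain ⟨a, ha, hacc⟩ := Set.Infinite.exists_accPt_of_subset_isCompact hinf hK
    (by intro z hz; simpa using hz.1)
  have h := hacc
  rw [accPt_iff_frequently_nhdsNE] at h
  have := AnalyticOnNhd.eqOn_zero_of_preconnected_of_frequently_eq_zero
    (f := f) (U := Set.univ) (fun z _ => hf.analyticAt z) isPreconnected_univ (Set.mem_univ a)
    (h.mono fun z hz => hz.2)
  exact h0 (this (Set.mem_univ 0))

/-- log-derivative variation bound for zero-free functions on a ball. -/
lemma logDeriv_var {h : ℂ → ℂ} (hh : Differentiable ℂ h) {R B : ℝ} (hR : 0 < R) (hB : 0 < B)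
    (hne : ∀ z ∈ ball (0:ℂ) R, h z ≠ 0)
    (hb : ∀ z ∈ ball (0:ℂ) R, ‖h z‖ ≤ ‖h 0‖ * Real.exp B) {z w : ℂ}
    (hz : ‖z‖ < R / 4) (hw : ‖w‖ < R / 4) :
    ‖logDeriv h z - logDeriv h w‖ ≤ 128 * B / R ^ 2 * ‖z - w‖ := by
  have h0 : h 0 ≠ 0 := hne 0 (by simpa using hR)
  have hd : DifferentiableOn ℂ (fun z => deriv h z / h z) (ball 0 R) := by
    intro z hz
    exact ((hh.deriv z).div (hh z) (hne z hz)).differentiableWithinAt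
  obtain ⟨φ0, hφ0⟩ := hd.isExactOn_ball
  set φ : ℂ → ℂ := fun z => φ0 z - φ0 0 with hφ
  have hφd : ∀ z ∈ ball (0:ℂ) R, HasDerivAt φ (deriv h z / h z) z := fun z hz =>
    (hφ0 z hz).sub_const _
  have hexp : ∀ z ∈ ball (0:ℂ) R, h z = h 0 * exp (φ z) := by
    have hc : ∀ z ∈ ball (0:ℂ) R, HasDerivAt (fun z => h z * exp (- φ z)) 0 z := by
      intro z hz
      have := ((hh z).hasDerivAt).mul ((hφd z hz).neg.cexp)
      refine this.congr_deriv ?_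
      have := hne z hz
      simp only [Pi.neg_apply]
      field_simp
      ring
    intro z hz
    have hconv : Convex ℝ (ball (0:ℂ) R) := convex_ball _ _
    have := Convex.norm_image_sub_le_of_norm_deriv_le (𝕜 := ℂ)
      (f := fun z => h z * exp (- φ z)) (s := ball 0 R) (C := 0)
      (x := 0) (y := z) (fun x hx => (hc x hx).differentiableAt)
      (fun x hx => by rw [(hc x hx).deriv]; simp) hconv (by simpa using hR) hz
    have h2 : h z * exp (- φ z) = h 0 := by
      have h3 : h z * exp (- φ z) - h 0 * exp (- φ 0) = 0 := by
        apply norm_eq_zero.1; apply le_antisymm _ (norm_nonneg _); simpa using this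
      have h4 : φ 0 = 0 := by simp [hφ]
      rw [h4] at h3
      simpa [sub_eq_zero] using h3
    rw [← h2, mul_assoc, ← exp_add]; simp
  have hφR : Set.MapsTo φ (ball 0 R) {z | z.re ≤ B} := by
    intro z hz
    have h1 := hb z hz
    rw [hexp z hz, norm_mul, norm_exp] at h1
    have := le_of_mul_le_mul_left h1 (norm_pos_iff.2 h0)
    exact Real.exp_le_exp.1 this
  have hφdiff : DifferentiableOn ℂ φ (ball 0 R) := fun z hz =>
    (hφd z hz).differentiableAt.differentiableWithinAt
  have hbd : ∀ z : ℂ, ‖z‖ ≤ R / 2 → ‖φ z‖ ≤ 2 * B := by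
    intro z hz
    have := borelCaratheodory_zero hB hφdiff hφR hR (z := z)
      (by simp; linarith) (by simp [hφ])
    refine this.trans ?_
    rw [div_le_iff₀ (by linarith)]
    nlinarith
  have hφ1 : ∀ z : ℂ, ‖z‖ ≤ 3 * R / 8 → ‖deriv φ z‖ ≤ 16 * B / R := by
    intro z hz
    have := norm_deriv_le_of_forall_mem_sphere_norm_le (c := z) (R := R / 8) (C := 2 * B) (f := φ)
      (by positivity) ?_ ?_
    · refine this.trans (le_of_eq ?_)
      field_simp; norm_num
    · refine DifferentiableOn.diffContOnCl_ball (U := ball 0 R) hφdiff ?_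
      intro y hy
      simp only [mem_closedBall, mem_ball, dist_eq_norm, sub_zero] at *
      have := norm_le_norm_add_norm_sub z y
      linarith [norm_sub_rev z y]
    · intro y hy
      apply hbd
      simp only [mem_sphere, dist_eq_norm] at hy
      have := norm_le_norm_add_norm_sub z y
      linarith [norm_sub_rev z y]
  have hφ'd : DifferentiableOn ℂ (deriv φ) (ball 0 R) := hφdiff.deriv isOpen_ball
  have hφ2 : ∀ z ∈ ball (0:ℂ) (R / 4), ‖deriv (deriv φ) z‖ ≤ 128 * B / R ^ 2 := by
    intro z hz
    simp only [mem_ball, dist_eq_norm, sub_zero] at hz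
    have := norm_deriv_le_of_forall_mem_sphere_norm_le (c := z) (R := R / 8) (C := 16 * B / R)
      (f := deriv φ) (by positivity) ?_ ?_
    · refine this.trans (le_of_eq ?_)
      field_simp; norm_num
    · refine DifferentiableOn.diffContOnCl_ball (U := ball 0 R) hφ'd ?_
      intro y hy
      simp only [mem_closedBall, mem_ball, dist_eq_norm, sub_zero] at *
      have := norm_le_norm_add_norm_sub z y
      linarith [norm_sub_rev z y]
    · intro y hy
      apply hφ1
      simp only [mem_sphere, dist_eq_norm] at hy
      have := norm_le_norm_add_norm_sub z y
      linarith [norm_sub_rev z y]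
  have key := Convex.norm_image_sub_le_of_norm_deriv_le (𝕜 := ℂ)
      (f := deriv φ) (s := ball 0 (R/4)) (C := 128 * B / R ^ 2)
      (x := w) (y := z) (fun x hx => (hφ'd x (ball_subset_ball (by linarith) hx)).differentiableAt
        (isOpen_ball.mem_nhds (ball_subset_ball (by linarith) hx)))
      hφ2 (convex_ball _ _) (by simpa using hw) (by simpa using hz)
  have e : ∀ z : ℂ, ‖z‖ < R / 4 → deriv φ z = logDeriv h z := by
    intro z hz
    rw [(hφd z (by simp; linarith)).deriv, logDeriv_apply]
  rwa [e z hz, e w hw] at key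

end PNT
end

section
open Complex Filter Topology Metric

namespace PNT

noncomputable def zset {f : ℂ → ℂ} (hf : Differentiable ℂ f) (h0 : f 0 ≠ 0) (R : ℝ) : Finset ℂ :=
  (zeros_finite hf h0 R).toFinset

lemma mem_zset {f : ℂ → ℂ} (hf : Differentiable ℂ f) (h0 : f 0 ≠ 0) (R : ℝ) (z : ℂ) :
    z ∈ zset hf h0 R ↔ ‖z‖ ≤ R ∧ f z = 0 := by simp [zset]

lemma hadamard_bound {f : ℂ → ℂ} (hf : Differentiable ℂ f) (h0 : f 0 ≠ 0) {M R : ℝ} (hR : 0 < R)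
    (hM : ∀ z : ℂ, ‖z‖ ≤ 2 * R → ‖f z‖ ≤ Real.exp M) {z w : ℂ}
    (hz : ‖z‖ < R / 4) (hw : ‖w‖ < R / 4) (hfz : f z ≠ 0) (hfw : f w ≠ 0) :
    ‖(logDeriv f z - logDeriv f w) - ∑ ρ ∈ zset hf h0 R,
      (analyticOrderNatAt f ρ : ℂ) * (1 / (z - ρ) - 1 / (w - ρ))‖ ≤
      128 * (M - Real.log ‖f 0‖ + 1) / R ^ 2 * ‖z - w‖ := by
  obtain ⟨g, hg, hgS, hfg⟩ := extract_finset hf h0 (zset hf h0 R)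
  set S := zset hf h0 R with hS
  set m := analyticOrderNatAt f
  have hS0 : ∀ ρ ∈ S, ρ ≠ 0 := by
    rintro ρ hρ rfl
    exact h0 ((mem_zset hf h0 R 0).1 hρ).2
  set c : ℂ := ∏ ρ ∈ S, (-ρ) ^ m ρ with hc
  have hc0 : c ≠ 0 := Finset.prod_ne_zero_iff.2 fun ρ hρ => pow_ne_zero _ (neg_ne_zero.2 (hS0 ρ hρ))
  have hf2 : ∀ z, f z = (∏ ρ ∈ S, (1 - z / ρ) ^ m ρ) * (c * g z) := by
    intro z
    rw [hfg z, ← mul_assoc, hc, ← Finset.prod_mul_distrib]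
    congr 1
    refine Finset.prod_congr rfl fun ρ hρ => ?_
    rw [← mul_pow]
    congr 1
    have := hS0 ρ hρ
    field_simp
    ring
  set h : ℂ → ℂ := fun z => c * g z with hh
  have hhd : Differentiable ℂ h := by fun_prop
  have hh0 : h 0 = f 0 := by rw [hf2 0]; simp [hh]
  have hbd : ∀ z ∈ closure (ball (0:ℂ) (2 * R)), ‖h z‖ ≤ Real.exp M := by
    intro z hz
    refine norm_le_of_forall_mem_frontier_norm_le (U := ball (0:ℂ) (2 * R)) isBounded_ball
      hhd.diffContOnCl ?_ hz
    intro y hy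
    rw [frontier_ball _ (by positivity)] at hy
    simp only [mem_sphere, dist_eq_norm, sub_zero] at hy
    refine le_trans ?_ (hM y hy.le)
    rw [hf2 y, norm_mul (∏ ρ ∈ S, (1 - y / ρ) ^ m ρ), norm_prod]
    refine le_mul_of_one_le_left (norm_nonneg _) ?_
    refine Finset.one_le_prod fun ρ hρ => ?_
    rw [norm_pow]
    refine one_le_pow₀ ?_
    have h1 : ‖ρ‖ ≤ R := ((mem_zset hf h0 R ρ).1 hρ).1
    have h2 : 0 < ‖ρ‖ := norm_pos_iff.2 (hS0 ρ hρ)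
    have h3 : 2 ≤ ‖y / ρ‖ := by
      rw [norm_div, hy, le_div_iff₀ h2]; linarith
    have := norm_sub_norm_le (y / ρ) 1
    rw [norm_sub_rev] at this
    simp only [norm_one] at this
    linarith
  have hsub : ball (0:ℂ) R ⊆ closure (ball (0:ℂ) (2 * R)) :=
    (ball_subset_ball (by linarith)).trans subset_closure
  have hlog : Real.exp M = ‖h 0‖ * Real.exp (M - Real.log ‖f 0‖) := by
    rw [hh0, Real.exp_sub, Real.exp_log (norm_pos_iff.2 h0)]
    have := norm_pos_iff.2 h0
    field_simp
  have hB0 : 0 ≤ M - Real.log ‖f 0‖ := by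
    have h1 := hbd 0 (hsub (by simpa using hR))
    rw [hh0] at h1
    have := Real.log_le_log (norm_pos_iff.2 h0) h1
    rw [Real.log_exp] at this
    linarith
  have hne : ∀ z ∈ ball (0:ℂ) R, h z ≠ 0 := by
    intro z hz hhz
    simp only [mem_ball, dist_eq_norm, sub_zero] at hz
    have : f z = 0 := by rw [hf2 z]; simp only [hh] at hhz; rw [hhz, mul_zero]
    have hzS : z ∈ S := (mem_zset hf h0 R z).2 ⟨hz.le, this⟩
    exact (mul_ne_zero hc0 (hgS z hzS)) hhz
  have var := logDeriv_var hhd hR (B := M - Real.log ‖f 0‖ + 1) (by linarith) hne (by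
    intro z hz
    refine (hbd z (hsub hz)).trans ?_
    rw [hlog]
    gcongr
    linarith) hz hw
  have hld : ∀ z, f z ≠ 0 → logDeriv f z = (∑ ρ ∈ S, (m ρ : ℂ) * (1 / (z - ρ))) + logDeriv h z := by
    intro z hfz
    have hzρ : ∀ ρ ∈ S, z - ρ ≠ 0 := by
      intro ρ hρ e
      apply hfz
      rw [sub_eq_zero.1 e]
      exact ((mem_zset hf h0 R ρ).1 hρ).2
    have hfeq : f = fun z => (∏ ρ ∈ S, (1 - z / ρ) ^ m ρ) * h z := by
      ext z; exact hf2 z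
    have hterm : ∀ ρ ∈ S, (1 - z / ρ) ≠ 0 := by
      intro ρ hρ e
      apply hzρ ρ hρ
      have := hS0 ρ hρ
      field_simp at e
      linear_combination -e
    have hprod : (∏ ρ ∈ S, (1 - z / ρ) ^ m ρ) ≠ 0 :=
      Finset.prod_ne_zero_iff.2 fun ρ hρ => pow_ne_zero _ (hterm ρ hρ)
    have hhz : h z ≠ 0 := by
      intro e; apply hfz; rw [hf2 z]; simp only [hh] at e; rw [e, mul_zero]
    conv_lhs => rw [hfeq]
    rw [logDeriv_mul z hprod hhz (by fun_prop) (hhd z)]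
    congr 1
    rw [logDeriv_prod (f := fun ρ z => (1 - z / ρ) ^ m ρ) (fun ρ hρ => pow_ne_zero _ (hterm ρ hρ)) (fun ρ hρ => by fun_prop)]
    refine Finset.sum_congr rfl fun ρ hρ => ?_
    rw [logDeriv_fun_pow (by fun_prop)]
    congr 1
    rw [logDeriv_apply]
    have : deriv (fun z => 1 - z / ρ) z = - (1 / ρ) := by
      have := ((hasDerivAt_id z).div_const ρ).const_sub 1
      simpa using this.deriv
    rw [this]
    have h1 := hS0 ρ hρ
    have h2 := hzρ ρ hρ
    have h3 := hterm ρ hρ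
    have h4 : ρ - z ≠ 0 := by rw [← neg_sub]; exact neg_ne_zero.2 h2
    field_simp
    ring
  refine le_trans (le_of_eq ?_) var
  congr 1
  rw [hld z hfz, hld w hfw]
  simp only [mul_sub, Finset.sum_sub_distrib]
  ring

theorem hadamard_tendsto {f : ℂ → ℂ} (hf : Differentiable ℂ f) (h0 : f 0 ≠ 0) (C : ℝ)
    (hC : ∀ z : ℂ, ‖f z‖ ≤ Real.exp (C * (1 + ‖z‖) ^ (3 / 2 : ℝ))) (hC0 : 0 ≤ C) {z w : ℂ}
    (hfz : f z ≠ 0) (hfw : f w ≠ 0) :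
    Tendsto (fun R : ℝ => ∑ ρ ∈ zset hf h0 R,
      (analyticOrderNatAt f ρ : ℂ) * (1 / (z - ρ) - 1 / (w - ρ))) atTop
      (𝓝 (logDeriv f z - logDeriv f w)) := by
  rw [tendsto_iff_norm_sub_tendsto_zero]
  have hlim : Tendsto (fun R : ℝ => 128 * (C * (3 ^ (3/2:ℝ)) * R ^ (-(1/2):ℝ)  +
      (- Real.log ‖f 0‖ + 1) * R ^ (-(2:ℝ))) * ‖z - w‖) atTop (𝓝 0) := by
    have h1 := tendsto_rpow_neg_atTop (y := 1/2) (by norm_num)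
    have h2 := tendsto_rpow_neg_atTop (y := 2) (by norm_num)
    have := (((h1.const_mul (C * (3 ^ (3/2:ℝ)))).add (h2.const_mul (- Real.log ‖f 0‖ + 1))).const_mul
      128).mul_const ‖z - w‖
    simpa using this
  refine squeeze_zero' (Eventually.of_forall fun _ => norm_nonneg _) ?_ hlim
  filter_upwards [eventually_gt_atTop (4 * ‖z‖), eventually_gt_atTop (4 * ‖w‖),
    eventually_ge_atTop 1] with R hz hw hR
  have hb := hadamard_bound hf h0 (R := R) (M := C * (3 * R) ^ (3 / 2 : ℝ)) (by linarith) (by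
    intro y hy
    refine (hC y).trans ?_
    gcongr
    linarith) (z := z) (w := w) (by linarith) (by linarith) hfz hfw
  rw [norm_sub_rev]
  refine hb.trans (le_of_eq ?_)
  have hR0 : 0 < R := by linarith
  rw [Real.mul_rpow (by norm_num) hR0.le]
  have e1 : R ^ (-(1/2):ℝ) = R ^ (3/2:ℝ) / R ^ 2 := by
    rw [← Real.rpow_natCast R 2, ← Real.rpow_sub hR0]; norm_num
  have e2 : R ^ (-(2:ℝ)) = 1 / R ^ 2 := by
    rw [Real.rpow_neg hR0.le, ← Real.rpow_natCast R 2]; norm_num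
  rw [e1, e2]
  field_simp
  ring

end PNT
end

section
open Complex Filter Topology Metric MeasureTheory Set HurwitzZeta

namespace PNT

lemma young_aux (p : ℝ) (hp : 0 < p) : ∃ C : ℝ, 0 ≤ C ∧ ∀ σ x : ℝ, 0 ≤ σ → 0 < x →
    x ^ σ ≤ Real.exp (p / 2 * x) * Real.exp (C * σ ^ (3 / 2 : ℝ)) := by
  refine ⟨3 * (6 / p) ^ (1 / 2 : ℝ), by positivity, fun σ x hσ hx => ?_⟩
  rw [Real.rpow_def_of_pos hx, ← Real.exp_add, Real.exp_le_exp]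
  set y := x ^ (1 / 3 : ℝ) with hy
  have hy0 : 0 < y := Real.rpow_pos_of_pos hx _
  have hy3 : y ^ 3 = x := by
    rw [hy, ← Real.rpow_natCast, ← Real.rpow_mul hx.le]; norm_num
  have hlog : Real.log x ≤ 3 * y := by
    have h1 : Real.log y ≤ y - 1 := Real.log_le_sub_one_of_pos hy0
    rw [← hy3, Real.log_pow]; push_cast; linarith
  set t := (6 * σ / p) ^ (1 / 2 : ℝ) with ht
  have ht0 : 0 ≤ t := by positivity
  have ht2 : t ^ 2 = 6 * σ / p := by
    rw [ht, ← Real.rpow_natCast, ← Real.rpow_mul (by positivity)]; norm_num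
  have hC : 3 * (6 / p) ^ (1 / 2 : ℝ) * σ ^ (3 / 2 : ℝ) = 3 * σ * t := by
    rw [ht, show 6 * σ / p = (6 / p) * σ by ring, Real.mul_rpow (by positivity) hσ,
      show (3 / 2 : ℝ) = 1 + 1 / 2 by norm_num, Real.rpow_add_of_nonneg hσ (by norm_num) (by norm_num),
      Real.rpow_one]
    ring
  rw [hC]
  have h1 : Real.log x * σ ≤ 3 * y * σ := mul_le_mul_of_nonneg_right hlog hσ
  refine h1.trans ?_
  rcases le_or_gt y t with h | h
  · have : 3 * y * σ ≤ 3 * σ * t := by nlinarith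
    have : 0 ≤ p / 2 * x := by positivity
    linarith
  · have h2 : 6 * σ / p ≤ y ^ 2 := by rw [← ht2]; gcongr
    rw [div_le_iff₀ hp] at h2
    have h3 : 3 * y * σ ≤ p / 2 * x := by rw [← hy3]; nlinarith
    have : 0 ≤ 3 * σ * t := by positivity
    linarith

lemma completedZeta0_growth : ∃ A C : ℝ, 0 ≤ A ∧ 0 ≤ C ∧ ∀ s : ℂ, 0 ≤ s.re →
    ‖completedRiemannZeta₀ s‖ ≤ A * Real.exp (C * s.re ^ (3 / 2 : ℝ)) := by
  obtain ⟨p, hp, hO⟩ := isBigO_atTop_evenKernel_sub 0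
  obtain ⟨C, hC0, hC⟩ := young_aux p hp
  set P := hurwitzEvenFEPair 0 with hP
  have hconv : ∀ s, MellinConvergent P.f_modif s := fun s =>
    (P.isStrongFEPair_toStrongFEPair.hasMellin s).1
  obtain ⟨c, hc⟩ := hO.bound
  rw [eventually_atTop] at hc
  obtain ⟨X0, hX0⟩ := hc
  set X := max X0 1
  set W : ℝ → ℝ := fun x => Real.exp (p / 2 * x) * ‖(x : ℂ) ^ ((0 : ℂ) - 1) • P.f_modif x‖ with hW
  have hWi : IntegrableOn W (Ioi 0) := by
    have h0 := hconv 0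
    have hg : IntegrableOn (fun x : ℝ => Real.exp (p / 2 * X) *
        ‖(x : ℂ) ^ ((0 : ℂ) - 1) • P.f_modif x‖ + |c| * Real.exp (-(p / 2) * x)) (Ioi 0) := by
      refine Integrable.add ?_ ?_
      · exact (h0.norm).const_mul _
      · exact (integrableOn_exp_mul_Ioi (by linarith) 0).const_mul _
    refine Integrable.mono' hg ?_ ?_
    · refine AEStronglyMeasurable.mul ?_ h0.norm.aestronglyMeasurable
      exact (by fun_prop : Continuous fun x : ℝ => Real.exp (p / 2 * x)).aestronglyMeasurable
    · refine (ae_restrict_iff' measurableSet_Ioi).2 (Eventually.of_forall fun x hx => ?_)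
      have hx : 0 < x := hx
      rw [Real.norm_of_nonneg (by positivity)]
      rcases le_or_gt x X with h | h
      · have : Real.exp (p / 2 * x) ≤ Real.exp (p / 2 * X) := by gcongr
        have h2 : 0 ≤ |c| * Real.exp (-(p / 2) * x) := by positivity
        have := mul_le_mul_of_nonneg_right this (norm_nonneg ((x : ℂ) ^ ((0 : ℂ) - 1) • P.f_modif x))
        simp only [hW]; linarith
      · have hx1 : 1 < x := lt_of_le_of_lt (le_max_right _ _) h
        have hxX : X0 ≤ x := (le_max_left _ _).trans h.le
        have e : P.f_modif x = ((evenKernel 0 x - 1 : ℝ) : ℂ) := by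
          simp [WeakFEPair.f_modif, hx1, hx1.le, hP, hurwitzEvenFEPair]
        have h1 := hX0 x hxX
        simp only [if_true, Real.norm_eq_abs, Real.abs_exp] at h1
        have h3 : ‖(x : ℂ) ^ ((0 : ℂ) - 1) • P.f_modif x‖ ≤ |c| * Real.exp (-p * x) := by
          rw [norm_smul, e, norm_real, Real.norm_eq_abs, norm_cpow_eq_rpow_re_of_pos hx]
          have h4 : x ^ ((0 : ℂ) - 1).re ≤ 1 := by
            have h41 : ((0 : ℂ) - 1).re = -1 := by simp
            rw [h41, Real.rpow_neg_one]; exact inv_le_one_of_one_le₀ hx1.le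
          have h5 : c * Real.exp (-p * x) ≤ |c| * Real.exp (-p * x) := by
            gcongr; exact le_abs_self c
          have h6 := mul_le_mul_of_nonneg_right h4 (abs_nonneg (evenKernel 0 x - 1))
          linarith
        have h7 : W x ≤ Real.exp (p / 2 * x) * (|c| * Real.exp (-p * x)) := by
          simp only [hW]; gcongr
        have h8 : Real.exp (p / 2 * x) * (|c| * Real.exp (-p * x)) =
            |c| * Real.exp (-(p / 2) * x) := by
          rw [mul_left_comm, ← Real.exp_add]; ring_nf
        have h9 : 0 ≤ Real.exp (p / 2 * X) * ‖(x : ℂ) ^ ((0 : ℂ) - 1) • P.f_modif x‖ := by positivity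
        linarith
  refine ⟨∫ x in Ioi 0, W x, C, setIntegral_nonneg measurableSet_Ioi
    (fun x _ => by simp only [hW]; positivity), hC0, fun s hs => ?_⟩
  have e : completedRiemannZeta₀ s = mellin P.f_modif (s / 2) / 2 := rfl
  rw [e, norm_div, mellin]
  have hn : ‖∫ t : ℝ in Ioi 0, (t : ℂ) ^ (s / 2 - 1) • P.f_modif t‖ ≤
      ∫ t in Ioi 0, W t * Real.exp (C * s.re ^ (3 / 2 : ℝ)) := by
    refine norm_integral_le_of_norm_le (hWi.mul_const _) ?_
    refine (ae_restrict_iff' measurableSet_Ioi).2 (Eventually.of_forall fun x hx => ?_)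
    have hx : 0 < x := hx
    simp only [hW]
    rw [norm_smul, norm_smul, norm_cpow_eq_rpow_re_of_pos hx, norm_cpow_eq_rpow_re_of_pos hx]
    have e2 : x ^ (s / 2 - 1).re = x ^ (s.re / 2) * x ^ ((0 : ℂ) - 1).re := by
      rw [← Real.rpow_add hx]; congr 1; simp; ring
    have h1 := hC (s.re / 2) x (by positivity) hx
    have h2 : Real.exp (C * (s.re / 2) ^ (3 / 2 : ℝ)) ≤ Real.exp (C * s.re ^ (3 / 2 : ℝ)) := by
      gcongr; linarith
    rw [e2]
    calc x ^ (s.re / 2) * x ^ ((0 : ℂ) - 1).re * ‖P.f_modif x‖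
        ≤ (Real.exp (p / 2 * x) * Real.exp (C * s.re ^ (3 / 2 : ℝ))) * x ^ ((0 : ℂ) - 1).re
          * ‖P.f_modif x‖ := by
          gcongr
          exact h1.trans (by gcongr)
      _ = _ := by ring
  rw [integral_mul_const] at hn
  refine le_trans ?_ hn
  simp only [norm_ofNat]
  exact div_le_self (norm_nonneg _) (by norm_num)

end PNT
end

section
open Complex Filter Topology Metric MeasureTheory Set HurwitzZeta
open scoped ComplexConjugate

namespace PNT

/-- The entire function `ξ`, normalised by `ξ 0 = 1`. -/
noncomputable def xi (s : ℂ) : ℂ := s * (s - 1) * completedRiemannZeta₀ s + 1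

lemma xi_diff : Differentiable ℂ xi := by
  unfold xi
  exact ((differentiable_id.mul (differentiable_id.sub_const 1)).mul
    differentiable_completedZeta₀).add_const 1

lemma xi_zero : xi 0 = 1 := by simp [xi]
lemma xi_one : xi 1 = 1 := by simp [xi]

lemma xi_one_sub (s : ℂ) : xi (1 - s) = xi s := by
  unfold xi; rw [completedRiemannZeta₀_one_sub]; ring

lemma xi_eq {s : ℂ} (hs : 0 < s.re) (h1 : s ≠ 1) :
    xi s = s * (s - 1) * (Gammaℝ s * riemannZeta s) := by
  have h0 : s ≠ 0 := by rintro rfl; simp at hs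
  have hg : Gammaℝ s ≠ 0 := Gammaℝ_ne_zero_of_re_pos hs
  have h2 : (1 - s) ≠ 0 := sub_ne_zero.2 h1.symm
  rw [riemannZeta_def_of_ne_zero h0, mul_div_cancel₀ _ hg, completedRiemannZeta_eq, xi]
  field_simp
  ring

lemma xi_growth : ∃ C : ℝ, 0 ≤ C ∧ ∀ z, ‖xi z‖ ≤ Real.exp (C * (1 + ‖z‖) ^ (3 / 2 : ℝ)) := by
  obtain ⟨A, C, hA, hC, h⟩ := completedZeta0_growth
  have key : ∀ z : ℂ, 0 ≤ z.re → ‖xi z‖ ≤ Real.exp ((A + 2 + C) * (1 + ‖z‖) ^ (3 / 2 : ℝ)) := by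
    intro z hz
    have hu1 : 1 ≤ 1 + ‖z‖ := by linarith [norm_nonneg z]
    set u := 1 + ‖z‖ with hu
    have hu2 : u ≤ u ^ (3 / 2 : ℝ) := by
      conv_lhs => rw [← Real.rpow_one u]
      exact Real.rpow_le_rpow_of_exponent_le hu1 (by norm_num)
    have hre : z.re ≤ u := (re_le_norm z).trans (by linarith)
    have h1 : ‖completedRiemannZeta₀ z‖ ≤ A * Real.exp (C * u ^ (3 / 2 : ℝ)) := by
      refine (h z hz).trans ?_
      gcongr
    have h2 : ‖xi z‖ ≤ u * u * (A * Real.exp (C * u ^ (3 / 2 : ℝ))) + 1 := by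
      unfold xi
      refine (norm_add_le _ _).trans ?_
      rw [norm_mul, norm_mul, norm_one]
      have : ‖z - 1‖ ≤ u := (norm_sub_le _ _).trans (by rw [norm_one]; linarith)
      have h3 : ‖z‖ ≤ u := by linarith
      gcongr
    have h3 : (1 : ℝ) ≤ Real.exp (C * u ^ (3 / 2 : ℝ)) := Real.one_le_exp (by positivity)
    have h4 : A + 1 ≤ Real.exp (A * u ^ (3 / 2 : ℝ)) := by
      refine (Real.add_one_le_exp A).trans ?_
      rw [Real.exp_le_exp]
      nlinarith
    have h5 : u ≤ Real.exp (u ^ (3 / 2 : ℝ)) := by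
      have := Real.add_one_le_exp (u ^ (3 / 2 : ℝ)); linarith
    rw [show (A + 2 + C) * u ^ (3 / 2 : ℝ) = u ^ (3 / 2 : ℝ) + u ^ (3 / 2 : ℝ) +
      (A * u ^ (3 / 2 : ℝ) + C * u ^ (3 / 2 : ℝ)) by ring, Real.exp_add, Real.exp_add, Real.exp_add]
    calc ‖xi z‖ ≤ u * u * (A * Real.exp (C * u ^ (3 / 2 : ℝ))) + 1 := h2
      _ ≤ u * u * (A * Real.exp (C * u ^ (3 / 2 : ℝ))) + u * u * Real.exp (C * u ^ (3 / 2 : ℝ)) := by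
          have : 1 ≤ u * u := by nlinarith
          nlinarith
      _ = u * u * ((A + 1) * Real.exp (C * u ^ (3 / 2 : ℝ))) := by ring
      _ ≤ _ := by gcongr
  refine ⟨(A + 2 + C) * 4, by positivity, fun z => ?_⟩
  have hu1 : 1 ≤ 1 + ‖z‖ := by linarith [norm_nonneg z]
  have hp : 0 ≤ (1 + ‖z‖) ^ (3 / 2 : ℝ) := by positivity
  rcases le_or_gt 0 z.re with hz | hz
  · refine (key z hz).trans ?_
    rw [Real.exp_le_exp]
    nlinarith [mul_nonneg (by positivity : 0 ≤ A + 2 + C) hp]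
  · rw [← xi_one_sub]
    refine (key (1 - z) (by simp; linarith)).trans ?_
    rw [Real.exp_le_exp, mul_assoc]
    refine mul_le_mul_of_nonneg_left ?_ (by positivity)
    have h1 : 1 + ‖1 - z‖ ≤ 2 * (1 + ‖z‖) := by
      have := norm_sub_le 1 z; rw [norm_one] at this; linarith [norm_nonneg z]
    calc (1 + ‖1 - z‖) ^ (3 / 2 : ℝ) ≤ (2 * (1 + ‖z‖)) ^ (3 / 2 : ℝ) := by gcongr
      _ = 2 ^ (3 / 2 : ℝ) * (1 + ‖z‖) ^ (3 / 2 : ℝ) := Real.mul_rpow (by norm_num) (by positivity)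
      _ ≤ 4 * (1 + ‖z‖) ^ (3 / 2 : ℝ) := by
          gcongr
          calc (2 : ℝ) ^ (3 / 2 : ℝ) ≤ 2 ^ (2 : ℝ) :=
                Real.rpow_le_rpow_of_exponent_le (by norm_num) (by norm_num)
            _ = 4 := by norm_num

lemma xi_ne_zero_of_one_le {s : ℂ} (hs : 1 ≤ s.re) : xi s ≠ 0 := by
  by_cases h1 : s = 1
  · rw [h1, xi_one]; exact one_ne_zero
  have h0 : s ≠ 0 := by rintro rfl; simp at hs; linarith
  rw [xi_eq (by linarith) h1]
  refine mul_ne_zero (mul_ne_zero h0 (sub_ne_zero.2 h1)) (mul_ne_zero ?_ ?_)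
  · exact Gammaℝ_ne_zero_of_re_pos (by linarith)
  · exact riemannZeta_ne_zero_of_one_le_re hs

lemma xi_zero_strip {s : ℂ} (hs : xi s = 0) : 0 < s.re ∧ s.re < 1 := by
  constructor
  · by_contra! h
    refine xi_ne_zero_of_one_le (s := 1 - s) (by simp; exact h) ?_
    rw [xi_one_sub, hs]
  · by_contra! h
    exact xi_ne_zero_of_one_le h hs

lemma zeta_conj_of_one_lt {s : ℂ} (hs : 1 < s.re) : riemannZeta (conj s) = conj (riemannZeta s) := by
  rw [zeta_eq_tsum_one_div_nat_cpow hs, zeta_eq_tsum_one_div_nat_cpow (by simpa using hs), conj_tsum]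
  refine tsum_congr fun n => ?_
  rw [map_div₀, map_one, cpow_conj _ _ (by rw [natCast_arg]; exact Real.pi_pos.ne), conj_natCast]

lemma Gammaℝ_conj (s : ℂ) : Gammaℝ (conj s) = conj (Gammaℝ s) := by
  rw [Gammaℝ_def, Gammaℝ_def, map_mul, ← Gamma_conj, map_div₀]
  have : (conj 2 : ℂ) = 2 := map_ofNat _ 2
  have h2 : -(conj s) / 2 = conj (-s / 2) := by rw [map_div₀, map_neg, this]
  rw [this, h2, cpow_conj _ _ (by rw [arg_ofReal_of_nonneg Real.pi_pos.le]; exact Real.pi_pos.ne),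
    conj_ofReal]

lemma xi_conj (s : ℂ) : xi (conj s) = conj (xi s) := by
  have hd : Differentiable ℂ (conj ∘ xi ∘ conj) := fun z => by
    simpa using (xi_diff (conj z)).conj_conj
  have h1 : AnalyticOnNhd ℂ (conj ∘ xi ∘ conj) univ := fun z _ => hd.analyticAt z
  have h2 : AnalyticOnNhd ℂ xi univ := fun z _ => xi_diff.analyticAt z
  have h3 : (conj ∘ xi ∘ conj) =ᶠ[𝓝 (2 : ℂ)] xi := by
    have : {z : ℂ | 1 < z.re} ∈ 𝓝 (2 : ℂ) :=
      (isOpen_lt continuous_const continuous_re).mem_nhds (by simp)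
    filter_upwards [this] with z hz
    have hz : 1 < z.re := hz
    have hz1 : z ≠ 1 := by rintro rfl; simp at hz
    have hz1' : conj z ≠ 1 := by
      intro h; apply hz1; rw [← conj_conj z, h, map_one]
    simp only [Function.comp]
    rw [xi_eq (by simp; linarith) hz1', xi_eq (by linarith) hz1, zeta_conj_of_one_lt hz, Gammaℝ_conj]
    simp
  have := h1.eq_of_eventuallyEq h2 h3
  have := congrFun this (conj s)
  simp only [Function.comp, conj_conj] at this
  exact this.symm

/-- multiplicity of zeros of `ξ` -/
noncomputable def mu (ρ : ℂ) : ℝ := analyticOrderNatAt xi ρ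

lemma mu_nonneg (ρ : ℂ) : 0 ≤ mu ρ := Nat.cast_nonneg _

lemma xi_of_mu {ρ : ℂ} (h : mu ρ ≠ 0) : xi ρ = 0 :=
  apply_eq_zero_of_analyticOrderNatAt_ne_zero (by unfold mu at h; exact_mod_cast h)

lemma mu_strip {ρ : ℂ} (h : mu ρ ≠ 0) : 0 < ρ.re ∧ ρ.re < 1 := xi_zero_strip (xi_of_mu h)

lemma mu_one_le {ρ : ℂ} (h : xi ρ = 0) : 1 ≤ mu ρ := by
  unfold mu
  have h1 : analyticOrderAt xi ρ ≠ ⊤ := order_ne_top xi_diff (by rw [xi_zero]; exact one_ne_zero) ρ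
  have h2 : analyticOrderNatAt xi ρ ≠ 0 := by
    intro h3
    have h4 := Nat.cast_analyticOrderNatAt h1
    rw [h3] at h4
    have := analyticOrderAt_eq_zero.1 h4.symm
    rcases this with h5 | h5
    · exact h5 (xi_diff.analyticAt ρ)
    · exact h5 h
  exact_mod_cast Nat.one_le_iff_ne_zero.2 h2

lemma mu_one_sub (ρ : ℂ) : mu (1 - ρ) = mu ρ := by
  unfold mu
  congr 1
  have h : xi ∘ (fun z : ℂ => 1 - z) = xi := by ext z; exact xi_one_sub z
  unfold analyticOrderNatAt
  have h2 : analyticOrderAt (xi ∘ (fun z : ℂ => 1 - z)) ρ = analyticOrderAt xi (1 - ρ) :=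
    analyticOrderAt_comp_of_deriv_ne_zero (by fun_prop) (by simp)
  rw [← h2, h]

lemma mu_conj (ρ : ℂ) : mu (conj ρ) = mu ρ := by
  unfold mu
  congr 1
  have hnt : ∀ ρ, analyticOrderAt xi ρ ≠ ⊤ :=
    order_ne_top xi_diff (by rw [xi_zero]; exact one_ne_zero)
  rw [(xi_diff.analyticAt _).analyticOrderNatAt_eq_iff (hnt _)]
  obtain ⟨g, hg, hg0, hgz⟩ := ((xi_diff.analyticAt ρ).analyticOrderNatAt_eq_iff (hnt _)).1 rfl
  have ht : Tendsto conj (𝓝 (conj ρ)) (𝓝 ρ) := by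
    have := continuous_conj.tendsto (conj ρ); rwa [conj_conj] at this
  refine ⟨conj ∘ g ∘ conj, ?_, ?_, ?_⟩
  · rw [analyticAt_iff_eventually_differentiableAt] at hg ⊢
    filter_upwards [ht.eventually hg] with z hz
    simpa using hz.conj_conj
  · simpa using hg0
  · filter_upwards [ht.eventually hgz] with z hz
    rw [← conj_conj (xi z), ← xi_conj, hz]
    simp

end PNT
end

section
open Complex Filter Topology Metric MeasureTheory Set HurwitzZeta
open scoped ComplexConjugate

namespace PNT

lemma xi_zero_ne : xi 0 ≠ 0 := by rw [xi_zero]; exact one_ne_zero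

lemma logDeriv_xi_one_sub (z : ℂ) : logDeriv xi (1 - z) = - logDeriv xi z := by
  have h : (fun w : ℂ => xi (1 - w)) = xi := by ext w; exact xi_one_sub w
  have h2 : deriv xi z = - deriv xi (1 - z) := by
    conv_lhs => rw [← h]
    exact deriv_comp_const_sub (f := xi) 1 z
  rw [logDeriv_apply, logDeriv_apply, xi_one_sub, h2]
  ring

lemma hadamard_xi (z : ℂ) (hz : xi z ≠ 0) :
    Tendsto (fun R : ℝ => ∑ ρ ∈ zset xi_diff xi_zero_ne R,
      (mu ρ : ℂ) * (1 / (z - ρ) + 1 / (z - 1 + ρ))) atTop (𝓝 (2 * logDeriv xi z)) := by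
  obtain ⟨C, hC0, hC⟩ := xi_growth
  have hz' : xi (1 - z) ≠ 0 := by rwa [xi_one_sub]
  have := hadamard_tendsto xi_diff xi_zero_ne C hC hC0 hz hz'
  rw [logDeriv_xi_one_sub, sub_neg_eq_add, ← two_mul] at this
  refine this.congr fun R => Finset.sum_congr rfl fun ρ _ => ?_
  have : (1 : ℂ) / (1 - z - ρ) = - (1 / (z - 1 + ρ)) := by
    rw [← one_div_neg_eq_neg_one_div]; congr 1; ring
  rw [this]; simp [mu]

lemma re_one_div (w : ℂ) : (1 / w).re = w.re / ‖w‖ ^ 2 := by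
  rw [one_div, inv_re, normSq_eq_norm_sq]

lemma re_one_div_nonneg {w : ℂ} (h : 0 ≤ w.re) : 0 ≤ (1 / w).re := by
  rw [re_one_div]; positivity

lemma summable_mu_norm : Summable fun ρ : ℂ => mu ρ / ‖2 - ρ‖ ^ 2 := by
  have h := hadamard_xi 2 (xi_ne_zero_of_one_le (by simp))
  have hre := (continuous_re.tendsto _).comp h
  have hev := hre.eventually (eventually_le_nhds (lt_add_one _))
  refine summable_of_sum_le (fun ρ => div_nonneg (mu_nonneg ρ) (by positivity))
    (c := (2 * logDeriv xi 2).re + 1) fun u => ?_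
  obtain ⟨R, hR1, hR2⟩ := (hev.and (eventually_ge_atTop (∑ ρ ∈ u, ‖ρ‖))).exists
  refine le_trans ?_ hR1
  simp only [Function.comp, re_sum]
  have hterm : ∀ ρ, mu ρ / ‖2 - ρ‖ ^ 2 ≤
      ((mu ρ : ℂ) * (1 / (2 - ρ) + 1 / (2 - 1 + ρ))).re := by
    intro ρ
    by_cases hm : mu ρ = 0
    · simp [hm]
    obtain ⟨h0, h1⟩ := mu_strip hm
    rw [re_ofReal_mul, add_re, div_eq_mul_one_div]
    have h2 : 0 ≤ (1 / (2 - 1 + ρ)).re := re_one_div_nonneg (by norm_num; linarith)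
    have h3 : 1 / ‖2 - ρ‖ ^ 2 ≤ (1 / (2 - ρ)).re := by
      rw [re_one_div]; gcongr; simp; linarith
    refine mul_le_mul_of_nonneg_left (by linarith) (mu_nonneg ρ)
  have hnn : ∀ ρ, 0 ≤ mu ρ / ‖2 - ρ‖ ^ 2 := fun ρ => div_nonneg (mu_nonneg ρ) (by positivity)
  have h1 : ∑ ρ ∈ u, mu ρ / ‖2 - ρ‖ ^ 2 ≤
      ∑ ρ ∈ zset xi_diff xi_zero_ne R, mu ρ / ‖2 - ρ‖ ^ 2 := by
    rw [← Finset.sum_filter_ne_zero]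
    refine Finset.sum_le_sum_of_subset_of_nonneg (fun ρ hρ' => ?_) (fun ρ _ _ => hnn ρ)
    obtain ⟨hρ, hne⟩ := Finset.mem_filter.1 hρ'
    have hm : mu ρ ≠ 0 := by intro h; simp [h] at hne
    refine (mem_zset _ _ _ _).2 ⟨?_, xi_of_mu hm⟩
    exact (Finset.single_le_sum (f := fun ρ : ℂ => ‖ρ‖) (fun _ _ => norm_nonneg _) hρ).trans hR2
  exact h1.trans (Finset.sum_le_sum fun ρ _ => hterm ρ)

lemma tendsto_zset {E : Type*} [NormedAddCommGroup E] [CompleteSpace E] {g : ℂ → E}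
    (hg : Summable fun ρ => ‖g ρ‖)
    (h0 : ∀ ρ, xi ρ ≠ 0 → g ρ = 0) :
    Tendsto (fun R : ℝ => ∑ ρ ∈ zset xi_diff xi_zero_ne R, g ρ) atTop (𝓝 (∑' ρ, g ρ)) := by
  have h1 : ∀ R : ℝ, ∑ ρ ∈ zset xi_diff xi_zero_ne R, g ρ =
      ∑' ρ, (if ρ ∈ zset xi_diff xi_zero_ne R then g ρ else 0) := by
    intro R
    rw [tsum_eq_sum (s := zset xi_diff xi_zero_ne R) (by intro b hb; simp [hb])]
    refine Finset.sum_congr rfl fun b hb => by simp [hb]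
  simp_rw [h1]
  refine tendsto_tsum_of_dominated_convergence hg ?_ ?_
  · intro ρ
    refine tendsto_const_nhds.congr' ?_
    filter_upwards [eventually_ge_atTop ‖ρ‖] with R hR
    by_cases hρ : xi ρ = 0
    · rw [if_pos ((mem_zset _ _ _ _).2 ⟨hR, hρ⟩)]
    · rw [h0 ρ hρ]; simp
  · refine Eventually.of_forall fun R ρ => ?_
    split_ifs
    · exact le_rfl
    · simp

lemma mu_eq_zero {ρ : ℂ} (h : xi ρ ≠ 0) : mu ρ = 0 := by
  by_contra h2; exact h (xi_of_mu h2)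

lemma norm_sub_lower {z ρ : ℂ} (hz : 1 < z.re) (h : ρ.re < 1) :
    ‖2 - ρ‖ ≤ ‖z - ρ‖ * (1 + ‖2 - z‖ / (z.re - 1)) := by
  have h1 : z.re - 1 ≤ ‖z - ρ‖ := by
    have := re_le_norm (z - ρ); rw [sub_re] at this; linarith
  have h2 : ‖2 - ρ‖ ≤ ‖2 - z‖ + ‖z - ρ‖ := by
    have := norm_add_le (2 - z) (z - ρ); rwa [show 2 - z + (z - ρ) = 2 - ρ by ring] at this
  have h3 : ‖2 - z‖ ≤ ‖z - ρ‖ * (‖2 - z‖ / (z.re - 1)) := by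
    have h4 : 0 < z.re - 1 := by linarith
    rw [mul_div_assoc', le_div_iff₀ h4, mul_comm]
    gcongr
  linarith

lemma pair_bound {z : ℂ} (hz : 1 < z.re) (ρ : ℂ) :
    ‖(mu ρ : ℂ) * (1 / (z - ρ) + 1 / (z - 1 + ρ))‖ ≤
      ‖2 * z - 1‖ * (1 + ‖2 - z‖ / (z.re - 1)) * (1 + ‖1 + z‖ / (z.re - 1)) *
        (mu ρ / ‖2 - ρ‖ ^ 2) := by
  set a := 1 + ‖2 - z‖ / (z.re - 1)
  have hz1 : 0 < z.re - 1 := by linarith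
  have ha : 0 < a := by positivity
  set b := 1 + ‖1 + z‖ / (z.re - 1)
  have hb : 0 < b := by positivity
  by_cases hm : mu ρ = 0
  · simp [hm]
  obtain ⟨h0, h1⟩ := mu_strip hm
  have k1 := norm_sub_lower hz h1
  have k2 : ‖2 - ρ‖ ≤ ‖z - 1 + ρ‖ * b := by
    have h1 : z.re - 1 ≤ ‖z - 1 + ρ‖ := by
      have := re_le_norm (z - 1 + ρ); simp at this; linarith
    have h2 : ‖2 - ρ‖ ≤ ‖1 + z‖ + ‖z - 1 + ρ‖ := by
      have := norm_sub_le (1 + z) (z - 1 + ρ)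
      rwa [show 1 + z - (z - 1 + ρ) = 2 - ρ by ring] at this
    have h3 : ‖1 + z‖ ≤ ‖z - 1 + ρ‖ * (‖1 + z‖ / (z.re - 1)) := by
      rw [mul_div_assoc', le_div_iff₀ hz1, mul_comm]
      gcongr
    simp only [b]; linarith
  have n0 : 0 < ‖2 - ρ‖ := by
    rw [norm_pos_iff]; intro h; have := congrArg re h; simp at this; linarith
  have n1 : 0 < ‖z - ρ‖ := by
    rw [norm_pos_iff]; intro h; have := congrArg re h; simp at this; linarith
  have n2 : 0 < ‖z - 1 + ρ‖ := by
    rw [norm_pos_iff]; intro h; have := congrArg re h; simp at this; linarith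
  have e : 1 / (z - ρ) + 1 / (z - 1 + ρ) = (2 * z - 1) / ((z - ρ) * (z - 1 + ρ)) := by
    have e1 := norm_pos_iff.1 n1
    have e2 := norm_pos_iff.1 n2
    field_simp; ring
  rw [e, norm_mul, norm_div, norm_mul, norm_real, Real.norm_of_nonneg (mu_nonneg ρ)]
  rw [mul_div_assoc', mul_div_assoc', div_le_div_iff₀ (by positivity) (by positivity)]
  have k3 : ‖2 - ρ‖ ^ 2 ≤ (‖z - ρ‖ * a) * (‖z - 1 + ρ‖ * b) := by
    rw [pow_two]; gcongr
  have := mu_nonneg ρ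
  calc mu ρ * ‖2 * z - 1‖ * ‖2 - ρ‖ ^ 2
      ≤ mu ρ * ‖2 * z - 1‖ * ((‖z - ρ‖ * a) * (‖z - 1 + ρ‖ * b)) := by gcongr
    _ = _ := by ring

lemma summable_pair {z : ℂ} (hz : 1 < z.re) :
    Summable fun ρ : ℂ => ‖(mu ρ : ℂ) * (1 / (z - ρ) + 1 / (z - 1 + ρ))‖ :=
  Summable.of_nonneg_of_le (fun _ => norm_nonneg _) (fun ρ => pair_bound hz ρ)
    (summable_mu_norm.mul_left _)

theorem logDeriv_xi {z : ℂ} (hz : 1 < z.re) :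
    logDeriv xi z = 1 / 2 * ∑' ρ : ℂ, (mu ρ : ℂ) * (1 / (z - ρ) + 1 / (z - 1 + ρ)) := by
  have h1 := hadamard_xi z (xi_ne_zero_of_one_le hz.le)
  have h2 := tendsto_zset (summable_pair hz) (fun ρ h => by simp [mu_eq_zero h])
  rw [← tendsto_nhds_unique h1 h2]; ring

lemma re_term_nonneg {z ρ : ℂ} (hz : 1 < z.re) : 0 ≤ mu ρ * (1 / (z - ρ)).re := by
  by_cases hm : mu ρ = 0
  · simp [hm]
  obtain ⟨h0, h1⟩ := mu_strip hm
  exact mul_nonneg (mu_nonneg ρ) (re_one_div_nonneg (by simp; linarith))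

lemma re_term_nonneg' {z ρ : ℂ} (hz : 1 < z.re) : 0 ≤ mu ρ * (1 / (z - 1 + ρ)).re := by
  by_cases hm : mu ρ = 0
  · simp [hm]
  obtain ⟨h0, h1⟩ := mu_strip hm
  exact mul_nonneg (mu_nonneg ρ) (re_one_div_nonneg (by simp; linarith))

lemma summable_re_pair {z : ℂ} (hz : 1 < z.re) :
    Summable fun ρ : ℂ => mu ρ * (1 / (z - ρ)).re + mu ρ * (1 / (z - 1 + ρ)).re := by
  have := (hasSum_re (summable_pair hz).of_norm.hasSum).summable
  refine this.congr fun ρ => ?_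
  rw [re_ofReal_mul, add_re]; ring

lemma summable_re {z : ℂ} (hz : 1 < z.re) : Summable fun ρ : ℂ => mu ρ * (1 / (z - ρ)).re :=
  Summable.of_nonneg_of_le (fun _ => re_term_nonneg hz)
    (fun _ => le_add_of_nonneg_right (re_term_nonneg' hz)) (summable_re_pair hz)

theorem re_logDeriv_xi {z : ℂ} (hz : 1 < z.re) :
    (logDeriv xi z).re = ∑' ρ : ℂ, mu ρ * (1 / (z - ρ)).re := by
  have h2 : Summable fun ρ : ℂ => mu ρ * (1 / (z - 1 + ρ)).re :=
    Summable.of_nonneg_of_le (fun _ => re_term_nonneg' hz)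
      (fun _ => le_add_of_nonneg_left (re_term_nonneg hz)) (summable_re_pair hz)
  have e : ∑' ρ : ℂ, mu ρ * (1 / (z - 1 + ρ)).re = ∑' ρ : ℂ, mu ρ * (1 / (z - ρ)).re := by
    rw [← (Equiv.subLeft (1 : ℂ)).tsum_eq]
    refine tsum_congr fun ρ => ?_
    simp only [Equiv.subLeft_apply, mu_one_sub]
    rw [show z - 1 + (1 - ρ) = z - ρ by ring]
  rw [logDeriv_xi hz, show (1 / 2 : ℂ) = ((1 / 2 : ℝ) : ℂ) by simp, re_ofReal_mul,
    re_tsum (summable_pair hz).of_norm]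
  have : ∀ ρ : ℂ, ((mu ρ : ℂ) * (1 / (z - ρ) + 1 / (z - 1 + ρ))).re =
      mu ρ * (1 / (z - ρ)).re + mu ρ * (1 / (z - 1 + ρ)).re := fun ρ => by
    rw [re_ofReal_mul, add_re]; ring
  simp_rw [this]
  rw [(summable_re hz).tsum_add h2, e]; ring

end PNT
end

section
open Complex Filter Topology Metric MeasureTheory Set

namespace PNT

/-- terms of the Weierstrass series of `log Γ(1+s)` -/
noncomputable def lgT (n : ℕ) (s : ℂ) : ℂ := s / (n + 1) - log (1 + s / (n + 1))

lemma one_add_re_pos (n : ℕ) {s : ℂ} (hs : -(1 / 2) < s.re) : 0 < (1 + s / (n + 1)).re := by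
  have : s / (n + 1) = ((1 / ((n : ℝ) + 1) : ℝ) : ℂ) * s := by push_cast; ring
  rw [this, add_re, re_ofReal_mul, one_re]
  have h1 : 0 < 1 / ((n : ℝ) + 1) := by positivity
  have h2 : 1 / ((n : ℝ) + 1) ≤ 1 := by
    rw [div_le_one (by positivity)]; linarith [(Nat.cast_nonneg n : (0 : ℝ) ≤ n)]
  nlinarith

lemma nat_add_re_pos (n : ℕ) {s : ℂ} (hs : -(1 / 2) < s.re) : ((n : ℝ) + 1) / 2 ≤ ‖(n : ℂ) + 1 + s‖ := by
  have := re_le_norm ((n : ℂ) + 1 + s)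
  simp at this
  linarith [(Nat.cast_nonneg n : (0 : ℝ) ≤ n)]

lemma nat_ne (n : ℕ) : (n : ℂ) + 1 ≠ 0 := by exact_mod_cast Nat.succ_ne_zero n

lemma nat_add_ne (n : ℕ) {s : ℂ} (hs : -(1 / 2) < s.re) : (n : ℂ) + 1 + s ≠ 0 := by
  have := nat_add_re_pos n hs
  rw [← norm_pos_iff]
  have : (0 : ℝ) < ((n : ℝ) + 1) / 2 := by positivity
  linarith

lemma lgT_deriv (n : ℕ) {s : ℂ} (hs : -(1 / 2) < s.re) :
    HasDerivAt (lgT n) (1 / ((n : ℂ) + 1) - 1 / ((n : ℂ) + 1 + s)) s := by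
  have h1 : HasDerivAt (fun s : ℂ => s / ((n : ℂ) + 1)) (1 / ((n : ℂ) + 1)) s :=
    (hasDerivAt_id s).div_const _
  have h2 := (h1.const_add 1).clog (Or.inl (one_add_re_pos n hs))
  have h3 := h1.sub h2
  refine h3.congr_deriv ?_
  congr 1
  have := nat_ne n
  have := nat_add_ne n hs
  rw [show 1 + s / ((n : ℂ) + 1) = ((n : ℂ) + 1 + s) / ((n : ℂ) + 1) by field_simp]
  field_simp

lemma dg_bound (n : ℕ) {s : ℂ} (hs : -(1 / 2) < s.re) :
    ‖1 / ((n : ℂ) + 1) - 1 / ((n : ℂ) + 1 + s)‖ ≤ 2 * ‖s‖ * (1 / ((n : ℝ) + 1) ^ 2) := by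
  have h1 := nat_ne n
  have h2 := nat_add_ne n hs
  rw [div_sub_div _ _ h1 h2, show 1 * ((n : ℂ) + 1 + s) - ((n : ℂ) + 1) * 1 = s by ring, norm_div,
    norm_mul]
  have h3 : ‖(n : ℂ) + 1‖ = (n : ℝ) + 1 := by
    rw [show (n : ℂ) + 1 = ((n + 1 : ℕ) : ℂ) by push_cast; ring, norm_natCast]; push_cast; ring
  rw [h3, mul_one_div]
  have h4 := nat_add_re_pos n hs
  rw [div_le_div_iff₀ (by have : 0 < ‖(n : ℂ) + 1 + s‖ := norm_pos_iff.2 h2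
                          positivity) (by positivity)]
  have : 0 ≤ ‖s‖ * ((n : ℝ) + 1) := by positivity
  nlinarith

lemma summable_inv_sq : Summable fun n : ℕ => 1 / ((n : ℝ) + 1) ^ 2 := by
  have := (summable_nat_add_iff 1).2 (Real.summable_one_div_nat_pow.2 (by norm_num : 1 < 2))
  simpa using this

lemma lgT_main {s : ℂ} (hs : -(1 / 2) < s.re) :
    HasDerivAt (fun z => ∑' n, lgT n z) (∑' n : ℕ, (1 / ((n : ℂ) + 1) - 1 / ((n : ℂ) + 1 + s))) s ∧
    Summable fun n => lgT n s := by
  set B := ‖s‖ + 1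
  set t : Set ℂ := {z | -(1 / 2) < z.re} ∩ ball 0 B
  have ht : IsOpen t := (isOpen_lt continuous_const continuous_re).inter isOpen_ball
  have htc : IsPreconnected t := by
    refine Convex.isPreconnected (Convex.inter ?_ (convex_ball _ _))
    exact convex_halfSpace_re_gt _
  have hu : Summable fun n : ℕ => 2 * B * (1 / ((n : ℝ) + 1) ^ 2) := summable_inv_sq.mul_left _
  have hb : ∀ (n : ℕ) z, z ∈ t → ‖1 / ((n : ℂ) + 1) - 1 / ((n : ℂ) + 1 + z)‖ ≤
      2 * B * (1 / ((n : ℝ) + 1) ^ 2) := by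
    intro n z hz
    refine (dg_bound n hz.1).trans ?_
    have : ‖z‖ ≤ B := by have := hz.2; rw [mem_ball_zero_iff] at this; exact this.le
    gcongr
  have h0 : (0 : ℂ) ∈ t := ⟨by simp, by simp [B]; positivity⟩
  have hst : s ∈ t := ⟨hs, by simp [B]⟩
  have hs0 : Summable fun n => lgT n 0 := by simp [lgT]
  exact ⟨hasDerivAt_tsum_of_isPreconnected hu ht htc (fun n z hz => lgT_deriv n hz.1) hb h0 hs0 hst,
    summable_of_summable_hasDerivAt_of_isPreconnected hu ht htc
      (fun n z hz => lgT_deriv n hz.1) hb h0 hs0 hst⟩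

lemma exp_lg {s : ℂ} (hs : 0 < s.re) :
    Gamma (s + 1) = exp (-Real.eulerMascheroniConstant * s + ∑' n, lgT n s) := by
  have hs' : -(1 / 2) < s.re := by linarith
  have hs0 : s ≠ 0 := by rintro rfl; simp at hs
  rw [Gamma_add_one s hs0]
  have h1 : Tendsto (fun n => s * GammaSeq s n) atTop (𝓝 (s * Gamma s)) :=
    (GammaSeq_tendsto_Gamma s).const_mul s
  have h2 : Tendsto (fun n : ℕ => -((harmonic n : ℝ) - Real.log n : ℝ) * s +
      ∑ j ∈ Finset.range n, lgT j s) atTop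
      (𝓝 (-Real.eulerMascheroniConstant * s + ∑' n, lgT n s)) := by
    refine Tendsto.add (Tendsto.mul_const s ?_) (lgT_main hs').2.hasSum.tendsto_sum_nat
    exact ((continuous_ofReal.tendsto _).comp Real.tendsto_harmonic_sub_log).neg
  have h3 := (continuous_exp.tendsto _).comp h2
  refine tendsto_nhds_unique h1 (h3.congr' ?_)
  filter_upwards [eventually_gt_atTop 0] with n hn
  simp only [Function.comp]
  have e1 : exp (∑ j ∈ Finset.range n, lgT j s) =
      exp (s * (harmonic n : ℝ)) / ∏ j ∈ Finset.range n, (1 + s / (j + 1)) := by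
    simp only [lgT, Finset.sum_sub_distrib]
    rw [exp_sub, exp_sum (Finset.range n) (fun j : ℕ => log (1 + s / ((j : ℂ) + 1)))]
    congr 1
    · congr 1
      rw [harmonic]; push_cast; rw [Finset.mul_sum]
      exact Finset.sum_congr rfl fun _ _ => rfl
    · refine Finset.prod_congr rfl fun j _ => exp_log ?_
      intro h; have := one_add_re_pos j hs'; rw [h] at this; simp at this
  have hn0 : (n : ℂ) ≠ 0 := by exact_mod_cast hn.ne'
  rw [exp_add, e1, GammaSeq, Finset.prod_range_succ', cpow_def_of_ne_zero hn0]
  have e2 : ∏ j ∈ Finset.range n, (1 + s / ((j : ℂ) + 1)) =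
      (∏ j ∈ Finset.range n, (s + ((j + 1 : ℕ) : ℂ))) / (n.factorial : ℂ) := by
    rw [← Finset.prod_range_add_one_eq_factorial]
    push_cast
    rw [← Finset.prod_div_distrib]
    refine Finset.prod_congr rfl fun j _ => ?_
    have := nat_ne j
    field_simp; ring
  rw [e2]
  have e3 : exp (-((harmonic n : ℝ) - Real.log n : ℝ) * s) * exp (s * (harmonic n : ℝ)) =
      exp (log n * s) := by
    rw [← exp_add]; congr 1
    rw [← natCast_log]; push_cast; ring
  rw [← mul_div_assoc, e3]
  have hp : ∏ j ∈ Finset.range n, (s + ((j + 1 : ℕ) : ℂ)) ≠ 0 := by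
    rw [Finset.prod_ne_zero_iff]; intro j _
    have := nat_add_ne j hs'
    push_cast; rwa [add_comm s]
  have hf : (n.factorial : ℂ) ≠ 0 := by exact_mod_cast n.factorial_ne_zero
  simp only [CharP.cast_eq_zero, add_zero]
  field_simp

theorem digamma_series {s : ℂ} (hs : 0 < s.re) :
    digamma (s + 1) = -Real.eulerMascheroniConstant +
      ∑' n : ℕ, (1 / ((n : ℂ) + 1) - 1 / ((n : ℂ) + 1 + s)) := by
  have h1 := (((hasDerivAt_id s).const_mul (-(Real.eulerMascheroniConstant : ℂ))).add
    (lgT_main (s := s) (by linarith)).1).cexp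
  have h2 : (fun z => Gamma (z + 1)) =ᶠ[𝓝 s]
      fun z => exp (-Real.eulerMascheroniConstant * z + ∑' n, lgT n z) := by
    filter_upwards [(isOpen_lt continuous_const continuous_re).mem_nhds hs] with z hz
    exact exp_lg hz
  have h3 := h1.congr_of_eventuallyEq h2
  have h4 : deriv (fun z => Gamma (z + 1)) s = deriv Gamma (s + 1) := deriv_comp_add_const Gamma 1 s
  rw [digamma_def, logDeriv_apply, ← h4, h3.deriv, exp_lg hs]
  simp only [id, Pi.add_apply, mul_one]
  field_simp [exp_ne_zero]

lemma digamma_summable {s : ℂ} (hs : 0 < s.re) :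
    Summable fun n : ℕ => (1 / ((n : ℂ) + 1) - 1 / ((n : ℂ) + 1 + s)) :=
  Summable.of_norm_bounded (summable_inv_sq.mul_left (2 * ‖s‖)) fun n => dg_bound n (by linarith)

end PNT
end

section
open Complex Filter Topology Metric MeasureTheory Set

namespace PNT

lemma re_inv_add (n : ℕ) (s : ℂ) : (1 / ((n : ℂ) + 1) - 1 / ((n : ℂ) + 1 + s)).re =
    1 / ((n : ℝ) + 1) - ((n : ℝ) + 1 + s.re) / (((n : ℝ) + 1 + s.re) ^ 2 + s.im ^ 2) := by
  rw [sub_re]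
  congr 1
  · rw [show (1 : ℂ) / ((n : ℂ) + 1) = ((1 / ((n : ℝ) + 1) : ℝ) : ℂ) by push_cast; rfl, ofReal_re]
  · rw [re_one_div, ← normSq_eq_norm_sq, normSq_apply]; simp; ring_nf

lemma digamma_re_le_of_partial {s : ℂ} (hs : 0 < s.re) (G : ℝ)
    (h : ∀ N : ℕ, 0 < N → ∑ n ∈ Finset.range N, (1 / ((n : ℂ) + 1) - 1 / ((n : ℂ) + 1 + s)).re ≤
      (harmonic N : ℝ) - Real.log N + G) : (digamma (s + 1)).re ≤ G := by
  rw [digamma_series hs, add_re, re_tsum (digamma_summable hs)]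
  have h1 := (hasSum_re (digamma_summable hs).hasSum).summable.hasSum.tendsto_sum_nat
  have h2 := Real.tendsto_harmonic_sub_log.add_const G
  have h3 : ∑' n : ℕ, (1 / ((n : ℂ) + 1) - 1 / ((n : ℂ) + 1 + s)).re ≤
      Real.eulerMascheroniConstant + G := by
    refine le_of_tendsto_of_tendsto h1 h2 ?_
    filter_upwards [eventually_gt_atTop 0] with N hN
    exact h N hN
  simp only [neg_re, ofReal_re] at *
  linarith

lemma digamma_re_le {s : ℂ} (hs : 0 < s.re) (hy : 0 < s.im) :
    (digamma (s + 1)).re ≤ Real.log ((1 + s.re) ^ 2 + s.im ^ 2) / 2 + 1 / (s.re + s.im) := by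
  set x := s.re
  set y := s.im
  refine digamma_re_le_of_partial hs _ fun N hN => ?_
  have key : ∀ M : ℕ, ∑ n ∈ Finset.range M, (1 / ((n : ℂ) + 1) - 1 / ((n : ℂ) + 1 + s)).re ≤
      (harmonic M : ℝ) - Real.log (((M : ℝ) + 1 + x) ^ 2 + y ^ 2) / 2 +
        Real.log ((1 + x) ^ 2 + y ^ 2) / 2 + (1 / (x + y) - 1 / (M + x + y)) := by
    intro M
    induction M with
    | zero => simp
    | succ M ih =>
      rw [Finset.sum_range_succ, harmonic_succ, re_inv_add]
      push_cast
      set u : ℝ := (M : ℝ) + 1 + x with hu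
      have hM : (0 : ℝ) ≤ M := Nat.cast_nonneg M
      have hu0 : 1 < u := by simp only [hu]; linarith
      have e1 : (M : ℝ) + 1 + 1 + x = u + 1 := by simp only [hu]; ring
      have e2 : (M : ℝ) + 1 + x + y = u + y := by simp only [hu]
      have e3 : (M : ℝ) + x + y = u + y - 1 := by simp only [hu]; ring
      rw [e3] at ih
      rw [e1, e2]
      have hq : 0 < u ^ 2 + y ^ 2 := by positivity
      have h1 : Real.log ((u + 1) ^ 2 + y ^ 2) - Real.log (u ^ 2 + y ^ 2) ≤
          (2 * u + 1) / (u ^ 2 + y ^ 2) := by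
        rw [← Real.log_div (by positivity) hq.ne']
        refine (Real.log_le_sub_one_of_pos (by positivity)).trans (le_of_eq ?_)
        field_simp; ring
      have h2 : 1 / (u ^ 2 + y ^ 2) / 2 ≤ 1 / (u + y - 1) - 1 / (u + y) := by
        have h3 : 0 < u + y - 1 := by linarith
        rw [div_sub_div _ _ h3.ne' (by positivity), div_div, div_le_div_iff₀ (by positivity) (by positivity)]
        nlinarith [sq_nonneg (u - y)]
      have h4 : (2 * u + 1) / (u ^ 2 + y ^ 2) = 2 * (u / (u ^ 2 + y ^ 2)) + 1 / (u ^ 2 + y ^ 2) := by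
        field_simp
      have h5 : (1 : ℝ) / ((M : ℝ) + 1) = ((M : ℝ) + 1)⁻¹ := one_div _
      rw [h5]
      linarith
  refine (key N).trans ?_
  have hN' : (0 : ℝ) < N := by exact_mod_cast hN
  have h1 : Real.log N ≤ Real.log (((N : ℝ) + 1 + x) ^ 2 + y ^ 2) / 2 := by
    have : Real.log ((N : ℝ) ^ 2) ≤ Real.log (((N : ℝ) + 1 + x) ^ 2 + y ^ 2) := by
      refine Real.log_le_log (by positivity) ?_
      have : (N : ℝ) ^ 2 ≤ ((N : ℝ) + 1 + x) ^ 2 := by gcongr; linarith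
      nlinarith [sq_nonneg y]
    rw [Real.log_pow] at this; push_cast at this; linarith
  have h2 : 0 ≤ 1 / ((N : ℝ) + x + y) := by positivity
  linarith

lemma digamma_real_le {x : ℝ} (hx : 0 < x) :
    (digamma ((x : ℂ) + 1)).re ≤ Real.log (1 + x) := by
  refine digamma_re_le_of_partial (by simpa using hx) _ fun N hN => ?_
  have key : ∀ M : ℕ, ∑ n ∈ Finset.range M, (1 / ((n : ℂ) + 1) - 1 / ((n : ℂ) + 1 + (x : ℂ))).re ≤
      (harmonic M : ℝ) - Real.log ((M : ℝ) + 1 + x) + Real.log (1 + x) := by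
    intro M
    induction M with
    | zero => simp
    | succ M ih =>
      rw [Finset.sum_range_succ, harmonic_succ, re_inv_add]
      push_cast
      simp only [ofReal_re, ofReal_im]
      set u : ℝ := (M : ℝ) + 1 + x with hu
      have hM : (0 : ℝ) ≤ M := Nat.cast_nonneg M
      have hu0 : 1 < u := by simp only [hu]; linarith
      have e1 : (M : ℝ) + 1 + 1 + x = u + 1 := by simp only [hu]; ring
      rw [e1]
      have h1 : Real.log (u + 1) - Real.log u ≤ 1 / u := by
        rw [← Real.log_div (by positivity) (by positivity)]
        refine (Real.log_le_sub_one_of_pos (by positivity)).trans (le_of_eq ?_)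
        field_simp; ring
      have h4 : u / (u ^ 2 + 0 ^ 2) = 1 / u := by field_simp; ring
      have h5 : (1 : ℝ) / ((M : ℝ) + 1) = ((M : ℝ) + 1)⁻¹ := one_div _
      rw [h4, h5]
      linarith
  refine (key N).trans ?_
  have hN' : (0 : ℝ) < N := by exact_mod_cast hN
  have h1 : Real.log N ≤ Real.log ((N : ℝ) + 1 + x) := Real.log_le_log hN' (by linarith)
  linarith

open ArithmeticFunction in
theorem vonMangoldt_formula {s : ℂ} (hs : 1 < s.re) :
    LSeries (fun n => (vonMangoldt n : ℂ)) s = 1 / (s - 1) - (Real.log Real.pi / 2 : ℝ) +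
      1 / 2 * digamma (s / 2 + 1) - logDeriv xi s := by
  have hs1 : s ≠ 1 := by rintro rfl; simp at hs
  have hs0 : s ≠ 0 := by rintro rfl; simp at hs; linarith
  have hζ := riemannZeta_ne_zero_of_one_le_re hs.le
  have hpi : (Real.pi : ℂ) ≠ 0 := by exact_mod_cast Real.pi_ne_zero
  have hre : 0 < (s / 2 + 1).re := by
    rw [show s / 2 = ((1 / 2 : ℝ) : ℂ) * s by push_cast; ring, add_re, re_ofReal_mul]
    simp; linarith
  have hΓ : Gamma (s / 2 + 1) ≠ 0 := Gamma_ne_zero_of_re_pos hre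
  have hΓd : DifferentiableAt ℂ Gamma (s / 2 + 1) := differentiableAt_Gamma _ (by
    intro m h; rw [h] at hre; simp at hre; linarith [(Nat.cast_nonneg m : (0 : ℝ) ≤ m)])
  have e : xi =ᶠ[𝓝 s] fun z => 2 * ((z - 1) * ((Real.pi : ℂ) ^ (-z / 2) *
      (Gamma (z / 2 + 1) * riemannZeta z))) := by
    filter_upwards [(isOpen_lt continuous_const continuous_re).mem_nhds hs] with z hz
    have hz : 1 < z.re := hz
    have hz1 : z ≠ 1 := by rintro rfl; simp at hz
    have hz0 : z ≠ 0 := by rintro rfl; simp at hz; linarith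
    rw [xi_eq (by linarith) hz1, Gammaℝ_def, Gamma_add_one (z / 2) (by simpa using hz0)]
    ring
  have hd1 : HasDerivAt (fun z : ℂ => z - 1) 1 s := (hasDerivAt_id s).sub_const 1
  have hd2 : HasDerivAt (fun z : ℂ => (Real.pi : ℂ) ^ (-z / 2))
      ((Real.pi : ℂ) ^ (-s / 2) * log Real.pi * (-1 / 2)) s := by
    have := (((hasDerivAt_id s).neg).div_const 2).const_cpow (c := (Real.pi : ℂ)) (Or.inl hpi)
    simpa using this
  have hd3 : HasDerivAt (fun z : ℂ => Gamma (z / 2 + 1)) (deriv Gamma (s / 2 + 1) * (1 / 2)) s := by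
    have h1 : HasDerivAt (fun z : ℂ => z / 2 + 1) (1 / 2) s :=
      ((hasDerivAt_id s).div_const 2).add_const 1
    exact hΓd.hasDerivAt.comp s h1
  have hd4 : HasDerivAt riemannZeta (deriv riemannZeta s) s :=
    (differentiableAt_riemannZeta hs1).hasDerivAt
  have hd := ((hd1.mul (hd2.mul (hd3.mul hd4))).const_mul 2).congr_of_eventuallyEq e
  rw [ArithmeticFunction.LSeries_vonMangoldt_eq_deriv_riemannZeta_div hs, logDeriv_apply, hd.deriv,
    e.eq_of_nhds, digamma_def, logDeriv_apply]
  have hs1' : s - 1 ≠ 0 := sub_ne_zero.2 hs1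
  have hpp : (Real.pi : ℂ) ^ (-s / 2) ≠ 0 := by rw [Ne, cpow_eq_zero_iff]; tauto
  have : ((Real.log Real.pi / 2 : ℝ) : ℂ) = log Real.pi / 2 := by
    push_cast; rw [ofReal_log Real.pi_pos.le]
  rw [this]
  simp only [Pi.mul_apply]
  generalize Gamma (s / 2 + 1) = A at *
  generalize deriv Gamma (s / 2 + 1) = A' at *
  generalize (Real.pi : ℂ) ^ (-s / 2) = B at *
  field_simp
  ring

end PNT
end

section
open Complex Filter Topology Metric MeasureTheory Set

namespace PNT

lemma log_lo {a b x c : ℝ} (n : ℕ) (hb : 0 < b) (hx : x = (a - b) / (a + b)) (hab : b ≤ a)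
    (hc : c ≤ 2 * ∑ i ∈ Finset.range n, x ^ (2 * i + 1) / (2 * i + 1)) :
    Real.log b + c ≤ Real.log a := by
  have ha : 0 < a := by linarith
  have h0 : 0 ≤ x := by rw [hx]; exact div_nonneg (by linarith) (by linarith)
  have h1 : x < 1 := by rw [hx, div_lt_one (by linarith)]; linarith
  have := Real.sum_range_le_log_div h0 h1 n
  have e : (1 + x) / (1 - x) = a / b := by
    have hs : a + b ≠ 0 := by linarith
    have e1 : 1 + x = 2 * a / (a + b) := by rw [hx]; field_simp; ring
    have e2 : 1 - x = 2 * b / (a + b) := by rw [hx]; field_simp; ring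
    rw [e1, e2, div_div_div_cancel_right₀ hs, mul_div_mul_left _ _ two_ne_zero]
  rw [e, Real.log_div ha.ne' hb.ne'] at this
  linarith

lemma log_hi {a b x c : ℝ} (n : ℕ) (hb : 0 < b) (hx : x = (a - b) / (a + b)) (hab : b ≤ a)
    (hc : 2 * ((∑ i ∈ Finset.range n, x ^ (2 * i + 1) / (2 * i + 1)) + x ^ (2 * n + 1) / (1 - x ^ 2)) ≤ c) :
    Real.log a ≤ Real.log b + c := by
  have ha : 0 < a := by linarith
  have h0 : 0 ≤ x := by rw [hx]; exact div_nonneg (by linarith) (by linarith)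
  have h1 : x < 1 := by rw [hx, div_lt_one (by linarith)]; linarith
  have := Real.log_div_le_sum_range_add h0 h1 n
  have e : (1 + x) / (1 - x) = a / b := by
    have hs : a + b ≠ 0 := by linarith
    have e1 : 1 + x = 2 * a / (a + b) := by rw [hx]; field_simp; ring
    have e2 : 1 - x = 2 * b / (a + b) := by rw [hx]; field_simp; ring
    rw [e1, e2, div_div_div_cancel_right₀ hs, mul_div_mul_left _ _ two_ne_zero]
  rw [e, Real.log_div ha.ne' hb.ne'] at this
  linarith

lemma log2_lo : (0.6931471 : ℝ) < Real.log 2 := by have := Real.log_two_gt_d9; linarith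
lemma log2_hi : Real.log 2 < (0.6931472 : ℝ) := by have := Real.log_two_lt_d9; linarith
lemma log4_eq : Real.log 4 = 2 * Real.log 2 := by
  rw [show (4 : ℝ) = 2 ^ 2 by norm_num, Real.log_pow]; norm_num
lemma log8_eq : Real.log 8 = 3 * Real.log 2 := by
  rw [show (8 : ℝ) = 2 ^ 3 by norm_num, Real.log_pow]; norm_num
lemma log16_eq : Real.log 16 = 4 * Real.log 2 := by
  rw [show (16 : ℝ) = 2 ^ 4 by norm_num, Real.log_pow]; norm_num
lemma log32_eq : Real.log 32 = 5 * Real.log 2 := by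
  rw [show (32 : ℝ) = 2 ^ 5 by norm_num, Real.log_pow]; norm_num

lemma log3_lo : (1.098612 : ℝ) < Real.log 3 := by
  have := log_lo (a := 3) (b := 2) (x := 1 / 5) (c := 0.4054650) 5 (by norm_num) (by norm_num)
    (by norm_num) (by norm_num [Finset.sum_range_succ])
  linarith [log2_lo]
lemma log3_hi : Real.log 3 < (1.098613 : ℝ) := by
  have := log_hi (a := 3) (b := 2) (x := 1 / 5) (c := 0.4054655) 5 (by norm_num) (by norm_num)
    (by norm_num) (by norm_num [Finset.sum_range_succ])
  linarith [log2_hi]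
lemma log5_lo : (1.609437 : ℝ) < Real.log 5 := by
  have := log_lo (a := 5) (b := 4) (x := 1 / 9) (c := 0.2231433) 4 (by norm_num) (by norm_num)
    (by norm_num) (by norm_num [Finset.sum_range_succ])
  linarith [log2_lo, log4_eq]
lemma log5_hi : Real.log 5 < (1.609439 : ℝ) := by
  have := log_hi (a := 5) (b := 4) (x := 1 / 9) (c := 0.2231437) 4 (by norm_num) (by norm_num)
    (by norm_num) (by norm_num [Finset.sum_range_succ])
  linarith [log2_hi, log4_eq]
lemma log7_lo : (1.945909 : ℝ) < Real.log 7 := by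
  have := log_hi (a := 8) (b := 7) (x := 1 / 15) (c := 0.1335315) 3 (by norm_num) (by norm_num)
    (by norm_num) (by norm_num [Finset.sum_range_succ])
  linarith [log2_lo, log8_eq]
lemma log7_hi : Real.log 7 < (1.945911 : ℝ) := by
  have := log_lo (a := 8) (b := 7) (x := 1 / 15) (c := 0.1335312) 3 (by norm_num) (by norm_num)
    (by norm_num) (by norm_num [Finset.sum_range_succ])
  linarith [log2_hi, log8_eq]
lemma log10_eq : Real.log 10 = Real.log 2 + Real.log 5 := by
  rw [← Real.log_mul (by norm_num) (by norm_num)]; norm_num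
lemma log12_eq : Real.log 12 = 2 * Real.log 2 + Real.log 3 := by
  rw [← log4_eq, ← Real.log_mul (by norm_num) (by norm_num)]; norm_num
lemma log18_eq : Real.log 18 = Real.log 2 + 2 * Real.log 3 := by
  rw [show (18 : ℝ) = 2 * 3 ^ 2 by norm_num, Real.log_mul (by norm_num) (by norm_num), Real.log_pow]
  norm_num
lemma log24_eq : Real.log 24 = 3 * Real.log 2 + Real.log 3 := by
  rw [← log8_eq, ← Real.log_mul (by norm_num) (by norm_num)]; norm_num
lemma log30_eq : Real.log 30 = Real.log 10 + Real.log 3 := by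
  rw [← Real.log_mul (by norm_num) (by norm_num)]; norm_num
lemma log11_lo : (2.39789 : ℝ) < Real.log 11 := by
  have := log_lo (a := 11) (b := 10) (x := 1 / 21) (c := 0.095310) 3 (by norm_num) (by norm_num)
    (by norm_num) (by norm_num [Finset.sum_range_succ])
  linarith [log2_lo, log5_lo, log10_eq]
lemma log13_lo : (2.56494 : ℝ) < Real.log 13 := by
  have := log_lo (a := 13) (b := 12) (x := 1 / 25) (c := 0.080042) 3 (by norm_num) (by norm_num)
    (by norm_num) (by norm_num [Finset.sum_range_succ])
  linarith [log2_lo, log3_lo, log12_eq]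
lemma log17_lo : (2.8332 : ℝ) < Real.log 17 := by
  have := log_lo (a := 17) (b := 16) (x := 1 / 33) (c := 0.060624) 3 (by norm_num) (by norm_num)
    (by norm_num) (by norm_num [Finset.sum_range_succ])
  linarith [log2_lo, log16_eq]
lemma log19_lo : (2.9444 : ℝ) < Real.log 19 := by
  have := log_lo (a := 19) (b := 18) (x := 1 / 37) (c := 0.054066) 3 (by norm_num) (by norm_num)
    (by norm_num) (by norm_num [Finset.sum_range_succ])
  linarith [log2_lo, log3_lo, log18_eq]
lemma log23_lo : (3.1354 : ℝ) < Real.log 23 := by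
  have := log_hi (a := 24) (b := 23) (x := 1 / 47) (c := 0.04257) 3 (by norm_num) (by norm_num)
    (by norm_num) (by norm_num [Finset.sum_range_succ])
  linarith [log2_lo, log3_lo, log24_eq]
lemma log31_hi : Real.log 31 < (3.43400 : ℝ) := by
  have := log_lo (a := 32) (b := 31) (x := 1 / 63) (c := 0.031747) 3 (by norm_num) (by norm_num)
    (by norm_num) (by norm_num [Finset.sum_range_succ])
  linarith [log2_hi, log32_eq]
lemma log31_lo : (3.43397 : ℝ) < Real.log 31 := by
  have := log_hi (a := 32) (b := 31) (x := 1 / 63) (c := 0.031750) 3 (by norm_num) (by norm_num)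
    (by norm_num) (by norm_num [Finset.sum_range_succ])
  linarith [log2_lo, log32_eq]
lemma log29_lo : (3.36725 : ℝ) < Real.log 29 := by
  have := log_hi (a := 30) (b := 29) (x := 1 / 59) (c := 0.033903) 3 (by norm_num) (by norm_num)
    (by norm_num) (by norm_num [Finset.sum_range_succ])
  linarith [log2_lo, log3_lo, log30_eq, log10_eq, log5_lo]
lemma logpi_lo : (1.14468 : ℝ) < Real.log Real.pi := by
  have h1 := log_lo (a := 3.1415) (b := 3) (x := 0.1415 / 6.1415) (c := 0.046088 - 0.0000095) 3 (by norm_num) (by norm_num)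
    (by norm_num) (by norm_num [Finset.sum_range_succ])
  have h2 : Real.log 3.1415 ≤ Real.log Real.pi := Real.log_le_log (by norm_num) Real.pi_gt_d4.le
  linarith [log3_lo]
lemma logpi_hi : Real.log Real.pi < (1.14475 : ℝ) := by
  have h1 := log_hi (a := 3.1416) (b := 3) (x := 0.1416 / 6.1416) (c := 0.046120) 3 (by norm_num) (by norm_num)
    (by norm_num) (by norm_num [Finset.sum_range_succ])
  have h2 : Real.log Real.pi ≤ Real.log 3.1416 := Real.log_le_log Real.pi_pos Real.pi_lt_d4.le
  linarith [log3_hi]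

lemma euler_lo : (0.5609 : ℝ) < Real.eulerMascheroniConstant := by
  have h := Real.eulerMascheroniSeq_lt_eulerMascheroniConstant 30
  have e : (harmonic 30 : ℝ) = (9304682830147 / 2329089562800 : ℝ) := by
    have : harmonic 30 = (9304682830147 / 2329089562800 : ℚ) := by
      simp only [harmonic, Finset.sum_range_succ, Finset.sum_range_zero]; norm_num
    rw [this]; norm_num
  rw [Real.eulerMascheroniSeq, e] at h
  norm_num at h
  have := log31_hi
  linarith

end PNT
end

section
open Complex Filter Topology Metric MeasureTheory Set ArithmeticFunction

namespace PNT

lemma term_re (s : ℂ) (n : ℕ) :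
    (LSeries.term (fun n => (vonMangoldt n : ℂ)) s n).re
      = vonMangoldt n * (n : ℝ) ^ (-s.re) * Real.cos (s.im * Real.log n) := by
  rcases Nat.eq_zero_or_pos n with h | h
  · subst h; simp
  · have hn : (n : ℂ) ≠ 0 := by exact_mod_cast h.ne'
    have hn' : (0 : ℝ) < n := by exact_mod_cast h
    rw [LSeries.term_of_ne_zero h.ne', div_eq_mul_inv, ← Complex.cpow_neg, Complex.re_ofReal_mul,
      mul_assoc]
    congr 1
    rw [Complex.cpow_def_of_ne_zero hn, ← Complex.ofReal_natCast, ← Complex.ofReal_log hn'.le,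
      Complex.exp_re, Real.rpow_def_of_pos hn']
    simp [-Complex.natCast_log, mul_comm]

lemma LS_re {s : ℂ} (hs : 1 < s.re) :
    HasSum (fun n : ℕ => vonMangoldt n * (n : ℝ) ^ (-s.re) * Real.cos (s.im * Real.log n))
      (LSeries (fun n => (vonMangoldt n : ℂ)) s).re := by
  have h := (LSeriesSummable_vonMangoldt hs).hasSum
  have := Complex.hasSum_re h
  simp only [term_re] at this
  exact this

lemma trig_pos (θ : ℝ) : 0 ≤ 11.26 + 19.2 * Real.cos θ + 11.76 * Real.cos (2 * θ)
    + 4.8 * Real.cos (3 * θ) + Real.cos (4 * θ) := by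
  have h4 : Real.cos (4 * θ) = 2 * (2 * Real.cos θ ^ 2 - 1) ^ 2 - 1 := by
    rw [show 4 * θ = 2 * (2 * θ) by ring, Real.cos_two_mul, Real.cos_two_mul]
  rw [h4, Real.cos_three_mul, Real.cos_two_mul]
  nlinarith [sq_nonneg (Real.cos θ ^ 2 + 1.2 * Real.cos θ + 0.25)]

lemma LS_trig_pos {σ : ℝ} (hσ : 1 < σ) (t : ℝ) :
    0 ≤ 11.26 * (LSeries (fun n => (vonMangoldt n : ℂ)) (σ : ℂ)).re
      + 19.2 * (LSeries (fun n => (vonMangoldt n : ℂ)) ((σ : ℂ) + (t : ℝ) * I)).re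
      + 11.76 * (LSeries (fun n => (vonMangoldt n : ℂ)) ((σ : ℂ) + (2 * t : ℝ) * I)).re
      + 4.8 * (LSeries (fun n => (vonMangoldt n : ℂ)) ((σ : ℂ) + (3 * t : ℝ) * I)).re
      + (LSeries (fun n => (vonMangoldt n : ℂ)) ((σ : ℂ) + (4 * t : ℝ) * I)).re := by
  have key : ∀ u : ℝ, HasSum (fun n : ℕ => vonMangoldt n * (n : ℝ) ^ (-σ) * Real.cos (u * Real.log n))
      (LSeries (fun n => (vonMangoldt n : ℂ)) ((σ : ℂ) + (u : ℝ) * I)).re := by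
    intro u
    have := LS_re (s := (σ : ℂ) + (u : ℝ) * I) (by simpa using hσ)
    simpa using this
  have h0 := key 0
  simp only [zero_mul, Real.cos_zero, mul_one, Complex.ofReal_zero, add_zero] at h0
  have hs := ((((h0.mul_left 11.26).add ((key t).mul_left 19.2)).add
    ((key (2 * t)).mul_left 11.76)).add ((key (3 * t)).mul_left 4.8)).add (key (4 * t))
  refine hs.nonneg fun n => ?_
  have := trig_pos (t * Real.log n)
  have hp : 0 ≤ vonMangoldt n * (n : ℝ) ^ (-σ) := mul_nonneg vonMangoldt_nonneg (by positivity)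
  have e : ∀ k : ℝ, k * t * Real.log n = k * (t * Real.log n) := fun k => by ring
  simp only [e]
  nlinarith [mul_nonneg hp this]

lemma vm_pp {p k : ℕ} (hp : p.Prime) (hk : k ≠ 0) : vonMangoldt (p ^ k) = Real.log p := by
  rw [vonMangoldt_apply_pow hk, vonMangoldt_apply_prime hp]

lemma LS2_lo : (0.5383 : ℝ) ≤ (LSeries (fun n => (vonMangoldt n : ℂ)) 2).re := by
  have h := LS_re (s := 2) (by norm_num)
  have h2 := sum_le_hasSum (({2,4,8,16,3,9,27,5,25,7,11,13,17,19,23,29,31} : Finset ℕ))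
    (fun n _ => ?_) h
  · refine le_trans ?_ h2
    have l4 := vm_pp Nat.prime_two (k := 2) (by norm_num)
    have l8 := vm_pp Nat.prime_two (k := 3) (by norm_num)
    have l16 := vm_pp Nat.prime_two (k := 4) (by norm_num)
    have l9 := vm_pp Nat.prime_three (k := 2) (by norm_num)
    have l27 := vm_pp Nat.prime_three (k := 3) (by norm_num)
    have l25 := vm_pp Nat.prime_five (k := 2) (by norm_num)
    have l2 := vonMangoldt_apply_prime Nat.prime_two
    have l3 := vonMangoldt_apply_prime Nat.prime_three
    have l5 := vonMangoldt_apply_prime Nat.prime_five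
    have l7 := vonMangoldt_apply_prime (p := 7) (by norm_num)
    have l11 := vonMangoldt_apply_prime (p := 11) (by norm_num)
    have l13 := vonMangoldt_apply_prime (p := 13) (by norm_num)
    have l17 := vonMangoldt_apply_prime (p := 17) (by norm_num)
    have l19 := vonMangoldt_apply_prime (p := 19) (by norm_num)
    have l23 := vonMangoldt_apply_prime (p := 23) (by norm_num)
    have l29 := vonMangoldt_apply_prime (p := 29) (by norm_num)
    have l31 := vonMangoldt_apply_prime (p := 31) (by norm_num)
    norm_num at l4 l8 l16 l9 l27 l25 l2 l3 l5 l7 l11 l13 l17 l19 l23 l29 l31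
    norm_num [l4, l8, l16, l9, l27, l25, l2, l3, l5, l7, l11, l13, l17, l19, l23, l29, l31,
      Real.rpow_neg]
    linarith [log2_lo, log3_lo, log5_lo, log7_lo, log11_lo, log13_lo, log17_lo, log19_lo,
      log23_lo, log29_lo, log31_lo]
  · have : (2 : ℂ).im = 0 := by simp
    rw [this, zero_mul, Real.cos_zero, mul_one]
    exact mul_nonneg vonMangoldt_nonneg (by positivity)

lemma digamma_two : (Complex.digamma 2).re = 1 - Real.eulerMascheroniConstant := by
  have := Complex.digamma_apply_add_one (s := 1) (fun m => by
    intro h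
    have := congrArg Complex.re h
    simp at this
    have hm : (0 : ℝ) ≤ m := Nat.cast_nonneg m
    linarith)
  rw [show (2 : ℂ) = 1 + 1 by norm_num, this, Complex.digamma_one]
  simp; ring

lemma P2_le : (logDeriv xi 2).re ≤ 0.109 := by
  have h := vonMangoldt_formula (s := 2) (by norm_num)
  have h1 : (logDeriv xi 2).re = 1 - Real.log Real.pi / 2 + 1 / 2 * (1 - Real.eulerMascheroniConstant)
      - (LSeries (fun n => (vonMangoldt n : ℂ)) 2).re := by
    rw [h, ← digamma_two]
    norm_num
  rw [h1]
  linarith [LS2_lo, euler_lo, logpi_lo]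

end PNT
end

section
open Complex Filter Topology Metric MeasureTheory Set ArithmeticFunction
open scoped ComplexConjugate

namespace PNT

lemma xi_re_nonneg {z : ℂ} (hz : 1 < z.re) : 0 ≤ (logDeriv xi z).re := by
  rw [re_logDeriv_xi hz]
  exact tsum_nonneg fun ρ => re_term_nonneg hz

lemma xi_re_pair {z ρ : ℂ} (hz : 1 < z.re) (h : xi ρ = 0) (hb : 1 / 2 < ρ.re) :
    (1 / (z - ρ)).re + (1 / (z - (1 - conj ρ))).re ≤ (logDeriv xi z).re := by
  rw [re_logDeriv_xi hz]
  have hne : ρ ≠ 1 - conj ρ := by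
    intro e
    have := congrArg Complex.re e
    simp at this; linarith
  have h1 := (summable_re hz).sum_le_tsum {ρ, 1 - conj ρ} (fun _ _ => re_term_nonneg hz)
  rw [Finset.sum_pair hne, mu_one_sub, mu_conj] at h1
  refine le_trans ?_ h1
  have hs := xi_zero_strip h
  have hm := mu_one_le h
  have p1 : 0 ≤ (1 / (z - ρ)).re := re_one_div_nonneg (by simp; linarith)
  have p2 : 0 ≤ (1 / (z - (1 - conj ρ))).re := re_one_div_nonneg (by simp; linarith)
  nlinarith

lemma gamma_lo {ρ : ℂ} (h : xi ρ = 0) (hb : 1 / 2 < ρ.re) : 20 ≤ ρ.im ^ 2 := by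
  have h1 := xi_re_pair (z := 2) (by simp) h hb
  have hs := xi_zero_strip h
  have h2 := h1.trans P2_le
  rw [re_one_div, re_one_div, ← normSq_eq_norm_sq, ← normSq_eq_norm_sq, normSq_apply,
    normSq_apply] at h2
  simp at h2
  set b := ρ.re
  set g := ρ.im
  have e1 : (2 - b) / (4 + g ^ 2) ≤ (2 - b) / ((2 - b) * (2 - b) + g * g) := by
    apply div_le_div_of_nonneg_left (by linarith) (by nlinarith) (by nlinarith)
  have e2 : (1 + b) / (4 + g ^ 2) ≤ (2 - (1 - b)) / ((2 - (1 - b)) * (2 - (1 - b)) + g * g) := by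
    rw [show 2 - (1 - b) = 1 + b by ring]
    apply div_le_div_of_nonneg_left (by linarith) (by nlinarith) (by nlinarith)
  have e3 : 3 / (4 + g ^ 2) ≤ 0.109 := by
    have : 3 / (4 + g ^ 2) = (2 - b) / (4 + g ^ 2) + (1 + b) / (4 + g ^ 2) := by ring
    rw [this]; linarith
  rw [div_le_iff₀ (by positivity)] at e3
  linarith

/-- bound for the non-real terms -/
lemma LS_re_le {σ u : ℝ} (h1 : 1 < σ) (h2 : σ ≤ 1.1) (hu : 0 < u) :
    (LSeries (fun n => (vonMangoldt n : ℂ)) ((σ : ℂ) + (u : ℝ) * I)).re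
      + (logDeriv xi ((σ : ℂ) + (u : ℝ) * I)).re ≤
      1 / 2 * Real.log (u / 2) - 0.57234 + 1 / u + 2.5025 / u ^ 2 := by
  rw [vonMangoldt_formula (by simpa using h1)]
  have hd := digamma_re_le (s := ((σ : ℂ) + (u : ℝ) * I) / 2) (by simp; linarith) (by simpa using hu)
  have e1 : (1 / ((σ : ℂ) + (u : ℝ) * I - 1)).re ≤ 0.1 / u ^ 2 := by
    rw [re_one_div, ← normSq_eq_norm_sq, normSq_apply]
    simp
    rw [div_le_div_iff₀ (by positivity) (by positivity)]
    nlinarith [mul_nonneg (by linarith : (0:ℝ) ≤ 1.1 - σ) (sq_nonneg u), sq_nonneg (σ-1)]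
  have e2 : Real.log ((1 + σ / 2) ^ 2 + (u / 2) ^ 2) ≤ 2 * Real.log (u / 2) + 9.61 / u ^ 2 := by
    have hu2 : 0 < u / 2 := by positivity
    have : (1 + σ / 2) ^ 2 + (u / 2) ^ 2 ≤ (u / 2) ^ 2 * (1 + 9.61 / u ^ 2) := by
      have : (u / 2) ^ 2 * (1 + 9.61 / u ^ 2) = (u / 2) ^ 2 + 9.61 / 4 := by field_simp; ring
      rw [this]; nlinarith
    refine (Real.log_le_log (by positivity) this).trans ?_
    rw [Real.log_mul (by positivity) (by positivity), Real.log_pow]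
    have := Real.log_le_sub_one_of_pos (show 0 < 1 + 9.61 / u ^ 2 by positivity)
    push_cast; linarith
  have e3 : 1 / (σ / 2 + u / 2) ≤ 2 / u := by
    rw [div_le_div_iff₀ (by positivity) hu]; linarith
  have r1 : (((σ : ℂ) + (u : ℝ) * I) / 2).re = σ / 2 := by simp
  have r2 : (((σ : ℂ) + (u : ℝ) * I) / 2).im = u / 2 := by simp
  rw [r1, r2] at hd
  have r3 : ((1 : ℂ) / 2 * digamma (((σ : ℂ) + (u : ℝ) * I) / 2 + 1)).re
      = 1 / 2 * (digamma (((σ : ℂ) + (u : ℝ) * I) / 2 + 1)).re := by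
    rw [show (1 : ℂ) / 2 = ((1 / 2 : ℝ) : ℂ) by norm_num, re_ofReal_mul]
  rw [sub_re, add_re, sub_re, ofReal_re, r3]
  have f1 : 0.1 / u ^ 2 + 9.61 / u ^ 2 / 4 = 2.5025 / u ^ 2 := by ring
  have f2 : (2 : ℝ) / u = 2 * (1 / u) := by ring
  linarith [logpi_lo]

lemma LS_re_le_real {σ : ℝ} (h1 : 1 < σ) (h2 : σ ≤ 1.1) :
    (LSeries (fun n => (vonMangoldt n : ℂ)) (σ : ℂ)).re ≤ 1 / (σ - 1) - 0.3531 := by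
  rw [vonMangoldt_formula (by simpa using h1)]
  have hd := digamma_real_le (x := σ / 2) (by linarith)
  have hx := xi_re_nonneg (z := (σ : ℂ)) (by simpa using h1)
  have r3 : ((1 : ℂ) / 2 * digamma ((σ : ℂ) / 2 + 1)).re
      = 1 / 2 * (digamma ((σ / 2 : ℝ) + 1)).re := by
    rw [show (1 : ℂ) / 2 = ((1 / 2 : ℝ) : ℂ) by norm_num, re_ofReal_mul]
    push_cast; rfl
  have r4 : (1 / ((σ : ℂ) - 1)).re = 1 / (σ - 1) := by
    rw [show (1 / ((σ : ℂ) - 1)) = ((1 / (σ - 1) : ℝ) : ℂ) by push_cast; rfl, ofReal_re]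
  rw [sub_re, add_re, sub_re, ofReal_re, r3, r4]
  have l1 : Real.log (1 + σ / 2) ≤ 0.4384 := by
    have a1 : Real.log (1 + σ / 2) ≤ Real.log 1.55 := Real.log_le_log (by linarith) (by linarith)
    have a2 := log_hi (a := 1.55) (b := 1.5) (x := 0.05 / 3.05) (c := 0.0328) 2 (by norm_num) (by norm_num)
      (by norm_num) (by norm_num [Finset.sum_range_succ])
    have a3 : Real.log 1.5 = Real.log 3 - Real.log 2 := by
      rw [← Real.log_div (by norm_num) (by norm_num)]; norm_num
    linarith [log3_hi, log2_lo]
  linarith [logpi_lo]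

lemma zfr_ineq {ρ : ℂ} (h : xi ρ = 0) (hb : 1 / 2 < ρ.re) (hg : 0 < ρ.im) {δ : ℝ} (h0 : 0 < δ)
    (h1 : δ ≤ 0.1) :
    19.2 / (δ + (1 - ρ.re)) ≤ 11.26 / δ + (18.38 * Real.log ρ.im - 47.8 + 27 / ρ.im + 57 / ρ.im ^ 2) := by
  set β := ρ.re
  set γ := ρ.im
  have hs := xi_zero_strip h
  have ht := LS_trig_pos (σ := 1 + δ) (by linarith) γ
  have k0 := LS_re_le_real (σ := 1 + δ) (by linarith) (by linarith)
  have k1 := LS_re_le (σ := 1 + δ) (u := γ) (by linarith) (by linarith) hg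
  have k2 := LS_re_le (σ := 1 + δ) (u := 2 * γ) (by linarith) (by linarith) (by linarith)
  have k3 := LS_re_le (σ := 1 + δ) (u := 3 * γ) (by linarith) (by linarith) (by linarith)
  have k4 := LS_re_le (σ := 1 + δ) (u := 4 * γ) (by linarith) (by linarith) (by linarith)
  have p2 := xi_re_nonneg (z := ((1 + δ : ℝ) : ℂ) + (2 * γ : ℝ) * I) (by simpa using h0)
  have p3 := xi_re_nonneg (z := ((1 + δ : ℝ) : ℂ) + (3 * γ : ℝ) * I) (by simpa using h0)
  have p4 := xi_re_nonneg (z := ((1 + δ : ℝ) : ℂ) + (4 * γ : ℝ) * I) (by simpa using h0)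
  have p1 := xi_re_pair (z := ((1 + δ : ℝ) : ℂ) + (γ : ℝ) * I) (by simpa using h0) h hb
  have q1 : (1 / (((1 + δ : ℝ) : ℂ) + (γ : ℝ) * I - ρ)).re = 1 / (δ + (1 - β)) := by
    rw [show ((1 + δ : ℝ) : ℂ) + (γ : ℝ) * I - ρ = ((δ + (1 - β) : ℝ) : ℂ) by
      apply Complex.ext <;> simp [β, γ]; ring]
    rw [show (1 / ((δ + (1 - β) : ℝ) : ℂ)) = ((1 / (δ + (1 - β)) : ℝ) : ℂ) by push_cast; rfl, ofReal_re]
  have q2 : (1 / (((1 + δ : ℝ) : ℂ) + (γ : ℝ) * I - (1 - conj ρ))).re = 1 / (δ + β) := by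
    rw [show ((1 + δ : ℝ) : ℂ) + (γ : ℝ) * I - (1 - conj ρ) = ((δ + β : ℝ) : ℂ) by
      apply Complex.ext <;> simp [β, γ]]
    rw [show (1 / ((δ + β : ℝ) : ℂ)) = ((1 / (δ + β) : ℝ) : ℂ) by push_cast; rfl, ofReal_re]
  rw [q1, q2] at p1
  have q3 : 1 / 1.1 ≤ 1 / (δ + β) := by
    apply one_div_le_one_div_of_le (by linarith) (by linarith)
  have q4 : (0.90909 : ℝ) ≤ 1 / 1.1 := by norm_num
  have L1 : Real.log (γ / 2) = Real.log γ - Real.log 2 := Real.log_div hg.ne' (by norm_num)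
  have L2 : Real.log (2 * γ / 2) = Real.log γ := by congr 1; ring
  have L3 : Real.log (3 * γ / 2) = Real.log γ + (Real.log 3 - Real.log 2) := by
    rw [Real.log_div (by positivity) (by norm_num), Real.log_mul (by norm_num) hg.ne']; ring
  have L4 : Real.log (4 * γ / 2) = Real.log γ + Real.log 2 := by
    rw [show 4 * γ / 2 = γ * 2 by ring, Real.log_mul hg.ne' (by norm_num)]
  rw [L1] at k1
  rw [L2] at k2
  rw [L3] at k3
  rw [L4] at k4
  have i1 : 0 < 1 / γ := by positivity
  have i2 : 0 < 1 / γ ^ 2 := by positivity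
  have m2 : 1 / (2 * γ) = 1 / 2 * (1 / γ) := by field_simp
  have m3 : 1 / (3 * γ) = 1 / 3 * (1 / γ) := by field_simp
  have m4 : 1 / (4 * γ) = 1 / 4 * (1 / γ) := by field_simp
  have n1 : 2.5025 / γ ^ 2 = 2.5025 * (1 / γ ^ 2) := by ring
  have n2 : 2.5025 / (2 * γ) ^ 2 = 2.5025 / 4 * (1 / γ ^ 2) := by field_simp; norm_num
  have n3 : 2.5025 / (3 * γ) ^ 2 = 2.5025 / 9 * (1 / γ ^ 2) := by field_simp; norm_num
  have n4 : 2.5025 / (4 * γ) ^ 2 = 2.5025 / 16 * (1 / γ ^ 2) := by field_simp; norm_num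
  rw [n1] at k1
  rw [m2, n2] at k2
  rw [m3, n3] at k3
  rw [m4, n4] at k4
  have o1 : 19.2 / (δ + (1 - β)) = 19.2 * (1 / (δ + (1 - β))) := by ring
  have o2 : 11.26 / δ = 11.26 * (1 / δ) := by ring
  have o3 : 27 / γ = 27 * (1 / γ) := by ring
  have o4 : 57 / γ ^ 2 = 57 * (1 / γ ^ 2) := by ring
  rw [o1, o2, o3, o4]
  rw [show 1 + δ - 1 = δ by ring] at k0
  linarith [log2_lo, log2_hi, log3_lo, log3_hi]

lemma log100 : Real.log 100 = 2 * (Real.log 2 + Real.log 5) := by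
  rw [← log10_eq, show (100 : ℝ) = 10 ^ 2 by norm_num, Real.log_pow]; norm_num

lemma zfr_pos {ρ : ℂ} (h : xi ρ = 0) (hb : 1 / 2 < ρ.re) (hg : 0 < ρ.im) {T : ℝ} (hT : 100 ≤ T)
    (hgT : ρ.im ≤ T) : 1.053 / (18.38 * Real.log T - 47.5) ≤ 1 - ρ.re := by
  set K := 18.38 * Real.log T - 47.5 with hK
  have lT : Real.log 100 ≤ Real.log T := Real.log_le_log (by norm_num) hT
  have l100 : 4.605 ≤ Real.log 100 := by rw [log100]; linarith [log2_lo, log5_lo]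
  have l100' : Real.log 100 ≤ 4.6052 := by rw [log100]; linarith [log2_hi, log5_hi]
  have hK35 : 35 ≤ K := by rw [hK]; linarith
  have hlo := gamma_lo h hb
  set γ := ρ.im
  have g1 : 4.4 ≤ γ := by nlinarith
  have hKK : 18.38 * Real.log γ - 47.8 + 27 / γ + 57 / γ ^ 2 ≤ K := by
    rcases le_or_gt 95 γ with h95 | h95
    · have a1 : Real.log γ ≤ Real.log T := Real.log_le_log hg hgT
      have a2 : 27 / γ ≤ 27 / 95 := by gcongr
      have a3 : 57 / γ ^ 2 ≤ 57 / 95 ^ 2 := by gcongr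
      have a4 : (27 : ℝ) / 95 + 57 / 95 ^ 2 ≤ 0.3 := by norm_num
      rw [hK]; linarith
    · have a1 : Real.log γ ≤ Real.log 100 + (γ / 100 - 1) := by
        have := Real.log_le_sub_one_of_pos (show 0 < γ / 100 by positivity)
        rw [Real.log_div hg.ne' (by norm_num)] at this
        linarith
      rcases le_or_gt γ 50 with h50 | h50
      · have a2 : 27 / γ ≤ 27 / 4.4 := by gcongr
        have a3 : 57 / γ ^ 2 ≤ 57 / 4.4 ^ 2 := by gcongr
        have a4 : (27 : ℝ) / 4.4 + 57 / 4.4 ^ 2 ≤ 9.1 := by norm_num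
        rw [hK]; linarith
      · have a2 : 27 / γ ≤ 27 / 50 := by gcongr
        have a3 : 57 / γ ^ 2 ≤ 57 / 50 ^ 2 := by gcongr
        have a4 : (27 : ℝ) / 50 + 57 / 50 ^ 2 ≤ 0.6 := by norm_num
        rw [hK]; linarith
  have hK0 : 0 < K := by linarith
  have key := zfr_ineq h hb hg (δ := 3.44 / K) (by positivity) (by
    rw [div_le_iff₀ hK0]; linarith)
  have hs := xi_zero_strip h
  have hδ : 0 < 3.44 / K := by positivity
  have k2 : 19.2 / (3.44 / K + (1 - ρ.re)) ≤ 4.27326 * K := by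
    have : 11.26 / (3.44 / K) = 11.26 / 3.44 * K := by field_simp
    have t : (11.26 : ℝ) / 3.44 ≤ 3.27326 := by norm_num
    have : 11.26 / 3.44 * K ≤ 3.27326 * K := mul_le_mul_of_nonneg_right t hK0.le
    linarith
  rw [div_le_iff₀ (by linarith)] at k2
  have : 3.44 / K * K = 3.44 := by field_simp
  rw [div_le_iff₀ hK0]
  nlinarith

theorem zfr {ρ : ℂ} (h : mu ρ ≠ 0) {T : ℝ} (hT : 100 ≤ T)
    (hgT : |ρ.im| ≤ T) : 1.053 / (18.38 * Real.log T - 47.5) ≤ 1 - ρ.re := by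
  rcases le_or_gt ρ.re (1 / 2) with hb | hb
  · have lT : Real.log 100 ≤ Real.log T := Real.log_le_log (by norm_num) hT
    have l100 : 4.605 ≤ Real.log 100 := by rw [log100]; linarith [log2_lo, log5_lo]
    have : 1.053 / (18.38 * Real.log T - 47.5) ≤ 1 / 2 := by
      rw [div_le_iff₀ (by linarith)]; linarith
    linarith
  have hx := xi_of_mu h
  rcases lt_trichotomy ρ.im 0 with hi | hi | hi
  · have hc : xi (conj ρ) = 0 := by
      apply xi_of_mu; rw [mu_conj]; exact h
    have := zfr_pos hc (by simpa using hb) (by simpa using hi) hT (by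
      rw [abs_of_neg hi] at hgT; simpa using hgT)
    simpa using this
  · have := gamma_lo hx hb
    rw [hi] at this; norm_num at this
  · exact zfr_pos hx hb hi hT (by rwa [abs_of_pos hi] at hgT)

end PNT
end

section
open Complex Filter Topology Metric MeasureTheory Set ArithmeticFunction
open scoped ComplexConjugate Nat

namespace PNT

lemma iter_unif {ι : Type*} {F : ι → ℂ → ℂ} {f : ℂ → ℂ} {fl : Filter ι} {U : Set ℂ} (hU : IsOpen U)
    (hF : ∀ n, DifferentiableOn ℂ (F n) U) (hf : TendstoLocallyUniformlyOn F f fl U) (k : ℕ) :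
    TendstoLocallyUniformlyOn (fun n => iteratedDeriv k (F n)) (iteratedDeriv k f) fl U ∧
      ∀ n, DifferentiableOn ℂ (iteratedDeriv k (F n)) U := by
  induction k with
  | zero => simpa using ⟨hf, hF⟩
  | succ k ih =>
    simp only [iteratedDeriv_succ]
    exact ⟨ih.1.deriv (Eventually.of_forall ih.2) hU, fun n => (ih.2 n).deriv hU⟩

lemma hasSum_iter {ι : Type*} {F : ι → ℂ → ℂ} {u : ι → ℝ} {U : Set ℂ} (hu : Summable u)
    (hU : IsOpen U) (hF : ∀ n, DifferentiableOn ℂ (F n) U) (hb : ∀ i, ∀ w ∈ U, ‖F i w‖ ≤ u i)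
    (k : ℕ) {z : ℂ} (hz : z ∈ U) :
    HasSum (fun i => iteratedDeriv k (F i) z) (iteratedDeriv k (fun w => ∑' i, F i w) z) := by
  have hc := (tendstoUniformlyOn_tsum hu hb).tendstoLocallyUniformlyOn
  have h := (iter_unif hU (fun s => DifferentiableOn.fun_sum fun i _ => hF i) hc k).1.tendsto_at hz
  rw [HasSum]
  refine h.congr fun s => ?_
  have : ∀ i ∈ s, ContDiffAt ℂ k (F i) z := fun i _ =>
    ((hF i).analyticAt (hU.mem_nhds hz)).contDiffAt
  have := iteratedDeriv_fun_sum this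
  simpa using this

/-- Taylor remainder at 2, expanded at l+2 -/
noncomputable def Rm (K : ℕ) (l : ℝ) (F : ℂ → ℂ) : ℂ :=
  F 2 - ∑ k ∈ Finset.range K, iteratedDeriv k F ((l + 2 : ℝ) : ℂ) * ((-(l : ℂ)) ^ k / (k ! : ℂ))

noncomputable def UU (l : ℝ) : Set ℂ := ball ((l + 2 : ℝ) : ℂ) (l + 1 / 2)

lemma UU_two {l : ℝ} (hl : 0 < l) : (2 : ℂ) ∈ UU l := by
  rw [UU, mem_ball, dist_eq, show (2 : ℂ) - ((l + 2 : ℝ) : ℂ) = ((-l : ℝ) : ℂ) by push_cast; ring,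
    norm_real, Real.norm_eq_abs, abs_neg, abs_of_pos hl]; linarith

lemma UU_sg {l : ℝ} (hl : 0 < l) : ((l + 2 : ℝ) : ℂ) ∈ UU l := mem_ball_self (by linarith)

lemma UU_re {l : ℝ} {z : ℂ} (h : z ∈ UU l) : 3 / 2 < z.re := by
  rw [UU, mem_ball, dist_eq] at h
  have := (abs_re_le_norm (z - ((l + 2 : ℝ) : ℂ))).trans_lt h
  rw [abs_lt] at this; simp at this; linarith

lemma UU_norm {l : ℝ} (hl : 0 < l) {z : ℂ} (h : z ∈ UU l) : ‖z‖ ≤ 2 * l + 5 / 2 := by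
  rw [UU, mem_ball, dist_eq] at h
  have := norm_le_norm_add_norm_sub' z ((l + 2 : ℝ) : ℂ)
  rw [norm_real, Real.norm_of_nonneg (by linarith)] at this
  linarith

lemma Rm_hasSum {ι : Type*} {F : ι → ℂ → ℂ} {u : ι → ℝ} (hu : Summable u) {l : ℝ} (hl : 0 < l)
    (K : ℕ) (hF : ∀ n, DifferentiableOn ℂ (F n) (UU l)) (hb : ∀ i, ∀ w ∈ UU l, ‖F i w‖ ≤ u i) :
    HasSum (fun i => Rm K l (F i)) (Rm K l (fun w => ∑' i, F i w)) := by
  have h0 := hasSum_iter hu isOpen_ball hF hb 0 (UU_two hl)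
  simp only [iteratedDeriv_zero] at h0
  refine h0.sub (hasSum_sum fun k _ => ?_)
  exact (hasSum_iter hu isOpen_ball hF hb k (UU_sg hl)).mul_right _

lemma Rm_add {K : ℕ} {l : ℝ} {F G : ℂ → ℂ} (hF : AnalyticAt ℂ F ((l + 2 : ℝ) : ℂ))
    (hG : AnalyticAt ℂ G ((l + 2 : ℝ) : ℂ)) :
    Rm K l (fun z => F z + G z) = Rm K l F + Rm K l G := by
  have : ∀ k : ℕ, iteratedDeriv k (fun z => F z + G z) ((l + 2 : ℝ) : ℂ) =
      iteratedDeriv k F ((l + 2 : ℝ) : ℂ) + iteratedDeriv k G ((l + 2 : ℝ) : ℂ) := fun k =>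
    iteratedDeriv_add hF.contDiffAt hG.contDiffAt
  simp only [Rm, this, add_mul, Finset.sum_add_distrib]; ring

lemma Rm_mul {K : ℕ} {l : ℝ} (c : ℂ) (F : ℂ → ℂ) :
    Rm K l (fun z => c * F z) = c * Rm K l F := by
  simp only [Rm, iteratedDeriv_const_mul_field, mul_sub, Finset.mul_sum, mul_assoc]

lemma Rm_const {K : ℕ} (hK : K ≠ 0) {l : ℝ} (c : ℂ) : Rm K l (fun _ => c) = 0 := by
  obtain ⟨m, rfl⟩ := Nat.exists_eq_succ_of_ne_zero hK
  simp [Rm, iteratedDeriv_const]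

lemma Rm_congr {K : ℕ} {l : ℝ} (hl : 0 < l) {F G : ℂ → ℂ} (h : ∀ z ∈ UU l, F z = G z) :
    Rm K l F = Rm K l G := by
  have he : F =ᶠ[𝓝 ((l + 2 : ℝ) : ℂ)] G :=
    Filter.eventually_of_mem (isOpen_ball.mem_nhds (UU_sg hl)) h
  simp only [Rm, h 2 (UU_two hl), he.iteratedDeriv_eq]

lemma Rm_inv {K : ℕ} {l : ℝ} {a : ℂ} (h1 : (2 : ℂ) - a ≠ 0)
    (h2 : ((l + 2 : ℝ) : ℂ) - a ≠ 0) :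
    Rm K l (fun z => 1 / (z - a)) = 1 / (2 - a) * ((l : ℂ) / (((l + 2 : ℝ) : ℂ) - a)) ^ K := by
  have hd : ∀ k : ℕ, iteratedDeriv k (fun z => 1 / (z - a)) ((l + 2 : ℝ) : ℂ) *
      ((-(l : ℂ)) ^ k / (k ! : ℂ)) =
      1 / (((l + 2 : ℝ) : ℂ) - a) * ((l : ℂ) / (((l + 2 : ℝ) : ℂ) - a)) ^ k := by
    intro k
    have := iter_deriv_inv_linear_sub k (1 : ℂ) a
    simp only [one_mul, one_pow, mul_one] at this
    simp only [one_div]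
    rw [iteratedDeriv_eq_iterate, congrFun this _]
    clear this
    set w := ((l + 2 : ℝ) : ℂ) - a
    have hk : (k ! : ℂ) ≠ 0 := by exact_mod_cast k.factorial_ne_zero
    have e : w ^ (-1 - k : ℤ) = w⁻¹ * (w ^ k)⁻¹ := by
      rw [zpow_sub₀ h2, zpow_neg_one, zpow_natCast]; rfl
    rw [e, div_pow, show (-(l : ℂ)) ^ k = (-1) ^ k * (l : ℂ) ^ k by rw [← mul_pow]; ring]
    have : ((-1 : ℂ) ^ k) * (-1) ^ k = 1 := by rw [← mul_pow]; norm_num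
    field_simp
    linear_combination ((l : ℂ)^k) * this
  simp only [Rm, hd, ← Finset.mul_sum]
  set w := ((l + 2 : ℝ) : ℂ) - a with hw
  have hlw : (l : ℂ) = w - (2 - a) := by rw [hw]; push_cast; ring
  have hne : (l : ℂ) / w ≠ 1 := by
    intro h; rw [div_eq_one_iff_eq h2] at h
    apply h1; rw [hlw] at h; linear_combination -h
  rw [geom_sum_eq hne]
  have hne' : (l : ℂ) / w - 1 ≠ 0 := sub_ne_zero.2 hne
  have e : (l : ℂ) / w - 1 = -(2 - a) / w := by
    rw [hlw]; field_simp; ring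
  rw [e]
  field_simp
  ring

/-- Poisson upper tail -/
noncomputable def Qp (K : ℕ) (y : ℝ) : ℝ :=
  1 - Real.exp (-y) * ∑ k ∈ Finset.range K, y ^ k / k !

lemma Rm_term {K : ℕ} {l : ℝ} (n : ℕ) :
    Rm K l (fun z => LSeries.term (fun n => (vonMangoldt n : ℂ)) z n) =
      ((vonMangoldt n * ((n : ℝ) ^ 2)⁻¹ * Qp K (l * Real.log n) : ℝ) : ℂ) := by
  rcases Nat.eq_zero_or_pos n with h | h
  · subst h
    have : (fun z => LSeries.term (fun n => (vonMangoldt n : ℂ)) z 0) = fun z => (0 : ℂ) * (0 : ℂ) := by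
      ext z; simp
    rw [this, Rm_mul 0 (fun _ => 0)]; simp
  · have hn : (n : ℂ) ≠ 0 := by exact_mod_cast h.ne'
    have hn' : (0 : ℝ) < n := by exact_mod_cast h
    have e : (fun z => LSeries.term (fun n => (vonMangoldt n : ℂ)) z n) =
        fun z => (vonMangoldt n : ℂ) * Complex.exp (((-Real.log n : ℝ) : ℂ) * z) := by
      ext z
      rw [LSeries.term_of_ne_zero h.ne', div_eq_mul_inv, ← Complex.cpow_neg,
        Complex.cpow_def_of_ne_zero hn, ← Complex.ofReal_natCast, ← Complex.ofReal_log hn'.le]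
      congr 2; push_cast; ring
    rw [e, Rm_mul]
    simp only [Rm, iteratedDeriv_cexp_const_mul]
    rw [Qp]
    set y := Real.log n with hy
    have e2 : Real.exp (-y * 2) = ((n : ℝ) ^ 2)⁻¹ := by
      rw [neg_mul, Real.exp_neg, show y * 2 = ((2 : ℕ) : ℝ) * y by push_cast; ring, Real.exp_nat_mul, hy,
        Real.exp_log hn']
    have e3 : Complex.exp (((-y : ℝ) : ℂ) * 2) = (((n : ℝ) ^ 2)⁻¹ : ℝ) := by
      rw [← e2]; push_cast; rfl
    have e4 : Complex.exp (((-y : ℝ) : ℂ) * ((l + 2 : ℝ) : ℂ)) =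
        (((n : ℝ) ^ 2)⁻¹ * Real.exp (-(l * y)) : ℝ) := by
      rw [← e2, ← Real.exp_add]; push_cast; congr 1; ring
    rw [e3, e4]
    push_cast
    rw [mul_assoc]
    congr 1
    rw [mul_sub, mul_one, Finset.mul_sum, Finset.mul_sum]
    congr 1
    refine Finset.sum_congr rfl fun k _ => ?_
    rw [show (-(l : ℂ)) ^ k = (-1) ^ k * (l : ℂ) ^ k by rw [← mul_pow]; ring,
      show (-(y : ℂ)) ^ k = (-1) ^ k * (y : ℂ) ^ k by rw [← mul_pow]; ring, mul_pow]
    have : ((-1 : ℂ) ^ k) * (-1) ^ k = 1 := by rw [← mul_pow]; norm_num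
    linear_combination ((y : ℂ)^k * (((n : ℂ) ^ 2)⁻¹ * cexp (-(↑l * ↑y))) * ((l:ℂ)^k / (k ! : ℂ))) * this

end PNT
end

section
open Complex Filter Topology Metric MeasureTheory Set ArithmeticFunction
open scoped ComplexConjugate Nat

namespace PNT

lemma term_eq (n : ℕ) : (fun z => LSeries.term (fun n => (vonMangoldt n : ℂ)) z n) =
        fun z => (vonMangoldt n : ℂ) * Complex.exp (((-Real.log n : ℝ) : ℂ) * z) := by
  ext z
  rcases Nat.eq_zero_or_pos n with h | h
  · subst h; simp
  · have hn : (n : ℂ) ≠ 0 := by exact_mod_cast h.ne'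
    have hn' : (0 : ℝ) < n := by exact_mod_cast h
    rw [LSeries.term_of_ne_zero h.ne', div_eq_mul_inv, ← Complex.cpow_neg,
      Complex.cpow_def_of_ne_zero hn, ← Complex.ofReal_natCast, ← Complex.ofReal_log hn'.le]
    congr 2; push_cast; ring

lemma Rm_LS {K : ℕ} {l : ℝ} (hl : 0 < l) :
    HasSum (fun n : ℕ => ((vonMangoldt n * ((n : ℝ) ^ 2)⁻¹ * Qp K (l * Real.log n) : ℝ) : ℂ))
      (Rm K l (fun z => LSeries (fun n => (vonMangoldt n : ℂ)) z)) := by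
  have hs : Summable fun n => ‖LSeries.term (fun n => (vonMangoldt n : ℂ)) (3 / 2) n‖ :=
    (LSeriesSummable_vonMangoldt (s := 3 / 2) (by norm_num)).norm
  have := Rm_hasSum (F := fun n z => LSeries.term (fun n => (vonMangoldt n : ℂ)) z n) hs hl K
    (fun n => by rw [term_eq]; fun_prop)
    (fun n z hz => LSeries.norm_term_le_of_re_le_re _ (by have := UU_re hz; norm_num; linarith) n)
  simp only [Rm_term] at this
  exact this

lemma dg_diff (n : ℕ) (l : ℝ) :
    DifferentiableOn ℂ (fun z : ℂ => 1 / ((n : ℂ) + 1) - 1 / ((n : ℂ) + 1 + z / 2)) (UU l) := by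
  intro z hz
  have h := UU_re hz
  have : (n : ℂ) + 1 + z / 2 ≠ 0 := nat_add_ne n (by simp; linarith)
  exact (DifferentiableAt.sub (by fun_prop) (by fun_prop (disch := assumption))).differentiableWithinAt

lemma dg_bd (n : ℕ) {l : ℝ} (hl : 0 < l) (z : ℂ) (hz : z ∈ UU l) :
    ‖1 / ((n : ℂ) + 1) - 1 / ((n : ℂ) + 1 + z / 2)‖ ≤ (2 * l + 5 / 2) * (1 / ((n : ℝ) + 1) ^ 2) := by
  have h := UU_re hz
  refine (dg_bound n (s := z / 2) (by simp; linarith)).trans ?_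
  have := UU_norm hl hz
  have e : ‖z / 2‖ = ‖z‖ / 2 := by simp
  rw [e]; gcongr; linarith

lemma Rm_dg {K : ℕ} (hK : K ≠ 0) {l : ℝ} (hl : 0 < l) (n : ℕ) :
    (Rm K l (fun z : ℂ => 1 / ((n : ℂ) + 1) - 1 / ((n : ℂ) + 1 + z / 2))).re ≤ 0 := by
  have e : Rm K l (fun z : ℂ => 1 / ((n : ℂ) + 1) - 1 / ((n : ℂ) + 1 + z / 2)) =
      Rm K l (fun z : ℂ => 1 / ((n : ℂ) + 1) + (-2) * (1 / (z - ((-(2 * n + 2) : ℝ) : ℂ)))) := by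
    refine Rm_congr hl fun z hz => ?_
    have h := UU_re hz
    have h1 : (n : ℂ) + 1 + z / 2 ≠ 0 := nat_add_ne n (by simp; linarith)
    have h2 : z - ((-(2 * n + 2) : ℝ) : ℂ) = 2 * ((n : ℂ) + 1 + z / 2) := by push_cast; ring
    rw [h2]; field_simp; ring
  have h1 : (2 : ℂ) - ((-(2 * n + 2) : ℝ) : ℂ) = ((2 * n + 4 : ℝ) : ℂ) := by push_cast; ring
  have h2 : ((l + 2 : ℝ) : ℂ) - ((-(2 * n + 2) : ℝ) : ℂ) = ((l + 2 * n + 4 : ℝ) : ℂ) := by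
    push_cast; ring
  have n1 : (2 : ℂ) - ((-(2 * n + 2) : ℝ) : ℂ) ≠ 0 := by
    rw [h1]; norm_cast; 
  have n2 : ((l + 2 : ℝ) : ℂ) - ((-(2 * n + 2) : ℝ) : ℂ) ≠ 0 := by
    rw [h2, Complex.ofReal_ne_zero]; positivity
  have ha : AnalyticAt ℂ (fun z : ℂ => (-2) * (1 / (z - ((-(2 * n + 2) : ℝ) : ℂ)))) ((l + 2 : ℝ) : ℂ) :=
    analyticAt_const.mul (analyticAt_const.div (analyticAt_id.sub analyticAt_const) n2)
  rw [e, Rm_add analyticAt_const ha, Rm_const hK, zero_add, Rm_mul, Rm_inv n1 n2, h1, h2]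
  have : (-2 : ℂ) * (1 / ((2 * n + 4 : ℝ) : ℂ) * ((l : ℂ) / ((l + 2 * n + 4 : ℝ) : ℂ)) ^ K) =
      ((-(2 * (1 / (2 * n + 4) * (l / (l + 2 * n + 4)) ^ K)) : ℝ) : ℂ) := by push_cast; ring
  rw [this, ofReal_re, neg_nonpos]
  positivity

lemma Z_diff (ρ : ℂ) (l : ℝ) :
    DifferentiableOn ℂ (fun z : ℂ => (mu ρ : ℂ) * (1 / (z - ρ) + 1 / (z - 1 + ρ))) (UU l) := by
  by_cases hm : mu ρ = 0
  · simp [hm]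
  obtain ⟨h0, h1⟩ := mu_strip hm
  intro z hz
  have h := UU_re hz
  have n1 : z - ρ ≠ 0 := by intro e; have := congrArg re e; simp at this; linarith
  have n2 : z - 1 + ρ ≠ 0 := by intro e; have := congrArg re e; simp at this; linarith
  exact (DifferentiableAt.mul (by fun_prop)
    (DifferentiableAt.add (by fun_prop (disch := assumption)) (by fun_prop (disch := assumption)))).differentiableWithinAt

lemma Z_bd {l : ℝ} (hl : 0 < l) (ρ z : ℂ) (hz : z ∈ UU l) :
    ‖(mu ρ : ℂ) * (1 / (z - ρ) + 1 / (z - 1 + ρ))‖ ≤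
      (4 * l + 6) * (4 * l + 10) * (4 * l + 8) * (mu ρ / ‖2 - ρ‖ ^ 2) := by
  have h := UU_re hz
  have hn := UU_norm hl hz
  refine (pair_bound (by linarith) ρ).trans ?_
  have hm := mu_nonneg ρ
  have a1 : ‖2 * z - 1‖ ≤ 4 * l + 6 := by
    have := norm_sub_le (2 * z) 1
    rw [norm_mul] at this; simp at this; linarith
  have a2 : 1 + ‖2 - z‖ / (z.re - 1) ≤ 4 * l + 10 := by
    have h1 := norm_sub_le 2 z
    simp at h1
    have : ‖2 - z‖ / (z.re - 1) ≤ ‖2 - z‖ * 2 := by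
      rw [div_le_iff₀ (by linarith)]
      nlinarith [norm_nonneg (2 - z)]
    linarith
  have a3 : 1 + ‖1 + z‖ / (z.re - 1) ≤ 4 * l + 8 := by
    have h1 := norm_add_le 1 z
    simp at h1
    have : ‖1 + z‖ / (z.re - 1) ≤ ‖1 + z‖ * 2 := by
      rw [div_le_iff₀ (by linarith)]
      nlinarith [norm_nonneg (1 + z)]
    linarith
  have p1 : 0 < z.re - 1 := by linarith
  gcongr

lemma Rm_Z {K : ℕ} {l : ℝ} (hl : 0 < l) {M : ℝ}
    (hM : ∀ ρ, mu ρ ≠ 0 → ‖2 - ρ‖ * ‖(l : ℂ) / (((l + 2 : ℝ) : ℂ) - ρ)‖ ^ K ≤ M) (ρ : ℂ) :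
    ‖Rm K l (fun z : ℂ => (mu ρ : ℂ) * (1 / (z - ρ) + 1 / (z - 1 + ρ)))‖ ≤
      M * (mu ρ * (1 / (2 - ρ)).re + mu ρ * (1 / (2 - 1 + ρ)).re) := by
  by_cases hm : mu ρ = 0
  · simp only [hm, ofReal_zero]
    rw [Rm_mul]; simp
  obtain ⟨h0, h1⟩ := mu_strip hm
  have hm' : mu (1 - ρ) ≠ 0 := by rwa [mu_one_sub]
  have one : ∀ r : ℂ, mu r ≠ 0 → AnalyticAt ℂ (fun z : ℂ => 1 / (z - r)) ((l + 2 : ℝ) : ℂ) ∧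
      ‖Rm K l (fun z : ℂ => 1 / (z - r))‖ ≤ M * (1 / (2 - r)).re := by
    intro r hr
    obtain ⟨h0, h1⟩ := mu_strip hr
    have n1 : (2 : ℂ) - r ≠ 0 := by intro e; have := congrArg re e; simp at this; linarith
    have n2 : ((l + 2 : ℝ) : ℂ) - r ≠ 0 := by intro e; have := congrArg re e; simp at this; linarith
    refine ⟨analyticAt_const.div (analyticAt_id.sub analyticAt_const) n2, ?_⟩
    rw [Rm_inv n1 n2, norm_mul, norm_pow, norm_div, norm_one, re_one_div]
    have hp : 0 < ‖2 - r‖ := norm_pos_iff.2 n1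
    have hh := hM r hr
    have hre : 1 ≤ (2 - r).re := by simp; linarith
    have hM0 : 0 ≤ M := le_trans (by positivity) hh
    rw [div_mul_eq_mul_div, one_mul, mul_div_assoc', div_le_div_iff₀ hp (by positivity)]
    calc ‖(l : ℂ) / (((l + 2 : ℝ) : ℂ) - r)‖ ^ K * ‖2 - r‖ ^ 2
        = (‖2 - r‖ * ‖(l : ℂ) / (((l + 2 : ℝ) : ℂ) - r)‖ ^ K) * ‖2 - r‖ := by ring
      _ ≤ M * (2 - r).re * ‖2 - r‖ := by
        refine mul_le_mul_of_nonneg_right ?_ hp.le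
        nlinarith
  have e : (fun z : ℂ => (mu ρ : ℂ) * (1 / (z - ρ) + 1 / (z - 1 + ρ))) =
      fun z : ℂ => (mu ρ : ℂ) * (1 / (z - ρ) + 1 / (z - (1 - ρ))) := by
    ext z; congr 4; ring
  have e2 : (2 : ℂ) - 1 + ρ = 2 - (1 - ρ) := by ring
  rw [e, e2, Rm_mul, Rm_add (one ρ hm).1 (one _ hm').1, norm_mul, norm_real,
    Real.norm_of_nonneg (mu_nonneg ρ)]
  have := norm_add_le (Rm K l (fun z : ℂ => 1 / (z - ρ))) (Rm K l (fun z : ℂ => 1 / (z - (1 - ρ))))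
  have a := (one ρ hm).2
  have b := (one _ hm').2
  have := mul_le_mul_of_nonneg_left (this.trans (add_le_add a b)) (mu_nonneg ρ)
  linarith

theorem smooth {K : ℕ} (hK : K ≠ 0) {l : ℝ} (hl : 0 < l) {M : ℝ}
    (hM : ∀ ρ, mu ρ ≠ 0 → ‖2 - ρ‖ * ‖(l : ℂ) / (((l + 2 : ℝ) : ℂ) - ρ)‖ ^ K ≤ M) (hM0 : 0 ≤ M) :
    ∃ S, HasSum (fun n : ℕ => vonMangoldt n * ((n : ℝ) ^ 2)⁻¹ * Qp K (l * Real.log n)) S ∧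
      S ≤ (l / (l + 1)) ^ K + 0.109 * M := by
  have hLS := Rm_LS (K := K) hl
  have hre := Complex.hasSum_re hLS
  simp only [ofReal_re] at hre
  refine ⟨_, hre, ?_⟩
  set D : ℕ → ℂ → ℂ := fun n z => 1 / ((n : ℂ) + 1) - 1 / ((n : ℂ) + 1 + z / 2) with hD
  set Z : ℂ → ℂ → ℂ := fun ρ z => (mu ρ : ℂ) * (1 / (z - ρ) + 1 / (z - 1 + ρ)) with hZ
  have sD : Summable fun n : ℕ => (2 * l + 5 / 2) * (1 / ((n : ℝ) + 1) ^ 2) := summable_inv_sq.mul_left _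
  have sZ : Summable fun ρ : ℂ => (4 * l + 6) * (4 * l + 10) * (4 * l + 8) * (mu ρ / ‖2 - ρ‖ ^ 2) :=
    summable_mu_norm.mul_left _
  have dD : ∀ n, DifferentiableOn ℂ (D n) (UU l) := fun n => dg_diff n l
  have dZ : ∀ ρ, DifferentiableOn ℂ (Z ρ) (UU l) := fun ρ => Z_diff ρ l
  have bD : ∀ n, ∀ z ∈ UU l, ‖D n z‖ ≤ (2 * l + 5 / 2) * (1 / ((n : ℝ) + 1) ^ 2) :=
    fun n z hz => dg_bd n hl z hz
  have bZ : ∀ ρ, ∀ z ∈ UU l, ‖Z ρ z‖ ≤ (4 * l + 6) * (4 * l + 10) * (4 * l + 8) * (mu ρ / ‖2 - ρ‖ ^ 2) :=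
    fun ρ z hz => Z_bd hl ρ z hz
  have hDs := Rm_hasSum (F := D) sD hl K dD bD
  have hZs := Rm_hasSum (F := Z) sZ hl K dZ bZ
  have hmem : UU l ∈ 𝓝 ((l + 2 : ℝ) : ℂ) := isOpen_ball.mem_nhds (UU_sg hl)
  have aD : AnalyticAt ℂ (fun z => ∑' n, D n z) ((l + 2 : ℝ) : ℂ) :=
    (differentiableOn_tsum_of_summable_norm sD dD isOpen_ball bD).analyticAt hmem
  have aZ : AnalyticAt ℂ (fun z => ∑' n, Z n z) ((l + 2 : ℝ) : ℂ) :=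
    (differentiableOn_tsum_of_summable_norm sZ dZ isOpen_ball bZ).analyticAt hmem
  set c : ℂ := -(Real.log Real.pi / 2 : ℝ) + 1 / 2 * (-(Real.eulerMascheroniConstant : ℂ)) with hc
  have n1 : (2 : ℂ) - 1 ≠ 0 := by norm_num
  have n2 : ((l + 2 : ℝ) : ℂ) - 1 ≠ 0 := by
    intro e; have := congrArg re e; simp at this; linarith
  have a1 : AnalyticAt ℂ (fun z : ℂ => 1 / (z - 1)) ((l + 2 : ℝ) : ℂ) :=
    analyticAt_const.div (analyticAt_id.sub analyticAt_const) n2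
  have a3 : AnalyticAt ℂ (fun z : ℂ => 1 / 2 * ∑' n, D n z) ((l + 2 : ℝ) : ℂ) := analyticAt_const.mul aD
  have a4 : AnalyticAt ℂ (fun z : ℂ => (-1 / 2) * ∑' n, Z n z) ((l + 2 : ℝ) : ℂ) := analyticAt_const.mul aZ
  have a12 : AnalyticAt ℂ (fun z : ℂ => 1 / (z - 1) + c) ((l + 2 : ℝ) : ℂ) := a1.add analyticAt_const
  have a123 : AnalyticAt ℂ (fun z : ℂ => (1 / (z - 1) + c) + 1 / 2 * ∑' n, D n z) ((l + 2 : ℝ) : ℂ) :=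
    a12.add a3
  have main : Rm K l (fun z => LSeries (fun n => (vonMangoldt n : ℂ)) z) =
      1 / (2 - 1) * ((l : ℂ) / (((l + 2 : ℝ) : ℂ) - 1)) ^ K + 1 / 2 * Rm K l (fun z => ∑' n, D n z)
        + (-1 / 2) * Rm K l (fun z => ∑' n, Z n z) := by
    have : Rm K l (fun z => LSeries (fun n => (vonMangoldt n : ℂ)) z) =
        Rm K l (fun z => ((1 / (z - 1) + c) + 1 / 2 * ∑' n, D n z) + (-1 / 2) * ∑' n, Z n z) := by
      refine Rm_congr hl fun z hz => ?_
      have h := UU_re hz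
      rw [vonMangoldt_formula (by linarith), logDeriv_xi (by linarith),
        digamma_series (s := z / 2) (by simp; linarith)]
      simp only [hD, hZ, hc]; ring
    rw [this, Rm_add a123 a4, Rm_add a12 a3,
      Rm_add a1 analyticAt_const, Rm_const hK, Rm_inv n1 n2, Rm_mul, Rm_mul, add_zero]
  rw [main, add_re, add_re]
  have t1 : (1 / (2 - 1) * ((l : ℂ) / (((l + 2 : ℝ) : ℂ) - 1)) ^ K).re = (l / (l + 1)) ^ K := by
    have : 1 / (2 - 1) * ((l : ℂ) / (((l + 2 : ℝ) : ℂ) - 1)) ^ K = (((l / (l + 1)) ^ K : ℝ) : ℂ) := by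
      push_cast; rw [show (l : ℂ) + 2 - 1 = l + 1 by ring]; norm_num
    rw [this, ofReal_re]
  have t2 : (1 / 2 * Rm K l (fun z => ∑' n, D n z)).re ≤ 0 := by
    rw [show (1 : ℂ) / 2 = ((1 / 2 : ℝ) : ℂ) by norm_num, re_ofReal_mul]
    have := (Complex.hasSum_re hDs).nonpos fun n => Rm_dg hK hl n
    linarith
  have t3 : ((-1 / 2) * Rm K l (fun z => ∑' n, Z n z)).re ≤ 0.109 * M := by
    refine (re_le_norm _).trans ?_
    have hs : HasSum (fun ρ : ℂ => M * (mu ρ * (1 / (2 - ρ)).re + mu ρ * (1 / (2 - 1 + ρ)).re))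
        (M * (2 * (logDeriv xi 2).re)) := by
      refine HasSum.mul_left M ?_
      have h := (summable_pair (z := 2) (by simp)).of_norm.hasSum
      have h2 := Complex.hasSum_re h
      have e : (∑' ρ : ℂ, (mu ρ : ℂ) * (1 / (2 - ρ) + 1 / (2 - 1 + ρ))).re = 2 * (logDeriv xi 2).re := by
        rw [logDeriv_xi (z := 2) (by simp), show (1 : ℂ) / 2 = ((1 / 2 : ℝ) : ℂ) by norm_num,
          re_ofReal_mul]; ring
      rw [e] at h2
      refine h2.congr_fun ?_ 
      intro ρ
      rw [re_ofReal_mul, add_re]; ring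
    have hle : ‖Rm K l (fun z => ∑' n, Z n z)‖ ≤ M * (2 * (logDeriv xi 2).re) := by
      rw [← hZs.tsum_eq]
      exact tsum_of_norm_bounded hs fun ρ => Rm_Z hl hM ρ
    rw [norm_mul, show ‖(-1 / 2 : ℂ)‖ = 1 / 2 by norm_num]
    have := P2_le
    nlinarith
  rw [t1]
  linarith

end PNT
end

section
open Complex Filter Topology Metric MeasureTheory Set ArithmeticFunction
open scoped ComplexConjugate Nat

namespace PNT

lemma zf_lin {r u w : ℝ} (hr : 0 ≤ r) (hu : 0 ≤ u) (hx : 0 < 1 + r * (u + w)) :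
    1 + (1 - r) * u - r * w ≤ Real.exp u / (1 + r * (u + w)) := by
  rw [le_div_iff₀ hx]
  have h := Real.quadratic_le_exp_of_nonneg hu
  nlinarith [sq_nonneg (u * (1 - 2 * r) / 2 - r * w), sq_nonneg u]

lemma gauss_lin {t y : ℝ} (ht : 0 < t) (hy : 0 < y) :
    t / (1 + t) * (1 + Real.log y) ≤ Real.log (1 + t * y) := by
  have h1 : (0 : ℝ) < 1 + t := by linarith
  have hc := strictConcaveOn_log_Ioi.concaveOn.2 (show (1 : ℝ) ∈ Ioi 0 by simp) (show y ∈ Ioi 0 from hy)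
    (show 0 ≤ 1 / (1 + t) by positivity) (show 0 ≤ t / (1 + t) by positivity) (by field_simp)
  simp only [smul_eq_mul, Real.log_one, mul_zero, zero_add, mul_one] at hc
  have e : 1 + t * y = (1 + t) * (1 / (1 + t) + t / (1 + t) * y) := by field_simp
  have h2 := Real.one_sub_inv_le_log_of_pos h1
  have e2 : 1 - (1 + t)⁻¹ = t / (1 + t) := by field_simp; ring
  rw [e, Real.log_mul h1.ne' (by positivity)]
  rw [e2] at h2
  linarith

lemma log400_hi : Real.log 400 ≤ 5.9915 := by
  have : Real.log 400 = 4 * Real.log 2 + 2 * Real.log 5 := by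
    rw [show (400 : ℝ) = 2 ^ 4 * 5 ^ 2 by norm_num, Real.log_mul (by norm_num) (by norm_num),
      Real.log_pow, Real.log_pow]; push_cast; ring
  linarith [log2_hi, log5_hi]

lemma log400_lo : 5.9914 ≤ Real.log 400 := by
  have : Real.log 400 = 4 * Real.log 2 + 2 * Real.log 5 := by
    rw [show (400 : ℝ) = 2 ^ 4 * 5 ^ 2 by norm_num, Real.log_mul (by norm_num) (by norm_num),
      Real.log_pow, Real.log_pow]; push_cast; ring
  linarith [log2_lo, log5_lo]

lemma loglog_bd {L : ℝ} (hL : 400 ≤ L) : Real.log L ≤ 0.015 * L ∧ 5.9914 ≤ Real.log L := by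
  have h0 : Real.log L = Real.log 400 + Real.log (L / 400) := by
    rw [Real.log_div (by linarith) (by norm_num)]; ring
  have h1 := Real.log_le_sub_one_of_pos (show 0 < L / 400 by linarith)
  have h2 := Real.log_nonneg (show 1 ≤ L / 400 by linarith)
  constructor
  · linarith [log400_hi]
  · linarith [log400_lo]

/-- exponent inequality on zeros -/
lemma zero_exp {L g e G : ℝ} (hL : 400 ≤ L) (hg : 0 ≤ g)
    (hz : ∀ T : ℝ, 100 ≤ T → g ≤ T → 1.053 / (18.38 * Real.log T - 47.5) ≤ e) (hG : 0 ≤ G)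
    (hG2 : 0 < g → (1 + (1.053 * 400 / 62.624) * (18.38 / 62.624)) / 2 *
      (1 + Real.log (g ^ 2 / (0.7 * L ^ 2))) ≤ G) :
    Real.log (g + 2) + Real.log L + 0.0363 - e * L - G ≤ 3.4965 := by
  set u := Real.log (L / 400) with hu
  have hu0 : 0 ≤ u := Real.log_nonneg (by linarith)
  have hLu : L = 400 * Real.exp u := by rw [hu, Real.exp_log (by linarith)]; ring
  have hl : Real.log L = Real.log 400 + u := by
    rw [hu, Real.log_div (by linarith) (by norm_num)]; ring
  have key : ∀ w T : ℝ, 100 ≤ T → g ≤ T → Real.log T = Real.log L + w →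
      1.053 * 400 / 62.624 * (1 + (1 - 18.38 / 62.624) * u - 18.38 / 62.624 * w) ≤ e * L := by
    intro w T hT hgT hw
    have h1 := hz T hT hgT
    have hlT : 4 ≤ Real.log T := by
      have := Real.log_le_log (by norm_num) hT
      rw [log100] at this
      linarith [log2_lo, log5_lo]
    have hp : 0 < 18.38 * Real.log T - 47.5 := by linarith
    have hx : 18.38 * Real.log T - 47.5 ≤ 62.624 * (1 + 18.38 / 62.624 * (u + w)) := by
      rw [hw, hl]; linarith [log400_hi]
    have hx0 : 0 < 1 + 18.38 / 62.624 * (u + w) := by linarith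
    have h2 := zf_lin (r := 18.38 / 62.624) (u := u) (w := w) (by norm_num) hu0 hx0
    have h3 : 1.053 / (62.624 * (1 + 18.38 / 62.624 * (u + w))) ≤ 1.053 / (18.38 * Real.log T - 47.5) :=
      div_le_div_of_nonneg_left (by norm_num) hp hx
    have h4 : e * L ≥ 1.053 / (62.624 * (1 + 18.38 / 62.624 * (u + w))) * (400 * Real.exp u) := by
      rw [← hLu]; exact mul_le_mul_of_nonneg_right (h3.trans h1) (by linarith)
    have h5 : 1.053 / (62.624 * (1 + 18.38 / 62.624 * (u + w))) * (400 * Real.exp u) =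
        1.053 * 400 / 62.624 * (Real.exp u / (1 + 18.38 / 62.624 * (u + w))) := by
      rw [mul_comm (62.624 : ℝ), ← div_div]; ring
    rw [h5] at h4
    refine le_trans ?_ h4
    exact mul_le_mul_of_nonneg_left h2 (by norm_num)
  rcases le_or_gt g (L / 2) with hc | hc
  · have h1 := key (-Real.log 2) (L / 2) (by linarith) hc (by
      rw [Real.log_div (by linarith) (by norm_num)]; ring)
    have h2 : Real.log (g + 2) ≤ Real.log (L / 2) + 0.01 := by
      have : g + 2 ≤ L / 2 * 1.01 := by linarith
      have h := Real.log_le_log (by linarith) this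
      rw [Real.log_mul (by linarith) (by norm_num)] at h
      linarith [Real.log_le_sub_one_of_pos (show (0 : ℝ) < 1.01 by norm_num)]
    rw [Real.log_div (by linarith) (by norm_num)] at h2
    rw [hl] at h2 ⊢
    have := log400_hi
    have := log2_lo
    norm_num at h1 ⊢
    linarith
  · have hg0 : 0 < g := by linarith
    have h1 := key (Real.log (g / L)) g (by linarith) le_rfl (by
      rw [Real.log_div (by linarith) (by linarith)]; ring)
    have h2 : Real.log (g + 2) ≤ Real.log g + 0.01 := by
      have : g + 2 ≤ g * 1.01 := by linarith
      have h := Real.log_le_log (by linarith) this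
      rw [Real.log_mul (by linarith) (by norm_num)] at h
      linarith [Real.log_le_sub_one_of_pos (show (0 : ℝ) < 1.01 by norm_num)]
    have h3 := hG2 hg0
    have h4 : Real.log (g ^ 2 / (0.7 * L ^ 2)) = 2 * Real.log g - 2 * Real.log L + Real.log 10 - Real.log 7 := by
      rw [Real.log_div (by positivity) (by positivity), Real.log_mul (by norm_num) (by positivity),
        Real.log_pow, Real.log_pow, show (0.7 : ℝ) = 7 / 10 by norm_num, Real.log_div (by norm_num) (by norm_num)]
      push_cast; ring
    rw [h4, log10_eq] at h3
    rw [Real.log_div (by linarith) (by linarith)] at h1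
    have := log400_hi
    have := log2_lo
    have := log5_lo
    have := log7_hi
    rw [hl] at h1 h3 ⊢
    norm_num at h1 h3 ⊢
    linarith

end PNT
end

section
open Complex Filter Topology Metric MeasureTheory Set ArithmeticFunction
open scoped ComplexConjugate Nat

namespace PNT

set_option maxHeartbeats 1000000 in
lemma zero_bd {L l a : ℝ} {K : ℕ} (hL : 400 ≤ L) (ha : a = 1.2 * Real.log L / L)
    (hl0 : L ^ 3 / (0.72 * Real.log L) ≤ l) (hl1 : l ≤ L ^ 3 / (0.72 * Real.log L) + 1)
    (hK : (K : ℝ) = l * (L - a)) {ρ : ℂ} (hρ : mu ρ ≠ 0) :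
    ‖2 - ρ‖ * ‖(l : ℂ) / (((l + 2 : ℝ) : ℂ) - ρ)‖ ^ K ≤ Real.exp (-L) * (3.6 / (0.109 * L)) := by
  obtain ⟨b1, b2⟩ := loglog_bd hL
  set ℓ := Real.log L with hℓ
  have hLp : 0 < L := by linarith
  have ha0 : 0 ≤ a := by rw [ha]; positivity
  have ha1 : a ≤ 0.018 := by rw [ha, div_le_iff₀ hLp]; linarith
  have hlbig : 92 * L ^ 2 ≤ l := by
    refine le_trans ?_ hl0
    rw [le_div_iff₀ (by positivity)]
    nlinarith [sq_nonneg L, mul_le_mul_of_nonneg_left b1 (sq_nonneg L)]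
  have hl6 : 14000000 ≤ l := by nlinarith
  have hlp : 0 < l := by linarith
  have hLl : L / l ≤ 0.00003 := by
    rw [div_le_iff₀ hlp]; nlinarith
  obtain ⟨s1, s2⟩ := mu_strip hρ
  set η := 1 - ρ.re with hη
  set g := |ρ.im| with hg
  have hg0 : 0 ≤ g := abs_nonneg _
  have hη0 : 0 ≤ η := by linarith
  have hη1 : η ≤ 1 := by linarith
  have n1 : ‖2 - ρ‖ ≤ g + 2 := by
    refine (Complex.norm_le_abs_re_add_abs_im _).trans ?_
    have : |(2 - ρ).re| ≤ 2 := by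
      rw [abs_le]; constructor <;> simp <;> linarith
    have h2 : |(2 - ρ).im| = g := by simp [hg]
    linarith
  have n2 : ‖((l + 2 : ℝ) : ℂ) - ρ‖ ^ 2 = (l + 1 + η) ^ 2 + g ^ 2 := by
    rw [← Complex.normSq_eq_norm_sq, Complex.normSq_apply, hg, sq_abs, hη]
    simp; ring
  set t := g ^ 2 / (l + 2) ^ 2 with ht
  have ht0 : 0 ≤ t := by positivity
  set G := (K : ℝ) / 2 * Real.log (1 + t) with hGd
  have hG0 : 0 ≤ G := mul_nonneg (by positivity) (Real.log_nonneg (by linarith))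
  have hn : 0 < ‖((l + 2 : ℝ) : ℂ) - ρ‖ := by
    by_contra h
    have h0 : ‖((l + 2 : ℝ) : ℂ) - ρ‖ = 0 := le_antisymm (not_lt.1 h) (norm_nonneg _)
    rw [h0] at n2
    nlinarith [sq_nonneg g]
  have hlog : (1 + η) / (l + 2) + 1 / 2 * Real.log (1 + t) ≤
      Real.log (‖((l + 2 : ℝ) : ℂ) - ρ‖ / l) := by
    have e1 : Real.log (‖((l + 2 : ℝ) : ℂ) - ρ‖ / l) =
        1 / 2 * Real.log ((‖((l + 2 : ℝ) : ℂ) - ρ‖ / l) ^ 2) := by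
      rw [Real.log_pow]; push_cast; ring
    have e2 : (‖((l + 2 : ℝ) : ℂ) - ρ‖ / l) ^ 2 =
        ((l + 1 + η) / l) ^ 2 * (1 + g ^ 2 / (l + 1 + η) ^ 2) := by
      rw [div_pow, n2]
      have : l + 1 + η ≠ 0 := by linarith
      field_simp
    have p1 : 0 < (l + 1 + η) / l := div_pos (by linarith) hlp
    rw [e1, e2, Real.log_mul (by positivity) (by positivity), Real.log_pow]
    have q1 : Real.log (1 + t) ≤ Real.log (1 + g ^ 2 / (l + 1 + η) ^ 2) := by
      refine Real.log_le_log (by linarith) ?_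
      have : t ≤ g ^ 2 / (l + 1 + η) ^ 2 := by
        refine div_le_div_of_nonneg_left (by positivity) (by positivity) ?_
        exact pow_le_pow_left₀ (by linarith) (by linarith) 2
      linarith
    have q2 := Real.one_sub_inv_le_log_of_pos p1
    have q3 : (1 + η) / (l + 2) ≤ 1 - ((l + 1 + η) / l)⁻¹ := by
      have : 1 - ((l + 1 + η) / l)⁻¹ = (1 + η) / (l + 1 + η) := by
        have : l + 1 + η ≠ 0 := by linarith
        field_simp; ring
      rw [this]
      exact div_le_div_of_nonneg_left (by linarith) (by linarith) (by linarith)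
    push_cast
    linarith
  have hKlog : (1 + η) * L - 2 * a - 4 * (L / l) + G ≤
      K * Real.log (‖((l + 2 : ℝ) : ℂ) - ρ‖ / l) := by
    have h1 := mul_le_mul_of_nonneg_left hlog (Nat.cast_nonneg (α := ℝ) K)
    have h2 : (1 + η) * L - 2 * a - 4 * (L / l) ≤ K * ((1 + η) / (l + 2)) := by
      rw [hK]
      have e : l * (L - a) * ((1 + η) / (l + 2)) = (1 + η) * (L - a) - 2 * (1 + η) * (L - a) / (l + 2) := by
        field_simp; ring
      rw [e]
      have : 2 * (1 + η) * (L - a) / (l + 2) ≤ 4 * (L / l) := by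
        rw [div_le_iff₀ (by linarith), mul_comm (4 : ℝ), div_mul_eq_mul_div, div_mul_eq_mul_div, le_div_iff₀ hlp]
        have h7 : (1 + η) * (L - a) ≤ 2 * L := mul_le_mul (by linarith) (by linarith) (by linarith) (by norm_num)
        have h8 := mul_le_mul_of_nonneg_right h7 hlp.le
        linarith
      have h9 : η * a ≤ 1 * a := mul_le_mul_of_nonneg_right hη1 ha0
      linarith
    rw [hGd]; linarith
  have hmain : Real.log (g + 2) + ℓ + 0.0363 - η * L - G ≤ 3.4965 := by
    refine zero_exp hL hg0 (fun T h1 h2 => zfr hρ h1 h2) hG0 fun hgp => ?_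
    set y := g ^ 2 / (0.7 * L ^ 2) with hy
    have hy0 : 0 < y := by positivity
    set t1 := 0.7 * L ^ 2 / (l + 2) ^ 2 with ht1
    have ht10 : 0 < t1 := by positivity
    have hty : t1 * y = t := by
      rw [ht1, hy, ht]; field_simp
    have h1 := gauss_lin ht10 hy0
    rw [hty] at h1
    set G0 : ℝ := (1 + (1.053 * 400 / 62.624) * (18.38 / 62.624)) / 2 with hG0d
    have hG01 : 0 < G0 := by rw [hG0d]; norm_num
    have hG02 : G0 ≤ 1.48702 := by rw [hG0d]; norm_num
    have hGn : G0 ≤ K / 2 * (t1 / (1 + t1)) := by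
      have e : t1 / (1 + t1) = 0.7 * L ^ 2 / ((l + 2) ^ 2 + 0.7 * L ^ 2) := by
        rw [ht1]; field_simp
      rw [e, hK, ← mul_div_assoc, le_div_iff₀ (by positivity)]
      have c1 : (l + 2) ^ 2 + 0.7 * L ^ 2 ≤ 1.0001 * l ^ 2 := by nlinarith
      have c2 : l ≤ 1.0001 * (L ^ 3 / (0.72 * ℓ)) := by linarith
      have c3 : 0.72 * ℓ * l ≤ 1.0001 * L ^ 3 := by
        rw [← mul_div_assoc, le_div_iff₀ (by positivity)] at c2; linarith
      have c4 : 0.9999 * L ≤ L - a := by linarith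
      have c5 : l * (0.9999 * L) / 2 * (0.7 * L ^ 2) ≤ l * (L - a) / 2 * (0.7 * L ^ 2) := by gcongr
      refine le_trans ?_ c5
      have c6 : G0 * ((l + 2) ^ 2 + 0.7 * L ^ 2) ≤ 1.48702 * (1.0001 * l ^ 2) := by gcongr
      refine c6.trans ?_
      have c7 : 4.31 * l ≤ 1.0001 * L ^ 3 := by nlinarith
      nlinarith [mul_le_mul_of_nonneg_left c7 hlp.le]
    rcases le_or_gt (1 + Real.log y) 0 with hn | hp
    · exact (mul_nonpos_of_nonneg_of_nonpos hG01.le hn).trans hG0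
    · calc G0 * (1 + Real.log y) ≤ (K / 2 * (t1 / (1 + t1))) * (1 + Real.log y) := by gcongr
        _ = K / 2 * (t1 / (1 + t1) * (1 + Real.log y)) := by ring
        _ ≤ G := by rw [hGd]; gcongr
  have e3 : ‖(l : ℂ) / (((l + 2 : ℝ) : ℂ) - ρ)‖ ^ K =
      Real.exp (-(K * Real.log (‖((l + 2 : ℝ) : ℂ) - ρ‖ / l))) := by
    rw [norm_div, Complex.norm_of_nonneg hlp.le, Real.exp_neg, mul_comm, Real.exp_mul,
      Real.exp_log (by positivity), Real.rpow_natCast, ← inv_pow, inv_div]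
  have e4 : g + 2 = Real.exp (Real.log (g + 2)) := (Real.exp_log (by linarith)).symm
  have e5 : Real.exp (3.4965 - ℓ) ≤ 3.6 / (0.109 * L) := by
    have h33 : Real.log 33 = Real.log 3 + Real.log 11 := by
      rw [← Real.log_mul (by norm_num) (by norm_num)]; norm_num
    have : (3.4965 : ℝ) ≤ Real.log 33 := by linarith [log3_lo, log11_lo]
    have h3 : Real.exp 3.4965 ≤ 33 := by
      rw [← Real.exp_log (show (0:ℝ) < 33 by norm_num)]; exact Real.exp_le_exp.2 this
    rw [Real.exp_sub, hℓ, Real.exp_log hLp, div_le_div_iff₀ hLp (by positivity)]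
    nlinarith
  rw [e3]
  calc ‖2 - ρ‖ * Real.exp (-(K * Real.log (‖((l + 2 : ℝ) : ℂ) - ρ‖ / l)))
      ≤ Real.exp (Real.log (g + 2)) * Real.exp (-((1 + η) * L - 2 * a - 4 * (L / l) + G)) := by
        rw [← e4]
        gcongr
    _ = Real.exp (Real.log (g + 2) - ((1 + η) * L - 2 * a - 4 * (L / l) + G)) := by
        rw [← Real.exp_add]; ring_nf
    _ ≤ Real.exp (-L + (3.4965 - ℓ)) := by
        apply Real.exp_le_exp.2
        linarith
    _ = Real.exp (-L) * Real.exp (3.4965 - ℓ) := Real.exp_add _ _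
    _ ≤ _ := by gcongr

end PNT
end

section
open Complex Filter Topology Metric MeasureTheory Set ArithmeticFunction
open scoped ComplexConjugate Nat

namespace PNT

lemma Qp_nonneg (K : ℕ) {y : ℝ} (hy : 0 ≤ y) : 0 ≤ Qp K y := by
  unfold Qp
  have h := Real.sum_le_exp_of_nonneg hy K
  have := mul_le_mul_of_nonneg_left h (Real.exp_pos (-y)).le
  rw [← Real.exp_add, neg_add_cancel, Real.exp_zero] at this
  linarith

lemma ent_bd {s : ℝ} (hs : 0 < s) (hs1 : s ≤ 1) : (1 - s) ^ 2 / 2 ≤ s * Real.log s + 1 - s := by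
  have h := Real.self_le_sinh_iff.2 (show 0 ≤ -Real.log s by linarith [Real.log_nonpos hs.le hs1])
  rw [Real.sinh_eq, neg_neg, Real.exp_neg, Real.exp_log hs] at h
  have h2 := mul_le_mul_of_nonneg_left h hs.le
  have h3 : s * ((s⁻¹ - s) / 2) = (1 - s ^ 2) / 2 := by field_simp
  rw [h3] at h2
  nlinarith

lemma chern {K : ℕ} {Y s y : ℝ} (hY : 0 < Y) (hs : 0 < s) (hs1 : s ≤ 1) (hK : (K : ℝ) = Y * s)
    (hy : Y ≤ y) : 1 - Real.exp (-(Y * ((1 - s) ^ 2 / 2))) ≤ Qp K y := by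
  unfold Qp
  have hy0 : 0 ≤ y := hY.le.trans hy
  have h1 : s ^ K * ∑ k ∈ Finset.range K, y ^ k / (k ! : ℝ) ≤ Real.exp (s * y) := by
    refine le_trans ?_ (Real.sum_le_exp_of_nonneg (show 0 ≤ s * y by positivity) K)
    rw [Finset.mul_sum]
    refine Finset.sum_le_sum fun k hk => ?_
    rw [mul_pow, mul_div_assoc]
    have := pow_le_pow_of_le_one hs.le hs1 (Finset.mem_range.1 hk).le
    gcongr
  have h2 : s ^ K = Real.exp (Real.log s * (Y * s)) := by
    rw [← hK, Real.exp_mul, Real.exp_log hs, Real.rpow_natCast]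
  have h3 : ∑ k ∈ Finset.range K, y ^ k / (k ! : ℝ) ≤ Real.exp (s * y - Real.log s * (Y * s)) := by
    rw [Real.exp_sub, le_div_iff₀ (Real.exp_pos _), ← h2]; linarith
  have h4 : Real.exp (-y) * ∑ k ∈ Finset.range K, y ^ k / (k ! : ℝ) ≤
      Real.exp (-(Y * ((1 - s) ^ 2 / 2))) := by
    calc _ ≤ Real.exp (-y) * Real.exp (s * y - Real.log s * (Y * s)) := by gcongr
      _ = Real.exp (-y + (s * y - Real.log s * (Y * s))) := (Real.exp_add _ _).symm
      _ ≤ _ := by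
        apply Real.exp_le_exp.2
        have a1 := mul_le_mul_of_nonneg_left (ent_bd hs hs1) hY.le
        have a2 := mul_le_mul_of_nonneg_left hy (show 0 ≤ 1 - s by linarith)
        nlinarith
  linarith

noncomputable def tauT (x : ℝ) (n : ℕ) : ℝ := if x ≤ n then vonMangoldt n * ((n : ℝ) ^ 2)⁻¹ else 0

noncomputable def tau (x : ℝ) : ℝ := ∑' n : ℕ, tauT x n

lemma summable_vm2 : Summable fun n : ℕ => (vonMangoldt n : ℝ) * ((n : ℝ) ^ 2)⁻¹ := by
  have h := (LSeriesSummable_vonMangoldt (s := 2) (by simp)).norm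
  refine h.congr fun n => ?_
  rcases Nat.eq_zero_or_pos n with h0 | h0
  · subst h0; simp
  · rw [LSeries.norm_term_eq, if_neg h0.ne']
    simp [abs_of_nonneg vonMangoldt_nonneg, div_eq_mul_inv]

lemma vm2_nonneg (n : ℕ) : 0 ≤ (vonMangoldt n : ℝ) * ((n : ℝ) ^ 2)⁻¹ :=
  mul_nonneg vonMangoldt_nonneg (by positivity)

lemma tauT_nonneg (x : ℝ) (n : ℕ) : 0 ≤ tauT x n := by
  unfold tauT; split_ifs
  · exact vm2_nonneg n
  · exact le_rfl

lemma tauT_le (x : ℝ) (n : ℕ) : tauT x n ≤ vonMangoldt n * ((n : ℝ) ^ 2)⁻¹ := by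
  unfold tauT; split_ifs
  · exact le_rfl
  · exact vm2_nonneg n

lemma summable_tauT (x : ℝ) : Summable (tauT x) :=
  Summable.of_nonneg_of_le (tauT_nonneg x) (tauT_le x) summable_vm2

theorem tau_large {L : ℝ} (hL : 400 ≤ L) :
    Real.exp L * tau (Real.exp L) ≤ 1 + 2 * Real.log L / L := by
  obtain ⟨b1, b2⟩ := loglog_bd hL
  set ℓ := Real.log L with hℓ
  have hLp : 0 < L := by linarith
  obtain ⟨a, ha⟩ : ∃ a, a = 1.2 * ℓ / L := ⟨_, rfl⟩
  have ha0 : 0 ≤ a := by rw [ha]; positivity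
  have ha1 : a ≤ 0.018 := by rw [ha, div_le_iff₀ hLp]; linarith
  obtain ⟨l0, hl0⟩ : ∃ l0, l0 = L ^ 3 / (0.72 * ℓ) := ⟨_, rfl⟩
  have hl0b : 92 * L ^ 2 ≤ l0 := by
    rw [hl0, le_div_iff₀ (by positivity)]
    nlinarith [sq_nonneg L, mul_le_mul_of_nonneg_left b1 (sq_nonneg L)]
  have hl00 : 0 < l0 := by nlinarith
  obtain ⟨K, hK⟩ : ∃ K, K = ⌈l0 * (L - a)⌉₊ := ⟨_, rfl⟩
  have hd : 1 ≤ L - a := by linarith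
  have hdp : 0 < L - a := by linarith
  obtain ⟨l, hl⟩ : ∃ l, l = K / (L - a) := ⟨_, rfl⟩
  have hKl : (K : ℝ) = l * (L - a) := by rw [hl, div_mul_cancel₀ _ hdp.ne']
  have hk1 : l0 * (L - a) ≤ K := hK ▸ Nat.le_ceil _
  have hk2 : (K : ℝ) < l0 * (L - a) + 1 := hK ▸ Nat.ceil_lt_add_one (by positivity)
  have l1 : l0 ≤ l := by rw [hl, le_div_iff₀ hdp]; exact hk1
  have l2 : l ≤ l0 + 1 := by rw [hl, div_le_iff₀ hdp]; linarith
  have hlp : 0 < l := by linarith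
  have hK0 : K ≠ 0 := by
    rintro h; rw [h] at hk1; have : 0 < l0 * (L - a) := by positivity
    simp at hk1; linarith
  have hM0 : 0 ≤ Real.exp (-L) * (3.6 / (0.109 * L)) := by positivity
  obtain ⟨S, hS, hSle⟩ := smooth hK0 hlp
    (fun ρ hρ => zero_bd hL ha (hl0 ▸ l1) (hl0 ▸ l2) hKl hρ) hM0
  have hlow : (1 - 1 / L) * tau (Real.exp L) ≤ S := by
    unfold tau
    rw [← tsum_mul_left]
    refine hasSum_le ?_ ((summable_tauT _).mul_left _).hasSum hS
    intro n
    rcases Nat.eq_zero_or_pos n with h0 | h0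
    · subst h0; simp [tauT]
    have hn1 : (1 : ℝ) ≤ n := by exact_mod_cast h0
    unfold tauT
    split_ifs with hc
    · have hlogn : L ≤ Real.log n := by
        rw [Real.le_log_iff_exp_le (by linarith)]; exact hc
      have h := chern (K := K) (Y := l * L) (s := (L - a) / L) (y := l * Real.log n) (by positivity)
        (by positivity) (by rw [div_le_one hLp]; linarith) (by rw [hKl]; field_simp) (by gcongr)
      have hE : Real.exp (-(l * L * ((1 - (L - a) / L) ^ 2 / 2))) ≤ 1 / L := by
        have : ℓ ≤ l * L * ((1 - (L - a) / L) ^ 2 / 2) := by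
          have e : l * L * ((1 - (L - a) / L) ^ 2 / 2) = l * a ^ 2 / (2 * L) := by field_simp; ring
          rw [e, le_div_iff₀ (by positivity)]
          have e2 : l0 * a ^ 2 = ℓ * (2 * L) := by rw [hl0, ha]; field_simp; norm_num
          nlinarith [sq_nonneg a]
        calc _ ≤ Real.exp (-ℓ) := Real.exp_le_exp.2 (by linarith)
          _ = 1 / L := by rw [Real.exp_neg, hℓ, Real.exp_log hLp, one_div]
      have := mul_le_mul_of_nonneg_left (show 1 - 1 / L ≤ Qp K (l * Real.log n) by linarith) (vm2_nonneg n)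
      linarith
    · rw [mul_zero]
      exact mul_nonneg (vm2_nonneg n) (Qp_nonneg K (mul_nonneg hlp.le (Real.log_nonneg hn1)))
  have hmain : Real.exp L * (l / (l + 1)) ^ K ≤ 1 + 1.225 * (ℓ / L) := by
    have h1 : (l / (l + 1)) ^ K ≤ Real.exp (-L + a + L / l) := by
      have h0 : Real.log (l / (l + 1)) ≤ -(1 / (l + 1)) := by
        refine (Real.log_le_sub_one_of_pos (by positivity)).trans (le_of_eq ?_)
        field_simp; ring
      rw [← Real.exp_log (show 0 < (l / (l + 1)) ^ K by positivity), Real.log_pow]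
      apply Real.exp_le_exp.2
      have h2 := mul_le_mul_of_nonneg_left h0 (Nat.cast_nonneg (α := ℝ) K)
      refine h2.trans ?_
      rw [hKl]
      have e : l * (L - a) * -(1 / (l + 1)) = -(L - a) + (L - a) / (l + 1) := by field_simp; ring
      rw [e]
      have : (L - a) / (l + 1) ≤ L / l := div_le_div₀ hLp.le (by linarith) hlp (by linarith)
      linarith
    have h2 : a + L / l ≤ 1.202 * (ℓ / L) := by
      have : L / l ≤ L / l0 := div_le_div_of_nonneg_left hLp.le hl00 l1
      have e : L / l0 = 0.72 * (ℓ / L) / L := by rw [hl0]; field_simp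
      have h3 : 0.72 * (ℓ / L) / L ≤ 0.002 * (ℓ / L) := by
        rw [div_le_iff₀ hLp]
        have : 0 < ℓ / L := by positivity
        nlinarith
      rw [ha, mul_div_assoc]; linarith
    have h4 : ℓ / L ≤ 0.015 := by rw [div_le_iff₀ hLp]; exact b1
    have h5 : 0 < ℓ / L := by positivity
    set b := 1.202 * (ℓ / L) with hb
    have h6 : Real.exp b ≤ 1 + b + b ^ 2 := by
      have := Real.abs_exp_sub_one_sub_id_le (x := b) (by rw [abs_of_nonneg (by positivity)]; linarith)
      have := (abs_le.1 this).2
      linarith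
    calc _ ≤ Real.exp L * Real.exp (-L + a + L / l) := by gcongr
      _ = Real.exp (a + L / l) := by rw [← Real.exp_add]; ring_nf
      _ ≤ Real.exp b := Real.exp_le_exp.2 h2
      _ ≤ 1 + b + b ^ 2 := h6
      _ ≤ _ := by rw [hb]; nlinarith
  have hfin := mul_le_mul_of_nonneg_left (hlow.trans hSle) (Real.exp_pos L).le
  have e1 : Real.exp L * ((l / (l + 1)) ^ K + 0.109 * (Real.exp (-L) * (3.6 / (0.109 * L)))) =
      Real.exp L * (l / (l + 1)) ^ K + 3.6 / L := by
    rw [Real.exp_neg]; field_simp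
  rw [e1] at hfin
  have h7 : (1 - 1 / L) * (Real.exp L * tau (Real.exp L)) ≤ 1 + 1.225 * (ℓ / L) + 3.6 / L := by linarith
  have hq : 0 < 1 - 1 / L := by
    have : 1 / L ≤ 1 / 400 := by gcongr
    linarith
  have h8 : 1 + 1.225 * (ℓ / L) + 3.6 / L ≤ (1 - 1 / L) * (1 + 2 * ℓ / L) := by
    have : (1 - 1 / L) * (1 + 2 * ℓ / L) - (1 + 1.225 * (ℓ / L) + 3.6 / L) =
        (0.775 * ℓ - 4.6 - 2 * (ℓ / L)) / L := by field_simp; ring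
    have h4 : ℓ / L ≤ 0.015 := by rw [div_le_iff₀ hLp]; exact b1
    have : 0 ≤ (0.775 * ℓ - 4.6 - 2 * (ℓ / L)) / L := div_nonneg (by linarith) hLp.le
    linarith
  exact le_of_mul_le_mul_left (h7.trans h8) hq

end PNT
end

section
open Filter Topology Set ArithmeticFunction

namespace PNT

noncomputable def ZtT (j i : ℕ) : ℝ := if j ≤ i then ((i : ℝ) ^ 2)⁻¹ else 0
noncomputable def Zt (j : ℕ) : ℝ := ∑' i : ℕ, ZtT j i
noncomputable def SlT (j i : ℕ) : ℝ := if j ≤ i then Real.log i * ((i : ℝ) ^ 2)⁻¹ else 0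
noncomputable def Sl (j : ℕ) : ℝ := ∑' i : ℕ, SlT j i

lemma summable_i2 : Summable fun i : ℕ => ((i : ℝ) ^ 2)⁻¹ :=
  Real.summable_nat_pow_inv.2 (by norm_num)

lemma ZtT_nonneg (j i : ℕ) : 0 ≤ ZtT j i := by unfold ZtT; split_ifs <;> positivity

lemma summable_ZtT (j : ℕ) : Summable (ZtT j) :=
  Summable.of_nonneg_of_le (ZtT_nonneg j) (fun i => by
    unfold ZtT; split_ifs; exacts [le_rfl, by positivity]) summable_i2

lemma Sl_hasSum {y : ℕ} :
    Summable (SlT y) ∧ HasSum (fun m : ℕ => vonMangoldt m * ((m : ℝ) ^ 2)⁻¹ * Zt ((y + m - 1) / m)) (Sl y) := by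
  set F : ℕ × ℕ → ℝ := fun b => if y ≤ b.1 * b.2 then
    vonMangoldt b.1 * ((b.1 : ℝ) ^ 2)⁻¹ * ((b.2 : ℝ) ^ 2)⁻¹ else 0 with hF
  have hs : Summable F := by
    refine Summable.of_nonneg_of_le (fun b => ?_) (fun b => ?_)
      (summable_vm2.mul_of_nonneg summable_i2 vm2_nonneg (fun i => by positivity))
    · simp only [hF]; split_ifs
      · exact mul_nonneg (vm2_nonneg _) (by positivity)
      · exact le_rfl
    · simp only [hF]; split_ifs
      · exact le_rfl
      · exact mul_nonneg (vm2_nonneg _) (by positivity)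
  have h1 := hs.hasSum.tsum_fiberwise (fun b => b.1 * b.2)
  have e1 : (fun c => ∑' b : (fun b : ℕ × ℕ => b.1 * b.2) ⁻¹' {c}, F b) = SlT y := by
    ext j
    rcases Nat.eq_zero_or_pos j with h0 | h0
    · subst h0
      have : ∀ b : (fun b : ℕ × ℕ => b.1 * b.2) ⁻¹' {0}, F b = 0 := by
        rintro ⟨⟨m, i⟩, hb⟩
        simp only [Set.mem_preimage, Set.mem_singleton_iff, mul_eq_zero] at hb
        simp only [hF]
        rcases hb with h | h <;> subst h <;> simp
      rw [tsum_congr this]; simp [SlT]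
    · have hset : (fun b : ℕ × ℕ => b.1 * b.2) ⁻¹' {j} = ↑(Nat.divisorsAntidiagonal j) := by
        ext b; simp [h0.ne']
      rw [hset, Finset.tsum_subtype' (Nat.divisorsAntidiagonal j) F]
      have : ∀ b ∈ Nat.divisorsAntidiagonal j, F b = if y ≤ j then vonMangoldt b.1 * ((j : ℝ) ^ 2)⁻¹ else 0 := by
        intro b hb
        have hb' := (Nat.mem_divisorsAntidiagonal.1 hb).1
        simp only [hF, hb']
        split_ifs
        · rw [← hb']; push_cast; rw [mul_pow, mul_inv]; ring
        · rfl
      rw [Finset.sum_congr rfl this]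
      unfold SlT
      split_ifs
      · rw [← Finset.sum_mul, Nat.sum_divisorsAntidiagonal (fun x _ => vonMangoldt x), vonMangoldt_sum]
      · simp
  rw [e1] at h1
  have h2 := hs.hasSum.prod_fiberwise (g := fun m => vonMangoldt m * ((m : ℝ) ^ 2)⁻¹ * Zt ((y + m - 1) / m))
    (fun m => by
      rcases Nat.eq_zero_or_pos m with h0 | h0
      · subst h0; simp only [hF]; simp
      have : (fun i => F (m, i)) = fun i => vonMangoldt m * ((m : ℝ) ^ 2)⁻¹ * ZtT ((y + m - 1) / m) i := by
        ext i
        simp only [hF, ZtT]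
        have : y ≤ m * i ↔ (y + m - 1) / m ≤ i := by
          rw [Nat.div_le_iff_le_mul_add_pred h0]; omega
        rw [if_congr this rfl rfl]
        split_ifs <;> simp
      rw [this]
      exact (summable_ZtT _).hasSum.mul_left _)
  refine ⟨h1.summable, ?_⟩
  unfold Sl
  rw [h1.tsum_eq]
  exact h2

end PNT
end

section
open Filter Topology Set ArithmeticFunction

namespace PNT

lemma tail_le {f g : ℕ → ℝ} {j : ℕ} (hf : Summable fun i => if j ≤ i then f i else 0)
    (hg : Tendsto g atTop (𝓝 0)) (h : ∀ i, j ≤ i → f i ≤ g i - g (i + 1)) :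
    ∑' i, (if j ≤ i then f i else 0) ≤ g j := by
  have h1 := hf.hasSum.tendsto_sum_nat
  have h2 : Tendsto (fun n => g j - g n) atTop (𝓝 (g j - 0)) := tendsto_const_nhds.sub hg
  rw [sub_zero] at h2
  refine le_of_tendsto_of_tendsto h1 h2 ?_
  filter_upwards [eventually_ge_atTop j] with n hn
  induction n, hn using Nat.le_induction with
  | base =>
    rw [Finset.sum_eq_zero]; · simp
    intro i hi; rw [if_neg]; have := Finset.mem_range.1 hi; omega
  | succ n hn ih =>
    rw [Finset.sum_range_succ, if_pos hn]; linarith [h n hn]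

lemma le_tail {f g : ℕ → ℝ} {j : ℕ} (hf : Summable fun i => if j ≤ i then f i else 0)
    (hg : Tendsto g atTop (𝓝 0)) (h : ∀ i, j ≤ i → g i - g (i + 1) ≤ f i) :
    g j ≤ ∑' i, (if j ≤ i then f i else 0) := by
  have h1 := hf.hasSum.tendsto_sum_nat
  have h2 : Tendsto (fun n => g j - g n) atTop (𝓝 (g j - 0)) := tendsto_const_nhds.sub hg
  rw [sub_zero] at h2
  refine le_of_tendsto_of_tendsto h2 h1 ?_
  filter_upwards [eventually_ge_atTop j] with n hn
  induction n, hn using Nat.le_induction with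
  | base =>
    rw [Finset.sum_eq_zero]; · simp
    intro i hi; rw [if_neg]; have := Finset.mem_range.1 hi; omega
  | succ n hn ih =>
    rw [Finset.sum_range_succ, if_pos hn]; linarith [h n hn]

lemma tail_succ {f : ℕ → ℝ} {j : ℕ} (hf : Summable fun i => if j ≤ i then f i else 0) :
    ∑' i, (if j ≤ i then f i else 0) = f j + ∑' i, (if j + 1 ≤ i then f i else 0) := by
  rw [hf.tsum_eq_add_tsum_ite j, if_pos le_rfl]
  congr 1
  refine tsum_congr fun i => ?_
  by_cases h : i = j
  · subst h; simp
  · rw [if_neg h]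
    by_cases h2 : j ≤ i
    · rw [if_pos h2, if_pos (by omega)]
    · rw [if_neg h2, if_neg (by omega)]

lemma Zt_succ (j : ℕ) : Zt j = ((j : ℝ) ^ 2)⁻¹ + Zt (j + 1) :=
  tail_succ (f := fun i => ((i : ℝ) ^ 2)⁻¹) (summable_ZtT j)

lemma tendsto_inv_lin (a b : ℝ) : Tendsto (fun i : ℕ => a / ((i : ℝ) + b)) atTop (𝓝 0) :=
  tendsto_const_nhds.div_atTop (tendsto_atTop_add_const_right _ _ tendsto_natCast_atTop_atTop)

lemma Zt_le {j : ℕ} (hj : 1 ≤ j) : Zt j ≤ 1 / ((j : ℝ) - 1 / 2) := by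
  refine tail_le (f := fun i => ((i : ℝ) ^ 2)⁻¹) (g := fun i : ℕ => 1 / ((i : ℝ) - 1 / 2)) (summable_ZtT j) ?_ ?_
  · simpa [sub_eq_add_neg] using tendsto_inv_lin 1 (-(1 / 2))
  · intro i hi
    have h1 : (1 : ℝ) ≤ i := by exact_mod_cast hj.trans hi
    push_cast
    rw [div_sub_div _ _ (by linarith) (by linarith), inv_eq_one_div, div_le_div_iff₀ (by positivity) (by nlinarith)]
    nlinarith

lemma le_Zt {j : ℕ} (hj : 1 ≤ j) : 1 / (j : ℝ) + 1 / (2 * (j : ℝ) ^ 2) ≤ Zt j := by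
  refine le_tail (f := fun i => ((i : ℝ) ^ 2)⁻¹) (g := fun i : ℕ => 1 / (i : ℝ) + 1 / (2 * (i : ℝ) ^ 2)) (summable_ZtT j) ?_ ?_
  · have h1 := tendsto_inv_lin 1 0
    have h2 := (h1.mul h1).mul_const (1 / 2)
    have h3 := h1.add h2
    simp only [mul_zero, zero_mul, add_zero] at h3
    refine h3.congr fun i => ?_
    ring
  · intro i hi
    have h1 : (1 : ℝ) ≤ i := by exact_mod_cast hj.trans hi
    push_cast
    have : (1 / (i : ℝ) + 1 / (2 * (i : ℝ) ^ 2) - (1 / ((i : ℝ) + 1) + 1 / (2 * ((i : ℝ) + 1) ^ 2))) =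
        ((i : ℝ) ^ 2)⁻¹ - 1 / (2 * i ^ 2 * (i + 1) ^ 2) := by
      field_simp; ring
    rw [this]
    have : 0 ≤ 1 / (2 * (i : ℝ) ^ 2 * (i + 1) ^ 2) := by positivity
    linarith

lemma Zt_one : Zt 1 = Real.pi ^ 2 / 6 := by
  have h := hasSum_zeta_two
  rw [← h.tsum_eq]
  refine tsum_congr fun i => ?_
  unfold ZtT
  rcases Nat.eq_zero_or_pos i with h | h
  · subst h; simp
  · rw [if_pos (by omega), one_div]

/-- `Zt ⌈v⌉` versus `1 / v`. -/
lemma Zt_near {j : ℕ} {v : ℝ} (hv : 1 ≤ v) (h1 : v ≤ j) (h2 : (j : ℝ) ≤ v + 1) :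
    |Zt j - 1 / v| ≤ 1 / (2 * v * (v - 1 / 2)) := by
  have hj : (1 : ℝ) ≤ j := hv.trans h1
  have hj' : 1 ≤ j := by exact_mod_cast hj
  rw [abs_le]
  constructor
  · have h := le_Zt hj'
    have a1 : 1 / (v + 1) + 1 / (2 * (v + 1) ^ 2) ≤ 1 / (j : ℝ) + 1 / (2 * (j : ℝ) ^ 2) := by
      gcongr
    have a2 : 1 / v - 1 / (2 * v * (v - 1 / 2)) ≤ 1 / (v + 1) + 1 / (2 * (v + 1) ^ 2) := by
      have b1 : 1 / (2 * v * v) ≤ 1 / (2 * v * (v - 1 / 2)) := by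
        apply div_le_div_of_nonneg_left (by norm_num) (by nlinarith) (by nlinarith)
      have b2 : 1 / (v + 1) + 1 / (2 * (v + 1) ^ 2) - (1 / v - 1 / (2 * v * v)) =
          1 / (2 * v ^ 2 * (v + 1) ^ 2) := by field_simp; ring
      have : 0 ≤ 1 / (2 * v ^ 2 * (v + 1) ^ 2) := by positivity
      linarith
    linarith
  · have h := Zt_le hj'
    have a1 : 1 / ((j : ℝ) - 1 / 2) ≤ 1 / (v - 1 / 2) :=
      div_le_div_of_nonneg_left (by norm_num) (by linarith) (by linarith)
    have a2 : 1 / (v - 1 / 2) - 1 / v = 1 / (2 * v * (v - 1 / 2)) := by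
      have h3 : v - 1 / 2 ≠ 0 := by linarith
      have h4 : v ≠ 0 := by linarith
      rw [div_sub_div _ _ h3 h4, div_eq_div_iff (mul_ne_zero h3 h4) (mul_ne_zero (mul_ne_zero two_ne_zero h4) h3)]
      ring
    linarith

noncomputable def GG (t : ℝ) : ℝ := (1 + Real.log t) / t

lemma log_ge_one {s : ℝ} (hs : 3 ≤ s) : 1.0986 ≤ Real.log s := by
  have := Real.log_le_log (by norm_num) hs
  linarith [log3_lo]

lemma GG_upper {s t : ℝ} (hs : 3 ≤ s) (hst : s ≤ t) :
    GG s - GG t ≤ Real.log s / s ^ 2 * (t - s) := by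
  have hs0 : 0 < s := by linarith
  have ht0 : 0 < t := by linarith
  have h1 := log_ge_one hs
  have h2 : Real.log t ≥ Real.log s + (1 - s / t) := by
    have := Real.one_sub_inv_le_log_of_pos (show 0 < t / s by positivity)
    rw [Real.log_div ht0.ne' hs0.ne', inv_div] at this; linarith
  unfold GG
  have h3 : (1 + Real.log s + (1 - s / t)) / t ≤ (1 + Real.log t) / t :=
    div_le_div_of_nonneg_right (by linarith) ht0.le
  have h4 : Real.log s / s ^ 2 * (t - s) - ((1 + Real.log s) / s - (1 + Real.log s + (1 - s / t)) / t) =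
      (t - s) ^ 2 * (Real.log s * t - s) / (s ^ 2 * t ^ 2) := by
    field_simp; ring
  have h5 : 0 ≤ (t - s) ^ 2 * (Real.log s * t - s) / (s ^ 2 * t ^ 2) := by
    apply div_nonneg _ (by positivity)
    apply mul_nonneg (sq_nonneg _)
    nlinarith
  linarith

lemma GG_lower {s : ℝ} (hs : 3 ≤ s) :
    Real.log (s + 1) / (s + 1) ^ 2 ≤ GG s - GG (s + 1) := by
  have hs0 : 0 < s := by linarith
  have ht0 : 0 < s + 1 := by linarith
  have h1 : 1.386 ≤ Real.log (s + 1) := by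
    have := Real.log_le_log (by norm_num) (show 4 ≤ s + 1 by linarith)
    rw [log4_eq] at this
    linarith [log2_lo]
  have h2 : Real.log s ≥ Real.log (s + 1) - 1 / s := by
    have := Real.log_le_sub_one_of_pos (show 0 < (s + 1) / s by positivity)
    rw [Real.log_div ht0.ne' hs0.ne'] at this
    have e : (s + 1) / s - 1 = 1 / s := by field_simp; ring
    linarith
  unfold GG
  have h3 : (1 + (Real.log (s + 1) - 1 / s)) / s ≤ (1 + Real.log s) / s :=
    div_le_div_of_nonneg_right (by linarith) hs0.le
  have h4 : (1 + (Real.log (s + 1) - 1 / s)) / s - (1 + Real.log (s + 1)) / (s + 1) -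
      Real.log (s + 1) / (s + 1) ^ 2 = (Real.log (s + 1) * s - (s + 1)) / (s ^ 2 * (s + 1) ^ 2) := by
    field_simp; ring
  have h5 : 0 ≤ (Real.log (s + 1) * s - (s + 1)) / (s ^ 2 * (s + 1) ^ 2) := by
    apply div_nonneg _ (by positivity)
    nlinarith
  linarith

lemma GG_anti {s t : ℝ} (hs : 3 ≤ s) (hst : s ≤ t) :
    GG t ≤ GG s ∧ Real.log t / t ^ 2 ≤ Real.log s / s ^ 2 := by
  have hs0 : 0 < s := by linarith
  have ht0 : 0 < t := by linarith
  have h1 := log_ge_one hs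
  have h2 : Real.log t ≤ Real.log s + (t - s) / s := by
    have := Real.log_le_sub_one_of_pos (show 0 < t / s by positivity)
    rw [Real.log_div ht0.ne' hs0.ne'] at this
    have e : t / s - 1 = (t - s) / s := by field_simp
    linarith
  have h2' : Real.log t * s ≤ Real.log s * s + (t - s) := by
    have := mul_le_mul_of_nonneg_right h2 hs0.le
    rwa [add_mul, div_mul_cancel₀ _ hs0.ne'] at this
  have h6 : Real.log t * s ≤ Real.log s * t := by nlinarith
  constructor
  · unfold GG; rw [div_le_div_iff₀ ht0 hs0]; nlinarith
  · rw [div_le_div_iff₀ (by positivity) (by positivity)]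
    calc Real.log t * s ^ 2 = (Real.log t * s) * s := by ring
      _ ≤ (Real.log s * t) * t := by
        apply mul_le_mul h6 hst hs0.le; nlinarith
      _ = _ := by ring

lemma tendsto_GG (a : ℝ) : Tendsto (fun i : ℕ => GG ((i : ℝ) + a)) atTop (𝓝 0) := by
  have h : Tendsto GG atTop (𝓝 0) := by
    have h1 : Tendsto (fun t : ℝ => 1 / t) atTop (𝓝 0) := tendsto_const_nhds.div_atTop tendsto_id
    have h2 : Tendsto (fun t : ℝ => Real.log t / t) atTop (𝓝 0) := by
      have := Real.isLittleO_log_id_atTop.tendsto_div_nhds_zero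
      simpa using this
    have h3 := h1.add h2
    rw [add_zero] at h3
    refine h3.congr fun t => ?_
    unfold GG; ring
  exact h.comp (tendsto_atTop_add_const_right _ _ tendsto_natCast_atTop_atTop)

lemma Sl_near {j : ℕ} {y : ℝ} (hy : 3 ≤ y) (h1 : y ≤ j) (h2 : (j : ℝ) ≤ y + 1) :
    |Sl j - GG y| ≤ Real.log y / y ^ 2 := by
  have hl : 0 < Real.log y / y ^ 2 := by
    have := log_ge_one hy; positivity
  have hj3 : (3 : ℝ) ≤ j := hy.trans h1
  have lo : GG j ≤ Sl j := by
    have := le_tail (f := fun i : ℕ => Real.log i * ((i : ℝ) ^ 2)⁻¹) (g := fun i : ℕ => GG i) (j := j) Sl_hasSum.1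
      (by simpa using tendsto_GG 0) (fun i hi => by
        have h3 : (3 : ℝ) ≤ i := hj3.trans (by exact_mod_cast hi)
        have := GG_upper h3 (show (i : ℝ) ≤ i + 1 by linarith)
        push_cast; rw [← div_eq_mul_inv]; linarith)
    exact this
  have hi : Sl j ≤ Real.log j / (j : ℝ) ^ 2 + GG j := by
    have e : Sl j = Real.log j * ((j : ℝ) ^ 2)⁻¹ + Sl (j + 1) :=
      tail_succ (f := fun i : ℕ => Real.log i * ((i : ℝ) ^ 2)⁻¹) Sl_hasSum.1
    have := tail_le (f := fun i : ℕ => Real.log i * ((i : ℝ) ^ 2)⁻¹) (g := fun i : ℕ => GG ((i : ℝ) + (-1))) (j := j + 1) Sl_hasSum.1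
      (tendsto_GG (-1)) (fun i hi => by
        have h3 : (3 : ℝ) + 1 ≤ i := by
          have h4 : ((j + 1 : ℕ) : ℝ) ≤ i := by exact_mod_cast hi
          push_cast at h4; linarith
        have := GG_lower (s := (i : ℝ) - 1) (by linarith)
        push_cast; rw [← div_eq_mul_inv]
        rw [show (i : ℝ) + 1 + -1 = i by ring, show (i : ℝ) + -1 = i - 1 by ring]
        rw [sub_add_cancel] at this
        exact this)
    rw [e, div_eq_mul_inv]
    have h5 : Sl (j + 1) ≤ GG j := by
      have e2 : ((j + 1 : ℕ) : ℝ) + (-1) = j := by push_cast; ring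
      rw [e2] at this; exact this
    linarith
  obtain ⟨a1, a2⟩ := GG_anti hy h1
  have a3 := GG_upper hy h1
  rw [abs_le]
  constructor
  · nlinarith
  · linarith

end PNT
end

section
open Filter Topology Set ArithmeticFunction

namespace PNT

/-- natural ceiling division -/
def cd (a n : ℕ) : ℕ := (a + n - 1) / n

lemma cd_le_iff {a n t : ℕ} (hn : 1 ≤ n) : cd a n ≤ t ↔ a ≤ n * t := by
  unfold cd
  rw [Nat.div_le_iff_le_mul_add_pred (by omega)]
  omega

lemma cd_comm {x n m : ℕ} (hn : 1 ≤ n) (hm : 1 ≤ m) : cd (cd x n) m = cd (cd x m) n := by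
  apply eq_of_forall_ge_iff
  intro t
  rw [cd_le_iff hm, cd_le_iff hn, cd_le_iff hn, cd_le_iff hm]
  rw [← mul_assoc, ← mul_assoc, mul_comm n m]

lemma le_cd {x n : ℕ} (hn : 1 ≤ n) : (x : ℝ) / n ≤ cd x n := by
  have h := (cd_le_iff (a := x) hn).1 le_rfl
  rw [div_le_iff₀ (by exact_mod_cast hn)]
  have : (x : ℝ) ≤ (n : ℝ) * cd x n := by exact_mod_cast h
  linarith

lemma cd_le {x n : ℕ} (hn : 1 ≤ n) : (cd x n : ℝ) ≤ x / n + 1 := by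
  by_contra h
  push Not at h
  have hn' : (0 : ℝ) < n := by exact_mod_cast hn
  have h1 : ¬ (cd x n ≤ cd x n - 1) := by
    have h0 : 0 ≤ (x : ℝ) / n := by positivity
    have : (1 : ℝ) < cd x n := by linarith
    have : 1 < cd x n := by exact_mod_cast this
    omega
  apply h1
  rw [cd_le_iff hn]
  have h2 : 1 ≤ cd x n := by omega
  have : (x : ℝ) ≤ n * ((cd x n - 1 : ℕ) : ℝ) := by
    rw [Nat.cast_sub h2]
    have h3 : (x : ℝ) / n < (cd x n : ℝ) - 1 := by linarith
    rw [div_lt_iff₀ hn'] at h3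
    push_cast; linarith
  exact_mod_cast this

section step
variable {ι κ : Type} [Fintype ι] [Fintype κ] (n : ι → ℕ) (c : ι → ℝ) (p : κ → ℕ) (e : κ → ℝ)

noncomputable def Cs (k : ℕ) : ℝ := ∑ i, c i / n i * Zt (cd k (n i))

lemma Cs_hasSum (hn : ∀ i, 1 ≤ n i) (x : ℕ) :
    HasSum (fun m : ℕ => vonMangoldt m * ((m : ℝ) ^ 2)⁻¹ * Cs n c (cd x m))
      (∑ i, c i / n i * Sl (cd x (n i))) := by
  have h := hasSum_sum (s := Finset.univ) (fun i _ => (Sl_hasSum (y := cd x (n i))).2.mul_left (c i / n i))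
  have he : (fun m : ℕ => vonMangoldt m * ((m : ℝ) ^ 2)⁻¹ * Cs n c (cd x m)) = fun b : ℕ =>
      ∑ i, c i / n i * (vonMangoldt b * ((b : ℝ) ^ 2)⁻¹ * Zt ((cd x (n i) + b - 1) / b)) := by
   funext m
   rcases Nat.eq_zero_or_pos m with hm | hm
   · subst hm; simp
   · unfold Cs
     rw [Finset.mul_sum]
     refine Finset.sum_congr rfl fun i _ => ?_
     have := cd_comm (x := x) (hn i) hm
     rw [← this]
     unfold cd; ring
  rw [he]; exact h

lemma Sl_comb_le (hn : ∀ i, 1 ≤ n i) (hc : ∑ i, c i = 0) {x : ℕ} (hx : ∀ i, 3 * n i ≤ x) (hx1 : 1 ≤ x) :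
    x * ∑ i, c i / n i * Sl (cd x (n i)) ≤
      - ∑ i, c i * Real.log (n i) + (∑ i, n i * |c i|) * (Real.log x / x) := by
  have hx0 : (0 : ℝ) < x := by exact_mod_cast hx1
  have key : ∀ i, x * (c i / n i * Sl (cd x (n i))) ≤
      c i * (1 + Real.log x) - c i * Real.log (n i) + n i * |c i| * (Real.log x / x) := by
    intro i
    have hni : (1 : ℝ) ≤ n i := by exact_mod_cast hn i
    have hni0 : (0 : ℝ) < n i := by linarith
    have h3 : (3 : ℝ) ≤ x / n i := by
      rw [le_div_iff₀ hni0]; exact_mod_cast hx i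
    have h := Sl_near h3 (le_cd (hn i)) (cd_le (hn i))
    have h4 : Real.log (x / n i) / (x / n i) ^ 2 ≤ Real.log x / (x / n i) ^ 2 := by
      apply div_le_div_of_nonneg_right _ (by positivity)
      apply Real.log_le_log (by positivity)
      exact div_le_self hx0.le hni
    have h5 : c i * (Sl (cd x (n i)) - GG (x / n i)) ≤ |c i| * (Real.log x / (x / n i) ^ 2) := by
      refine (le_abs_self _).trans ?_
      rw [abs_mul]
      exact mul_le_mul_of_nonneg_left (h.trans h4) (abs_nonneg _)
    have h6 : x * (c i / n i * Sl (cd x (n i))) = x / n i * (c i * (Sl (cd x (n i)) - GG (x / n i))) +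
        x / n i * (c i * GG (x / n i)) := by ring
    have h7 : x / n i * (c i * GG (x / n i)) = c i * (1 + Real.log x) - c i * Real.log (n i) := by
      unfold GG
      rw [Real.log_div hx0.ne' hni0.ne']
      field_simp; ring
    have h8 : x / n i * (|c i| * (Real.log x / (x / n i) ^ 2)) = n i * |c i| * (Real.log x / x) := by
      field_simp
    have h9 := mul_le_mul_of_nonneg_left h5 (show 0 ≤ (x : ℝ) / n i by positivity)
    linarith
  rw [Finset.mul_sum]
  refine (Finset.sum_le_sum fun i _ => key i).trans ?_
  rw [Finset.sum_add_distrib, Finset.sum_sub_distrib, ← Finset.sum_mul, ← Finset.sum_mul, hc]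
  linarith

/-- tail bound for `Cs` -/
lemma Cs_tail (hn : ∀ i, 1 ≤ n i) (hc : ∑ i, c i = 0) {N Y k : ℕ} (hN : ∀ i, n i ≤ N) (hY : N ≤ Y) (hN1 : 1 ≤ N)
    (hk : Y < k) : - Cs n c k ≤ ((∑ i, n i * |c i|) / 2 * (Y / (Y - N / 2))) / (k : ℝ) ^ 2 := by
  have hN' : (1 : ℝ) ≤ N := by exact_mod_cast hN1
  have hY' : (N : ℝ) ≤ Y := by exact_mod_cast hY
  have hk' : (Y : ℝ) < k := by exact_mod_cast hk
  have key : ∀ i, - (c i / n i * Zt (cd k (n i))) ≤ - (c i / k) + (n i * |c i|) * ((1 / 2 * (Y / (Y - N / 2))) / (k : ℝ) ^ 2) := by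
    intro i
    have hni : (1 : ℝ) ≤ n i := by exact_mod_cast hn i
    have hni0 : (0 : ℝ) < n i := by linarith
    have hniN : (n i : ℝ) ≤ N := by exact_mod_cast hN i
    have hk0 : (0 : ℝ) < k := by linarith
    have h1 : (1 : ℝ) ≤ k / n i := by rw [le_div_iff₀ hni0]; linarith
    have h := Zt_near h1 (le_cd (hn i)) (cd_le (hn i))
    have h2 : - (c i / n i) * (Zt (cd k (n i)) - 1 / (k / n i)) ≤ |c i| / n i * (1 / (2 * (k / n i) * (k / n i - 1 / 2))) := by
      refine (le_abs_self _).trans ?_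
      rw [abs_mul, abs_neg, abs_div, abs_of_pos hni0]
      exact mul_le_mul_of_nonneg_left h (by positivity)
    have h3 : c i / n i * (1 / (k / n i)) = c i / k := by field_simp
    have hd : (0 : ℝ) < k - n i / 2 := by linarith
    have h4 : |c i| / n i * (1 / (2 * (k / n i) * (k / n i - 1 / 2))) = n i * |c i| * (1 / 2 * (k / (k - n i / 2)) / (k : ℝ) ^ 2) := by
      have e : (k : ℝ) / n i - 1 / 2 = (k - n i / 2) / n i := by field_simp
      rw [e]
      field_simp
    have h5 : (k : ℝ) / (k - n i / 2) ≤ Y / (Y - N / 2) := by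
      rw [div_le_div_iff₀ hd (by linarith)]
      nlinarith
    have h6 : n i * |c i| * (1 / 2 * (k / (k - n i / 2)) / (k : ℝ) ^ 2) ≤
        (n i * |c i|) * ((1 / 2 * (Y / (Y - N / 2))) / (k : ℝ) ^ 2) := by
      gcongr
    linarith
  unfold Cs
  rw [← Finset.sum_neg_distrib]
  refine (Finset.sum_le_sum fun i _ => key i).trans ?_
  rw [Finset.sum_add_distrib, ← Finset.sum_mul, Finset.sum_neg_distrib, ← Finset.sum_div, hc]
  apply le_of_eq; ring

lemma le_cd_iff {x m q : ℕ} (hm : 1 ≤ m) (hq : 1 ≤ q) : cd x m ≤ q ↔ ((cd x q : ℕ) : ℝ) ≤ m := by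
  rw [Nat.cast_le, cd_le_iff hm, cd_le_iff hq, mul_comm]

lemma pointwise (hp : ∀ j, 1 ≤ p j) {Y : ℕ} {B : ℝ} (hB : 0 ≤ B) (hY1 : 1 ≤ Y)
    (hD : ∀ k, 2 ≤ k → k ≤ Y → - Cs n c k ≤ ∑ j, if k ≤ p j then e j else 0)
    (hT : ∀ k, Y < k → - Cs n c k ≤ B / (k : ℝ) ^ 2) (he : ∀ j, 0 ≤ e j)
    {x : ℕ} (hx : 1 ≤ x) (m : ℕ) :
    (Cs n c 1 + ∑ j, e j) * tauT x m - ∑ j, e j * tauT (cd x (p j)) m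
      - (if m ∈ Finset.Ioc 0 ⌊(x : ℝ) / Y⌋₊ then vonMangoldt m * (B / (x : ℝ) ^ 2) else 0) ≤
      vonMangoldt m * ((m : ℝ) ^ 2)⁻¹ * Cs n c (cd x m) := by
  have hx0 : (0 : ℝ) < x := by exact_mod_cast hx
  have hY0 : (0 : ℝ) < Y := by exact_mod_cast hY1
  rcases Nat.eq_zero_or_pos m with hm | hm
  · subst hm; simp [tauT]
  have hm0 : (0 : ℝ) < m := by exact_mod_cast hm
  set w := vonMangoldt m * ((m : ℝ) ^ 2)⁻¹ with hw
  have hw0 : 0 ≤ w := vm2_nonneg m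
  have hlast : 0 ≤ (if m ∈ Finset.Ioc 0 ⌊(x : ℝ) / Y⌋₊ then vonMangoldt m * (B / (x : ℝ) ^ 2) else 0) := by
    split_ifs
    · exact mul_nonneg vonMangoldt_nonneg (by positivity)
    · exact le_rfl
  have hcd1 : 1 ≤ cd x m := by
    by_contra h
    have : cd x m ≤ 0 := by omega
    rw [cd_le_iff hm] at this; omega
  have hsum : ∑ j, e j * tauT (cd x (p j)) m = w * ∑ j, if cd x m ≤ p j then e j else 0 := by
    rw [Finset.mul_sum]
    refine Finset.sum_congr rfl fun j _ => ?_
    unfold tauT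
    by_cases h : cd x m ≤ p j
    · rw [if_pos h, if_pos ((le_cd_iff hm (hp j)).1 h)]; ring
    · rw [if_neg h, if_neg (fun h' => h ((le_cd_iff hm (hp j)).2 h'))]; ring
  rw [hsum]
  have hDn : 0 ≤ ∑ j, (if cd x m ≤ p j then e j else 0) :=
    Finset.sum_nonneg fun j _ => by split_ifs; exacts [he j, le_rfl]
  by_cases hmx : x ≤ m
  · have h1 : cd x m = 1 := by
      have : cd x m ≤ 1 := by rw [cd_le_iff hm]; omega
      omega
    have h2 : tauT x m = w := by unfold tauT; rw [if_pos (by exact_mod_cast hmx)]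
    have h3 : ∑ j, (if cd x m ≤ p j then e j else 0) = ∑ j, e j :=
      Finset.sum_congr rfl fun j _ => by rw [h1, if_pos (hp j)]
    rw [h3, h2, h1]
    linarith
  · have h2 : tauT x m = 0 := by unfold tauT; rw [if_neg (by push Not at hmx ⊢; exact_mod_cast hmx)]
    rw [h2, mul_zero]
    have hk2 : 2 ≤ cd x m := by
      by_contra h
      have : cd x m ≤ 1 := by omega
      rw [cd_le_iff hm] at this; omega
    by_cases hkY : cd x m ≤ Y
    · have := mul_le_mul_of_nonneg_left (hD _ hk2 hkY) hw0
      linarith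
    · have h3 := hT _ (not_le.1 hkY)
      have hmem : m ∈ Finset.Ioc 0 ⌊(x : ℝ) / Y⌋₊ := by
        rw [Finset.mem_Ioc]
        refine ⟨hm, Nat.le_floor ?_⟩
        rw [cd_le_iff hm] at hkY
        rw [le_div_iff₀ hY0]
        exact_mod_cast (not_le.1 hkY).le
      rw [if_pos hmem]
      have h4 := mul_le_mul_of_nonneg_left h3 hw0
      have h5 : w * (B / (cd x m : ℝ) ^ 2) ≤ vonMangoldt m * (B / (x : ℝ) ^ 2) := by
        have h6 : (x : ℝ) ^ 2 ≤ (m : ℝ) ^ 2 * (cd x m : ℝ) ^ 2 := by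
          rw [← mul_pow]
          apply pow_le_pow_left₀ hx0.le
          exact_mod_cast (cd_le_iff hm).1 le_rfl
        have h7 : w * (B / (cd x m : ℝ) ^ 2) = vonMangoldt m * (B / ((m : ℝ) ^ 2 * (cd x m : ℝ) ^ 2)) := by
          rw [hw]; field_simp
        rw [h7]
        apply mul_le_mul_of_nonneg_left _ vonMangoldt_nonneg
        exact div_le_div_of_nonneg_left hB (by positivity) h6
      have h8 := mul_nonneg hw0 hDn
      linarith

theorem step (hn : ∀ i, 1 ≤ n i) (hc : ∑ i, c i = 0) {N Y : ℕ} (hN : ∀ i, n i ≤ N) (hY : N ≤ Y) (hN1 : 1 ≤ N)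
    (hp : ∀ j, 1 ≤ p j) (he : ∀ j, 0 ≤ e j)
    (hD : ∀ k, 2 ≤ k → k ≤ Y → - Cs n c k ≤ ∑ j, if k ≤ p j then e j else 0)
    {x : ℕ} (hx : 3 * N ≤ x) {K c0 : ℝ} (hK : ∀ j, (cd x (p j) : ℝ) * tau (cd x (p j)) ≤ K)
    (hψ : Chebyshev.psi ((x : ℝ) / Y) ≤ c0 * (x / Y)) :
    (Cs n c 1 + ∑ j, e j) * (x * tau x) ≤ - ∑ i, c i * Real.log (n i) + K * ∑ j, e j * p j
      + (∑ i, n i * |c i|) * (c0 / (2 * (Y - N / 2)) + Real.log x / x) := by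
  have hN' : (1 : ℝ) ≤ N := by exact_mod_cast hN1
  have hY' : (N : ℝ) ≤ Y := by exact_mod_cast hY
  have hx1 : 1 ≤ x := by omega
  have hx0 : (0 : ℝ) < x := by exact_mod_cast hx1
  have hdd : (0 : ℝ) < Y - N / 2 := by linarith
  set A := ∑ i, n i * |c i| with hA
  have hA0 : 0 ≤ A := Finset.sum_nonneg fun i _ => by positivity
  set B := A / 2 * (Y / (Y - N / 2)) with hB
  have hB0 : 0 ≤ B := by
    have : (0 : ℝ) ≤ Y := by linarith
    positivity
  have hpt := pointwise n c p e hp hB0 (by omega) hD (fun k hk => Cs_tail n c hn hc hN hY hN1 hk) he hx1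
  have h1 := Cs_hasSum n c hn x
  have h2 : HasSum (fun m => (Cs n c 1 + ∑ j, e j) * tauT x m - ∑ j, e j * tauT (cd x (p j)) m
      - (if m ∈ Finset.Ioc 0 ⌊(x : ℝ) / Y⌋₊ then vonMangoldt m * (B / (x : ℝ) ^ 2) else 0))
      ((Cs n c 1 + ∑ j, e j) * tau x - ∑ j, e j * tau (cd x (p j)) - Chebyshev.psi ((x : ℝ) / Y) * (B / (x : ℝ) ^ 2)) := by
    refine (((summable_tauT _).hasSum.mul_left _).sub
      (hasSum_sum (s := Finset.univ) fun j _ => (summable_tauT _).hasSum.mul_left (e j))).sub ?_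
    have := hasSum_sum_of_ne_finset_zero (L := SummationFilter.unconditional ℕ) (s := Finset.Ioc 0 ⌊(x : ℝ) / Y⌋₊)
      (f := fun m => if m ∈ Finset.Ioc 0 ⌊(x : ℝ) / Y⌋₊ then vonMangoldt m * (B / (x : ℝ) ^ 2) else 0)
      (fun m hm => if_neg hm)
    have e : Chebyshev.psi ((x : ℝ) / Y) * (B / (x : ℝ) ^ 2) = ∑ m ∈ Finset.Ioc 0 ⌊(x : ℝ) / Y⌋₊,
        (if m ∈ Finset.Ioc 0 ⌊(x : ℝ) / Y⌋₊ then vonMangoldt m * (B / (x : ℝ) ^ 2) else 0) := by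
      unfold Chebyshev.psi
      rw [Finset.sum_mul]
      exact Finset.sum_congr rfl fun m hm => (if_pos hm).symm
    rw [e]; exact this
  have h3 := hasSum_le hpt h2 h1
  have h4 := Sl_comb_le n c hn hc (x := x) (fun i => (Nat.mul_le_mul_left 3 (hN i)).trans hx) hx1
  have h5 := mul_le_mul_of_nonneg_left h3 hx0.le
  have h6 : x * ∑ j, e j * tau (cd x (p j)) ≤ K * ∑ j, e j * p j := by
    rw [Finset.mul_sum, Finset.mul_sum]
    refine Finset.sum_le_sum fun j _ => ?_
    have hpj : (0 : ℝ) < p j := by exact_mod_cast hp j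
    have a1 : (x : ℝ) ≤ p j * cd x (p j) := by exact_mod_cast (cd_le_iff (hp j)).1 le_rfl
    have a2 : 0 ≤ tau (cd x (p j)) := tsum_nonneg fun m => tauT_nonneg _ _
    have a3 := mul_le_mul_of_nonneg_right a1 a2
    have a4 := mul_le_mul_of_nonneg_left (hK j) hpj.le
    have a5 : x * tau (cd x (p j)) ≤ p j * K := by linarith
    have a6 := mul_le_mul_of_nonneg_left a5 (he j)
    linarith
  have h7 : x * (Chebyshev.psi ((x : ℝ) / Y) * (B / (x : ℝ) ^ 2)) ≤ A * (c0 / (2 * (Y - N / 2))) := by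
    have hY0 : (0 : ℝ) < Y := by linarith
    have : x * (Chebyshev.psi ((x : ℝ) / Y) * (B / (x : ℝ) ^ 2)) ≤ x * (c0 * (x / Y) * (B / (x : ℝ) ^ 2)) := by
      gcongr
    refine this.trans (le_of_eq ?_)
    rw [hB]; field_simp
  have h8 : x * ((Cs n c 1 + ∑ j, e j) * tau x - ∑ j, e j * tau (cd x (p j)) - Chebyshev.psi ((x : ℝ) / Y) * (B / (x : ℝ) ^ 2))
    = (Cs n c 1 + ∑ j, e j) * (x * tau x) - x * (∑ j, e j * tau (cd x (p j))) - x * (Chebyshev.psi ((x : ℝ) / Y) * (B / (x : ℝ) ^ 2)) := by ring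
  rw [h8] at h5
  rw [mul_add]
  linarith

end step

end PNT
end

section
open Filter Topology Set ArithmeticFunction

namespace PNT

lemma cd_succ_of_dvd {k m : ℕ} (hm : 1 ≤ m) (hk : 1 ≤ k) (h : m ∣ k) :
    cd k m = k / m ∧ cd (k + 1) m = k / m + 1 := by
  obtain ⟨t, rfl⟩ := h
  rw [Nat.mul_div_cancel_left _ hm]
  constructor
  · apply eq_of_forall_ge_iff
    intro s
    rw [cd_le_iff hm]
    exact Nat.mul_le_mul_left_iff hm
  · apply eq_of_forall_ge_iff
    intro s
    rw [cd_le_iff hm, Nat.succ_le_iff, Nat.succ_le_iff]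
    exact Nat.mul_lt_mul_left hm

lemma cd_succ_of_not_dvd {k m : ℕ} (hm : 1 ≤ m) (h : ¬ m ∣ k) : cd (k + 1) m = cd k m := by
  apply eq_of_forall_ge_iff
  intro s
  rw [cd_le_iff hm, cd_le_iff hm]
  constructor
  · intro h1; omega
  · intro h1
    rcases Nat.lt_or_ge k (m * s) with h2 | h2
    · omega
    · exact absurd ⟨s, le_antisymm h1 h2⟩ h

lemma Cs_succ {ι : Type} [Fintype ι] (n : ι → ℕ) (c : ι → ℝ) (hn : ∀ i, 1 ≤ n i) {k : ℕ} (hk : 1 ≤ k) :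
    Cs n c (k + 1) = Cs n c k - (∑ i, if n i ∣ k then n i * c i else 0) / (k : ℝ) ^ 2 := by
  unfold Cs
  rw [Finset.sum_div, ← Finset.sum_sub_distrib]
  refine Finset.sum_congr rfl fun i _ => ?_
  have hni : (0 : ℝ) < n i := by exact_mod_cast hn i
  have hk0 : (0 : ℝ) < k := by exact_mod_cast hk
  by_cases h : n i ∣ k
  · rw [if_pos h]
    obtain ⟨h1, h2⟩ := cd_succ_of_dvd (hn i) hk h
    rw [h1, h2, Zt_succ (k / n i), Nat.cast_div h hni.ne']
    field_simp; ring
  · rw [if_neg h, cd_succ_of_not_dvd (hn i) h]; simp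

lemma Cs_one {ι : Type} [Fintype ι] (n : ι → ℕ) (c : ι → ℝ) (hn : ∀ i, 1 ≤ n i) :
    Cs n c 1 = Real.pi ^ 2 / 6 * ∑ i, c i / n i := by
  unfold Cs
  rw [Finset.mul_sum]
  refine Finset.sum_congr rfl fun i _ => ?_
  have : cd 1 (n i) = 1 := by
    unfold cd; rw [Nat.add_sub_cancel_left, Nat.div_self (hn i)]
  rw [this, Zt_one, mul_comm]

/-- weighted divisor sum over a list (kernel friendly) -/
noncomputable def bs (j : ℕ) (l : List (ℕ × ℕ)) : ℕ :=
  List.rec 0 (fun hd _ ih => Nat.rec (Nat.add (Nat.mul hd.1 hd.2) ih) (fun _ _ => ih) (Nat.mod j hd.1)) l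
noncomputable def upd (lp ln : List (ℕ × ℕ)) (W j V : ℕ) : ℕ :=
  Nat.sub (Nat.succ (Nat.add V (Nat.div (Nat.mul (bs j lp) W) (Nat.mul j j))))
    (Nat.div (Nat.mul (bs j ln) W) (Nat.mul j j))
noncomputable def run (lp ln : List (ℕ × ℕ)) (W T Ve E fuel : ℕ) : ℕ → Bool :=
  Nat.rec (fun V => Nat.ble V Ve)
    (fun m ih V => and (Nat.ble V T)
      (Nat.rec (ih 0) (fun v _ => ih (Nat.succ v)) (upd lp ln W (Nat.sub E m) V))) fuel

lemma bs_eq (j : ℕ) (l : List (ℕ × ℕ)) :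
    bs j l = (l.map fun a => if a.1 ∣ j then a.1 * a.2 else 0).sum := by
  induction l with
  | nil => rfl
  | cons a l ih =>
    have h : bs j (a :: l) = Nat.rec (Nat.add (Nat.mul a.1 a.2) (bs j l)) (fun _ _ => bs j l) (Nat.mod j a.1) := rfl
    rw [h, List.map_cons, List.sum_cons, ← ih]
    by_cases hd : a.1 ∣ j
    · have h0 : Nat.mod j a.1 = 0 := Nat.mod_eq_zero_of_dvd hd
      rw [h0, if_pos hd]; rfl
    · have h0 : Nat.mod j a.1 ≠ 0 := fun h => hd (Nat.dvd_of_mod_eq_zero h)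
      obtain ⟨r, hr⟩ := Nat.exists_eq_succ_of_ne_zero h0
      rw [hr, if_neg hd, zero_add]

lemma upd_le (lp ln : List (ℕ × ℕ)) (W V : ℕ) {j : ℕ} (hj : 1 ≤ j) :
    (V : ℝ) + W * (((bs j lp : ℝ) - bs j ln) / (j : ℝ) ^ 2) ≤ upd lp ln W j V := by
  have hj0 : (0 : ℝ) < (j : ℝ) ^ 2 := by positivity
  have e : upd lp ln W j V = (V + (bs j lp * W) / (j * j) + 1) - (bs j ln * W) / (j * j) := rfl
  have h1 : (V : ℝ) + (bs j lp * W / (j * j) : ℕ) + 1 ≤ upd lp ln W j V + (bs j ln * W / (j * j) : ℕ) := by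
    have : V + (bs j lp * W) / (j * j) + 1 ≤ upd lp ln W j V + (bs j ln * W) / (j * j) := by omega
    exact_mod_cast this
  have h2 : (bs j lp : ℝ) * W / (j : ℝ) ^ 2 ≤ (bs j lp * W / (j * j) : ℕ) + 1 := by
    have := (Nat.lt_floor_add_one ((bs j lp * W : ℕ) / ((j * j : ℕ) : ℝ))).le
    rw [Nat.floor_div_eq_div] at this
    push_cast at this ⊢
    rw [pow_two]; exact this
  have h3 : ((bs j ln * W / (j * j) : ℕ) : ℝ) ≤ (bs j ln : ℝ) * W / (j : ℝ) ^ 2 := by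
    have := @Nat.cast_div_le ℝ _ _ _ (bs j ln * W) (j * j)
    push_cast at this ⊢
    rw [pow_two]; exact this
  have h4 : W * (((bs j lp : ℝ) - bs j ln) / (j : ℝ) ^ 2) =
    (bs j lp : ℝ) * W / (j : ℝ) ^ 2 - (bs j ln : ℝ) * W / (j : ℝ) ^ 2 := by ring
  linarith

lemma soundRun {lp ln : List (ℕ × ℕ)} {W T Ve E : ℕ} {G : ℕ → ℝ}
    (hG : ∀ j, 1 ≤ j → G (j + 1) = G j + W * (((bs j lp : ℝ) - bs j ln) / (j : ℝ) ^ 2)) (fuel : ℕ) :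
    ∀ V : ℕ, run lp ln W T Ve E fuel V = true → fuel ≤ E → G (E + 1 - fuel) ≤ V →
      (∀ k, E + 1 - fuel ≤ k → k ≤ E → G k ≤ T) ∧ G (E + 1) ≤ Ve := by
  induction fuel with
  | zero =>
    intro V h _ hV
    refine ⟨fun k h1 h2 => by omega, ?_⟩
    have h : Nat.ble V Ve = true := h
    have : (V : ℝ) ≤ Ve := by exact_mod_cast Nat.le_of_ble_eq_true h
    simpa using hV.trans this
  | succ m ih =>
    intro V h hE hV
    have h0 : (Nat.ble V T && (Nat.rec (run lp ln W T Ve E m 0) (fun v _ => run lp ln W T Ve E m (Nat.succ v))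
      (upd lp ln W (E - m) V) : Bool)) = true := h
    rw [Bool.and_eq_true] at h0
    obtain ⟨h1, h2⟩ := h0
    have h3 : run lp ln W T Ve E m (upd lp ln W (E - m) V) = true := by
      revert h2
      cases upd lp ln W (E - m) V <;> exact id
    have hT : (V : ℝ) ≤ T := by exact_mod_cast Nat.le_of_ble_eq_true h1
    have e1 : E + 1 - (m + 1) = E - m := by omega
    rw [e1] at hV
    have e2 : E + 1 - m = (E - m) + 1 := by omega
    have h4 : G (E + 1 - m) ≤ upd lp ln W (E - m) V := by
      rw [e2, hG _ (by omega)]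
      have := upd_le lp ln W V (j := E - m) (by omega)
      linarith
    obtain ⟨h5, h6⟩ := ih _ h3 (by omega) h4
    refine ⟨fun k hk1 hk2 => ?_, h6⟩
    rw [e1] at hk1
    rcases Nat.eq_or_lt_of_le hk1 with h7 | h7
    · rw [← h7]; linarith
    · exact h5 k (by omega) hk2

/-- chunked check: list of `(p, e, Ve)`. -/
def Chk (lp ln : List (ℕ × ℕ)) (W base : ℕ) : List (ℕ × ℕ × ℕ) → ℕ → ℕ → Prop
  | [], _, _ => True
  | a :: l, prev, V => run lp ln W (base + (a.2.1 + (l.map fun b => b.2.1).sum)) a.2.2 a.1 (a.1 - prev) V = true ∧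
      prev ≤ a.1 ∧ Chk lp ln W base l a.1 a.2.2

lemma Chk_ge {lp ln : List (ℕ × ℕ)} {W base : ℕ} (l : List (ℕ × ℕ × ℕ)) :
    ∀ prev V, Chk lp ln W base l prev V → ∀ a ∈ l, prev ≤ a.1 := by
  induction l with
  | nil => simp
  | cons b l ih =>
    intro prev V h a ha
    obtain ⟨_, h2, h3⟩ := h
    rcases List.mem_cons.1 ha with h4 | h4
    · rw [h4]; exact h2
    · exact h2.trans (ih _ _ h3 a h4)

lemma Chk_sound {lp ln : List (ℕ × ℕ)} {W base : ℕ} {G : ℕ → ℝ}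
    (hG : ∀ j, 1 ≤ j → G (j + 1) = G j + W * (((bs j lp : ℝ) - bs j ln) / (j : ℝ) ^ 2)) (l : List (ℕ × ℕ × ℕ)) :
    ∀ prev V, Chk lp ln W base l prev V → G (prev + 1) ≤ V → ∀ k, prev < k → (∃ a ∈ l, k ≤ a.1) →
      G k ≤ base + (l.map fun a => if k ≤ a.1 then (a.2.1 : ℝ) else 0).sum := by
  induction l with
  | nil => intro _ _ _ _ k _ ⟨a, ha, _⟩; simp at ha
  | cons b l ih =>
    intro prev V h hV k hk hex
    obtain ⟨h1, h2, h3⟩ := h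
    obtain ⟨h4, h5⟩ := soundRun hG _ V h1 (by omega) (by
      rw [show b.1 + 1 - (b.1 - prev) = prev + 1 by omega]; exact hV)
    by_cases hkb : k ≤ b.1
    · have h6 := h4 k (by omega) hkb
      refine h6.trans (le_of_eq ?_)
      have h7 : (l.map fun a => if k ≤ a.1 then (a.2.1 : ℝ) else 0) = l.map fun a => (a.2.1 : ℝ) :=
        List.map_congr_left fun a ha => if_pos (hkb.trans (Chk_ge l _ _ h3 a ha))
      rw [List.map_cons, List.sum_cons, if_pos hkb, h7]
      push_cast
      rw [List.map_map]; rfl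
    · have := ih b.1 _ h3 h5 k (by omega) (by
        obtain ⟨a, ha, hka⟩ := hex
        rcases List.mem_cons.1 ha with h8 | h8
        · rw [h8] at hka; exact absurd hka hkb
        · exact ⟨a, h8, hka⟩)
      rw [List.map_cons, List.sum_cons, if_neg hkb, zero_add]; exact this

end PNT
end

section
open Filter Topology Set ArithmeticFunction

namespace PNT

/-- scale for logarithm tables -/
noncomputable def ltT (m K : ℕ) : ℕ :=
  Nat.rec 0 (fun i ih => Nat.add (Nat.div 2000000000000 (Nat.mul (Nat.succ (Nat.mul 2 i)) (Nat.pow (Nat.succ (Nat.mul 2 m)) (Nat.succ (Nat.mul 2 i))))) ih) K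
noncomputable def lgL (n : ℕ) : ℕ :=
  Nat.rec 0 (fun m ih => Nat.add (ltT (Nat.succ m) 12) ih) (Nat.sub n 1)

lemma ltT_bd (m K : ℕ) : (ltT m K : ℝ) ≤ 1000000000000 * (2 * ∑ i ∈ Finset.range K, (1 / (2 * m + 1) : ℝ) ^ (2 * i + 1) / (2 * i + 1)) ∧
    1000000000000 * (2 * ∑ i ∈ Finset.range K, (1 / (2 * m + 1) : ℝ) ^ (2 * i + 1) / (2 * i + 1)) ≤ ltT m K + K := by
  induction K with
  | zero => simp [ltT]
  | succ K ih =>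
    have e : ltT m (K + 1) = 2000000000000 / ((2 * K + 1) * (2 * m + 1) ^ (2 * K + 1)) + ltT m K := rfl
    rw [e, Finset.sum_range_succ]
    set d := (2 * K + 1) * (2 * m + 1) ^ (2 * K + 1) with hd
    have h1 := @Nat.cast_div_le ℝ _ _ _ 2000000000000 d
    have h2 := (Nat.lt_floor_add_one ((2000000000000 : ℕ) / (d : ℝ))).le
    rw [Nat.floor_div_eq_div] at h2
    have h3 : ((2000000000000 : ℕ) : ℝ) / (d : ℝ) = 1000000000000 * (2 * ((1 / (2 * m + 1) : ℝ) ^ (2 * K + 1) / (2 * K + 1))) := by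
      rw [hd]; push_cast
      rw [one_div, inv_pow]
      have : ((2 * (m : ℝ) + 1) ^ (2 * K + 1)) ≠ 0 := by positivity
      generalize (2 * (m : ℝ) + 1) ^ (2 * K + 1) = z at *
      field_simp; norm_num
    rw [h3] at h1 h2
    push_cast
    obtain ⟨a, b⟩ := ih
    push_cast at h2
    constructor <;> linarith

lemma lgL_bd (n : ℕ) (hn : 1 ≤ n) : (lgL n : ℝ) ≤ 1000000000000 * Real.log n ∧
    1000000000000 * Real.log n ≤ lgL n + 15 * n := by
  induction n, hn using Nat.le_induction with
  | base => simp [lgL]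
  | succ n hn ih =>
    have e : lgL (n + 1) = ltT n 12 + lgL n := by
      obtain ⟨m, rfl⟩ : ∃ m, n = m + 1 := ⟨n - 1, by omega⟩
      rfl
    have hn0 : (1 : ℝ) ≤ n := by exact_mod_cast hn
    obtain ⟨a, b⟩ := ih
    obtain ⟨p, q⟩ := ltT_bd n 12
    have hx : (1 / (2 * n + 1) : ℝ) = ((n + 1 : ℝ) - n) / ((n + 1) + n) := by
      congr 1 <;> ring
    have h1 := log_lo (a := (n : ℝ) + 1) (b := n) (x := 1 / (2 * n + 1)) 12 (by linarith) hx (by linarith) le_rfl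
    have h2 := log_hi (a := (n : ℝ) + 1) (b := n) (x := 1 / (2 * n + 1)) 12 (by linarith) hx (by linarith) le_rfl
    have h3 : (1 / (2 * n + 1) : ℝ) ≤ 1 / 3 := one_div_le_one_div_of_le (by norm_num) (by linarith)
    have h30 : 0 ≤ (1 / (2 * n + 1) : ℝ) := by positivity
    have h4 : (1 / (2 * n + 1) : ℝ) ^ (2 * 12 + 1) / (1 - (1 / (2 * n + 1) : ℝ) ^ 2) ≤ (1 / 3 : ℝ) ^ (2 * 12 + 1) / (1 - (1 / 3) ^ 2) := by
      gcongr
    have h5 : (1 / 3 : ℝ) ^ (2 * 12 + 1) / (1 - (1 / 3) ^ 2) = 1 / 753145430616 := by norm_num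
    rw [h5] at h4
    rw [e]; push_cast
    push_cast at q
    constructor
    · linarith
    · linarith

section cert
variable (lp ln : List (ℕ × ℕ))

noncomputable def nn : Fin lp.length ⊕ Fin ln.length → ℕ := Sum.elim (fun i => lp[i].1) (fun i => ln[i].1)
noncomputable def cc : Fin lp.length ⊕ Fin ln.length → ℝ := Sum.elim (fun i => (lp[i].2 : ℝ)) (fun i => -(ln[i].2 : ℝ))

lemma sum_split (f : ℕ → ℝ → ℝ) : ∑ i, f (nn lp ln i) (cc lp ln i) =
    (lp.map fun a => f a.1 a.2).sum + (ln.map fun a => f a.1 (-(a.2 : ℝ))).sum := by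
  rw [Fintype.sum_sum_type]
  simp only [nn, cc, Sum.elim_inl, Sum.elim_inr]
  rw [← Fin.sum_univ_fun_getElem lp fun a => f a.1 a.2, ← Fin.sum_univ_fun_getElem ln fun a => f a.1 (-(a.2 : ℝ))]
  rfl

/-- lower bound for `∑ c / n` -/
noncomputable def rl (l : List (ℕ × ℕ)) : ℕ := (l.map fun a => a.2 * 1000000000000 / a.1).sum
noncomputable def ru (l : List (ℕ × ℕ)) : ℕ := (l.map fun a => a.2 * 1000000000000 / a.1 + 1).sum
noncomputable def mlo (l : List (ℕ × ℕ)) : ℕ := (l.map fun a => a.2 * lgL a.1).sum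
noncomputable def mup (l : List (ℕ × ℕ)) : ℕ := (l.map fun a => a.2 * (lgL a.1 + 15 * a.1)).sum

lemma cast_sum {l : List (ℕ × ℕ)} (f : ℕ × ℕ → ℕ) (g : ℕ × ℕ → ℝ) (h : ∀ a ∈ l, (f a : ℝ) ≤ g a) :
    ((l.map f).sum : ℝ) ≤ (l.map g).sum := by
  push_cast
  rw [List.map_map]
  exact List.sum_le_sum h

lemma sum_cast {l : List (ℕ × ℕ)} (f : ℕ × ℕ → ℕ) (g : ℕ × ℕ → ℝ) (h : ∀ a ∈ l, g a ≤ f a) :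
    (l.map g).sum ≤ ((l.map f).sum : ℝ) := by
  push_cast
  rw [List.map_map]
  exact List.sum_le_sum h

lemma cert {N Y W O C1 M A Zl : ℕ} {sg : List (ℕ × ℕ × ℕ)}
    (hp : ∀ a ∈ lp, 1 ≤ a.1 ∧ a.1 ≤ N) (hn : ∀ a ∈ ln, 1 ≤ a.1 ∧ a.1 ≤ N)
    (hs : (lp.map fun a => a.2).sum = (ln.map fun a => a.2).sum)
    (hA : (lp.map fun a => a.1 * a.2).sum + (ln.map fun a => a.1 * a.2).sum = A)
    (hM : mup ln ≤ M + mlo lp) (hZ : ru ln + Zl ≤ rl lp)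
    (hC : C1 * (1000000000000 * 1000000000000) ≤ W * (1644934066848 * Zl)) (hW : 0 < W)
    (hsg : ∀ a ∈ sg, 1 ≤ a.1) (hsY : ∃ a ∈ sg, Y ≤ a.1) (hchk : Chk lp ln W (O + C1) sg 0 O)
    (hNY : N ≤ Y) (hN1 : 1 ≤ N) {x : ℕ} (hx : 3 * N ≤ x) {K c0 : ℝ}
    (hK : ∀ a ∈ sg, (cd x a.1 : ℝ) * tau (cd x a.1) ≤ K)
    (hψ : Chebyshev.psi ((x : ℝ) / Y) ≤ c0 * (x / Y)) :
    ((C1 + (sg.map fun a => a.2.1).sum : ℕ) : ℝ) / W * (x * tau x) ≤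
      (M : ℝ) / 1000000000000 + K * (((sg.map fun a => a.2.1 * a.1).sum : ℕ) / W)
        + A * (c0 / (2 * (Y - N / 2)) + Real.log x / x) := by
  have hW0 : (0 : ℝ) < W := by exact_mod_cast hW
  have hnn : ∀ i, 1 ≤ nn lp ln i ∧ nn lp ln i ≤ N := by
    rintro (i | i)
    · exact hp _ (List.getElem_mem i.2)
    · exact hn _ (List.getElem_mem i.2)
  have hneg : ∀ (l : List (ℕ × ℕ)) (f : ℕ × ℕ → ℝ), (l.map fun a => -f a).sum = -(l.map f).sum := by
    intro l f
    induction l with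
    | nil => simp
    | cons a l ih => simp only [List.map_cons, List.sum_cons, ih]; ring
  have hmul : ∀ (l : List (ℕ × ℕ)) (r : ℝ) (f : ℕ × ℕ → ℝ), (l.map fun a => r * f a).sum = r * (l.map f).sum := by
    intro l r f
    induction l with
    | nil => simp
    | cons a l ih => simp only [List.map_cons, List.sum_cons, ih]; ring
  have hc : ∑ i, cc lp ln i = 0 := by
    rw [sum_split lp ln fun _ c => c, hneg]
    have : (((lp.map fun a => a.2).sum : ℕ) : ℝ) = ((ln.map fun a => a.2).sum : ℕ) := by rw [hs]
    push_cast at this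
    rw [List.map_map, List.map_map] at this
    have h2 : (lp.map fun a => (a.2 : ℝ)).sum = (ln.map fun a => (a.2 : ℝ)).sum := this
    rw [h2]; ring
  have hAA : ∑ i, nn lp ln i * |cc lp ln i| = A := by
    rw [sum_split lp ln fun n c => (n : ℝ) * |c|, ← hA]
    push_cast
    rw [List.map_map, List.map_map]
    congr 2
    · refine List.map_congr_left fun a _ => ?_
      simp
    · refine List.map_congr_left fun a _ => ?_
      simp
  have hMM : - ∑ i, cc lp ln i * Real.log (nn lp ln i) ≤ (M : ℝ) / 1000000000000 := by
    rw [sum_split lp ln fun n c => c * Real.log n]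
    have h1 : (mlo lp : ℝ) ≤ (lp.map fun a => 1000000000000 * ((a.2 : ℝ) * Real.log a.1)).sum :=
      cast_sum _ _ fun a ha => by
        have := mul_le_mul_of_nonneg_left (lgL_bd a.1 (hp a ha).1).1 (show (0 : ℝ) ≤ a.2 by positivity)
        push_cast; linarith
    have h2 : (ln.map fun a => 1000000000000 * ((a.2 : ℝ) * Real.log a.1)).sum ≤ (mup ln : ℝ) :=
      sum_cast _ _ fun a ha => by
        have := mul_le_mul_of_nonneg_left (lgL_bd a.1 (hn a ha).1).2 (show (0 : ℝ) ≤ a.2 by positivity)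
        push_cast; linarith
    have h3 : (mup ln : ℝ) ≤ M + mlo lp := by exact_mod_cast hM
    rw [hmul] at h1 h2
    have h4 : (ln.map fun a => (-(a.2 : ℝ)) * Real.log a.1).sum = -(ln.map fun a => (a.2 : ℝ) * Real.log a.1).sum := by
      rw [← hneg]; congr 1
      exact List.map_congr_left fun a _ => by ring
    rw [h4, le_div_iff₀ (by norm_num)]
    linarith
  have hCC : (C1 : ℝ) / W ≤ Cs (nn lp ln) (cc lp ln) 1 := by
    rw [Cs_one _ _ fun i => (hnn i).1, sum_split lp ln fun n c => c / n]
    have h1 : (rl lp : ℝ) ≤ (lp.map fun a => 1000000000000 * ((a.2 : ℝ) / a.1)).sum :=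
      cast_sum _ _ fun a ha => by
        have := @Nat.cast_div_le ℝ _ _ _ (a.2 * 1000000000000) a.1
        push_cast at this ⊢
        refine this.trans (le_of_eq ?_); ring
    have h2 : (ln.map fun a => 1000000000000 * ((a.2 : ℝ) / a.1)).sum ≤ (ru ln : ℝ) :=
      sum_cast _ _ fun a ha => by
        have := (Nat.lt_floor_add_one ((a.2 * 1000000000000 : ℕ) / (a.1 : ℝ))).le
        rw [Nat.floor_div_eq_div] at this
        push_cast at this ⊢
        refine le_trans (le_of_eq ?_) this; ring
    rw [hmul] at h1 h2
    have h3 : (ru ln : ℝ) + Zl ≤ rl lp := by exact_mod_cast hZ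
    have h4 : (ln.map fun a => (-(a.2 : ℝ)) / a.1).sum = -(ln.map fun a => (a.2 : ℝ) / a.1).sum := by
      rw [← hneg]; congr 1
      exact List.map_congr_left fun a _ => by ring
    have h5 : (C1 : ℝ) * (1000000000000 * 1000000000000) ≤ W * (1644934066848 * Zl) := by exact_mod_cast hC
    have h6 : (1.644934066848 : ℝ) ≤ Real.pi ^ 2 / 6 := by
      have := Real.pi_gt_d20
      nlinarith
    rw [h4]
    set s := (lp.map fun a => (a.2 : ℝ) / a.1).sum + -(ln.map fun a => (a.2 : ℝ) / a.1).sum with hsdef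
    have h7 : (Zl : ℝ) / 1000000000000 ≤ s := by
      rw [div_le_iff₀ (by norm_num)]; linarith
    have h8 : 1.644934066848 * ((Zl : ℝ) / 1000000000000) ≤ Real.pi ^ 2 / 6 * s :=
      mul_le_mul h6 h7 (by positivity) (by positivity)
    refine le_trans ?_ h8
    rw [div_le_iff₀ hW0]
    linarith
  set G : ℕ → ℝ := fun k => O + W * (Cs (nn lp ln) (cc lp ln) 1 - Cs (nn lp ln) (cc lp ln) k) with hGdef
  have hb : ∀ (j : ℕ) (l : List (ℕ × ℕ)), (bs j l : ℝ) = (l.map fun a => if a.1 ∣ j then (a.1 : ℝ) * a.2 else 0).sum := by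
    intro j l
    rw [bs_eq]; push_cast; rw [List.map_map]
    congr 1
    refine List.map_congr_left fun a _ => ?_
    simp only [Function.comp]
    split_ifs <;> simp
  have hG : ∀ j, 1 ≤ j → G (j + 1) = G j + W * (((bs j lp : ℝ) - bs j ln) / (j : ℝ) ^ 2) := by
    intro j hj
    have : ((bs j lp : ℝ) - bs j ln) = ∑ i, if nn lp ln i ∣ j then nn lp ln i * cc lp ln i else 0 := by
      rw [sum_split lp ln fun n c => if n ∣ j then n * c else 0, hb, hb, sub_eq_add_neg, ← hneg]
      congr 2
      refine List.map_congr_left fun a _ => ?_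
      split_ifs <;> simp
    rw [this, hGdef]
    simp only
    rw [Cs_succ _ _ (fun i => (hnn i).1) hj]; ring
  have hfin := Chk_sound hG sg 0 O hchk (by simp [hGdef])
  obtain ⟨aY, haY, hYle⟩ := hsY
  have hD : ∀ k, 2 ≤ k → k ≤ Y → - Cs (nn lp ln) (cc lp ln) k ≤
      ∑ j : Fin sg.length, if k ≤ sg[j].1 then (sg[j].2.1 : ℝ) / W else 0 := by
    intro k hk hkY
    have h1 := hfin k (by omega) ⟨aY, haY, hkY.trans hYle⟩
    have h2 : ∑ j : Fin sg.length, (if k ≤ sg[j].1 then (sg[j].2.1 : ℝ) / W else 0) =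
        (sg.map fun a => if k ≤ a.1 then (a.2.1 : ℝ) else 0).sum / W := by
      rw [← Fin.sum_univ_fun_getElem sg fun a => if k ≤ a.1 then (a.2.1 : ℝ) else 0, Finset.sum_div]
      refine Finset.sum_congr rfl fun j _ => ?_
      show _ = (if k ≤ sg[j].1 then (sg[j].2.1 : ℝ) else 0) / W
      split_ifs <;> simp
    rw [h2, le_div_iff₀ hW0]
    simp only [hGdef] at h1
    push_cast at h1
    rw [div_le_iff₀ hW0] at hCC
    linarith
  have h := step (nn lp ln) (cc lp ln) (fun j : Fin sg.length => sg[j].1) (fun j => (sg[j].2.1 : ℝ) / W)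
    (fun i => (hnn i).1) hc (fun i => (hnn i).2) hNY hN1 (fun j => hsg _ (List.getElem_mem j.2))
    (fun j => by positivity) hD hx (fun j => hK _ (List.getElem_mem j.2)) hψ
  rw [hAA] at h
  have e1 : ∑ j : Fin sg.length, (sg[j].2.1 : ℝ) / W = ((sg.map fun a => a.2.1).sum : ℕ) / W := by
    push_cast
    rw [List.map_map, ← Fin.sum_univ_fun_getElem sg, Finset.sum_div]
    rfl
  have e2 : ∑ j : Fin sg.length, (sg[j].2.1 : ℝ) / W * (sg[j].1 : ℝ) = ((sg.map fun a => a.2.1 * a.1).sum : ℕ) / W := by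
    push_cast
    rw [List.map_map, ← Fin.sum_univ_fun_getElem sg, Finset.sum_div]
    refine Finset.sum_congr rfl fun j _ => ?_
    simp only [Function.comp]; push_cast
    show (sg[j].2.1 : ℝ) / W * (sg[j].1 : ℝ) = (sg[j].2.1 : ℝ) * (sg[j].1 : ℝ) / W
    ring
  rw [e1, e2] at h
  have ht : 0 ≤ (x : ℝ) * tau x := mul_nonneg (by positivity) (tsum_nonneg fun m => tauT_nonneg _ _)
  have h9 := mul_le_mul_of_nonneg_right hCC ht
  have e3 : ((C1 + (sg.map fun a => a.2.1).sum : ℕ) : ℝ) / W = C1 / W + ((sg.map fun a => a.2.1).sum : ℕ) / W := by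
    rw [Nat.cast_add]; ring
  rw [e3, add_mul]
  rw [add_mul] at h
  linarith

end cert
end PNT
end

section
open Filter Topology Set ArithmeticFunction

namespace PNT

def cAP : List (ℕ × ℕ) := [(1, 30), (6, 1)]
def cAN : List (ℕ × ℕ) := [(2, 15), (3, 10), (5, 6)]
def cAS : List (ℕ × ℕ × ℕ) := [(6, 5442173, 102933333340), (10, 4121794, 102964557833), (15, 2049864,
   102977102706), (20, 1828919, 102980886175), (24, 599479, 102982390590), (30, 2282687, 102979957777), (60,
   522553, 102982081870), (90, 148900, 102982485870), (120, 68573, 102982628637), (150, 37126, 102982695064),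
   (210, 36790, 102982753161), (270, 16957, 102982777179), (390, 14682, 102982796439), (510, 5972,
   102982803877), (1000, 9762, 102982812562)]

lemma cA_chk : Chk cAP cAN 100000000 (100000000000 + 2982813774) cAS 0 100000000000 := by
  unfold cAS Chk
  repeat' refine And.intro ?_ ?_
  all_goals first | exact True.intro | decide +kernel

lemma cA_step {x : ℕ} (hx : 18 ≤ x) {K c0 : ℝ}
    (hK : ∀ y : ℕ, x ≤ 1000 * y → (y : ℝ) * tau y ≤ K)
    (hψ : Chebyshev.psi ((x : ℝ) / 1000) ≤ c0 * (x / 1000)) :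
    (3000000005 : ℝ) / 100000000 * (x * tau x) ≤ 29248198601519 / 1000000000000 + K * (313455254 / 100000000)
      + 126 * (c0 / (2 * (1000 - 6 / 2)) + Real.log x / x) := by
  have hS1 : ∀ a ∈ cAS, 1 ≤ a.1 ∧ a.1 ≤ 1000 := by decide +kernel
  have h := cert cAP cAN (N := 6) (Y := 1000) (W := 100000000) (O := 100000000000) (C1 := 2982813774) (M := 29248198601519) (A := 126)
    (Zl := 18133333333330) (sg := cAS) (by decide +kernel) (by decide +kernel) (by decide +kernel) (by decide +kernel)
    (by decide +kernel) (by decide +kernel) (by decide +kernel) (by norm_num) (fun a ha => (hS1 a ha).1) (by decide +kernel)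
    cA_chk (by norm_num) (by norm_num) (by omega) (K := K) (c0 := c0)
    (fun a ha => hK _ (((cd_le_iff (hS1 a ha).1).1 le_rfl).trans (Nat.mul_le_mul_right _ (hS1 a ha).2)))
    (by exact_mod_cast hψ)
  have e1 : 2982813774 + (cAS.map fun a => a.2.1).sum = 3000000005 := by decide +kernel
  have e2 : (cAS.map fun a => a.2.1 * a.1).sum = 313455254 := by decide +kernel
  rw [e1, e2] at h
  exact_mod_cast h

end PNT
end

section
open Filter Topology Set ArithmeticFunction

namespace PNT

def cBP : List (ℕ × ℕ) := [(1, 100104), (6, 16684), (10, 10011), (14, 7150), (15, 6674), (21, 4767), (22,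
   4550), (26, 3850), (33, 3034), (34, 273), (35, 2862), (38, 2634), (39, 1089), (46, 1402), (51, 1963), (55,
   1426), (57, 960), (58, 315), (62, 1615), (65, 47), (68, 492), (69, 447), (72, 93), (74, 610), (80, 410),
   (84, 461), (85, 1178), (86, 1164), (92, 713), (94, 128), (95, 329), (100, 328), (102, 78), (103, 19), (104,
   236), (106, 560), (111, 346), (115, 871), (116, 276), (117, 89), (118, 564), (119, 196), (120, 807), (122,
   429), (132, 58), (133, 455), (141, 446), (143, 99), (144, 192), (146, 48)]
def cBN : List (ℕ × ℕ) := [(2, 50059), (3, 33369), (5, 20021), (7, 14301), (11, 9101), (13, 7700), (17, 5889),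
   (19, 5269), (23, 4352), (28, 1662), (29, 1730), (30, 3337), (31, 3229), (36, 1444), (37, 1221), (40, 819),
   (41, 48), (42, 2383), (43, 2328), (47, 1339), (53, 1889), (59, 312), (60, 771), (61, 857), (66, 1631), (70,
   765), (73, 733), (77, 281), (79, 196), (83, 1182), (88, 529), (98, 2), (99, 896), (105, 934), (109, 432),
   (110, 712), (113, 404), (114, 480), (127, 242), (138, 303), (139, 380)]
def cBS : List (ℕ × ℕ × ℕ) := [(2, 349999999, 110010050000002), (4, 120833332, 110009929166670), (8, 79219667,
   110009849947003), (18, 51582755, 110009798364248), (34, 7870002081, 110001923300941), (55, 723292325,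
   110001205069842), (56, 1482298965, 109999720471629), (84, 110157762, 109999610698958), (209, 154779419,
   109999276212709), (319, 89887291, 109999367916130), (322, 25880143, 109999333584289), (391, 39702300,
   109999276433146), (527, 24656992, 109999264822910), (627, 11549803, 109999265402544), (775, 7392534,
   109999249488227), (893, 18410188, 109999235797003), (1309, 8930757, 109999225997589), (1494, 2825590,
   109999227027568), (1881, 5836960, 109999222440833), (2821, 1575235, 109999219546269), (3052, 507000,
   109999219690099), (3553, 1069624, 109999218083488), (4807, 461179, 109999218308183), (6000, 1471692,
   109999217615894)]

lemma cB_chk : Chk cBP cBN 100000000 (100000000000000 + 9999217676408) cBS 0 100000000000000 := by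
  unfold cBS Chk
  repeat' refine And.intro ?_ ?_
  all_goals first | exact True.intro | decide +kernel

lemma cB_step {x : ℕ} (hx : 450 ≤ x) {K c0 : ℝ}
    (hK : ∀ y : ℕ, x ≤ 6000 * y → (y : ℝ) * tau y ≤ K)
    (hψ : Chebyshev.psi ((x : ℝ) / 6000) ≤ c0 * (x / 6000)) :
    (10010400000001 : ℝ) / 100000000 * (x * tau x) ≤ 96329944761674471 / 1000000000000 + K * (577383775267 / 100000000)
      + 5540058 * (c0 / (2 * (6000 - 150 / 2)) + Real.log x / x) := by
  have hS1 : ∀ a ∈ cBS, 1 ≤ a.1 ∧ a.1 ≤ 6000 := by decide +kernel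
  have h := cert cBP cBN (N := 150) (Y := 6000) (W := 100000000) (O := 100000000000000) (C1 := 9999217676408) (M := 96329944761674471) (A := 5540058)
    (Zl := 60787954228272716) (sg := cBS) (by decide +kernel) (by decide +kernel) (by decide +kernel) (by decide +kernel)
    (by decide +kernel) (by decide +kernel) (by decide +kernel) (by norm_num) (fun a ha => (hS1 a ha).1) (by decide +kernel)
    cB_chk (by norm_num) (by norm_num) (by omega) (K := K) (c0 := c0)
    (fun a ha => hK _ (((cd_le_iff (hS1 a ha).1).1 le_rfl).trans (Nat.mul_le_mul_right _ (hS1 a ha).2)))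
    (by exact_mod_cast hψ)
  have e1 : 9999217676408 + (cBS.map fun a => a.2.1).sum = 10010400000001 := by decide +kernel
  have e2 : (cBS.map fun a => a.2.1 * a.1).sum = 577383775267 := by decide +kernel
  rw [e1, e2] at h
  exact_mod_cast h

end PNT
end

section
open Filter Topology Set ArithmeticFunction

namespace PNT

lemma tau_nonneg (x : ℝ) : 0 ≤ tau x := tsum_nonneg fun m => tauT_nonneg _ _

lemma tauT_nat (y i : ℕ) : tauT y i = if y ≤ i then vonMangoldt i * ((i : ℝ) ^ 2)⁻¹ else 0 := by
  unfold tauT; simp only [Nat.cast_le]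

lemma tau_succ (y : ℕ) : tau y = vonMangoldt y * ((y : ℝ) ^ 2)⁻¹ + tau (y + 1 : ℕ) := by
  have h := tail_succ (f := fun i : ℕ => vonMangoldt i * ((i : ℝ) ^ 2)⁻¹) (j := y)
    ((summable_tauT (y : ℝ)).congr fun i => tauT_nat y i)
  unfold tau
  rw [tsum_congr (tauT_nat y), tsum_congr (tauT_nat (y + 1))]
  exact h

lemma tau_le_succ {y : ℕ} {l t : ℝ} (hl : Real.log y ≤ l) (ht : tau (y + 1 : ℕ) ≤ t) :
    tau y ≤ l * ((y : ℝ) ^ 2)⁻¹ + t := by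
  rw [tau_succ]
  have h1 : vonMangoldt y ≤ l := vonMangoldt_le_log.trans hl
  have : vonMangoldt y * ((y : ℝ) ^ 2)⁻¹ ≤ l * ((y : ℝ) ^ 2)⁻¹ := by gcongr
  linarith

lemma log_ub {n a : ℕ} (hn : 1 ≤ n) (h : lgL n + 15 * n ≤ a) : Real.log n ≤ a / 1000000000000 := by
  have h1 := (lgL_bd n hn).2
  have h2 : (lgL n : ℝ) + 15 * n ≤ a := by exact_mod_cast h
  rw [le_div_iff₀ (by norm_num)]; linarith

lemma psi_bd {x : ℝ} (hx : 0 ≤ x) : Chebyshev.psi x ≤ 5.387 * x := by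
  refine (Chebyshev.psi_le_const_mul_self hx).trans ?_
  have : Real.log 4 + 4 ≤ 5.387 := by rw [log4_eq]; linarith [log2_hi]
  exact mul_le_mul_of_nonneg_right this hx

lemma psi_nat_succ (M : ℕ) : Chebyshev.psi ((M + 1 : ℕ) : ℝ) = Chebyshev.psi (M : ℝ) + vonMangoldt (M + 1) := by
  unfold Chebyshev.psi
  rw [Nat.floor_natCast, Nat.floor_natCast]
  exact Finset.sum_Ioc_succ_top (Nat.zero_le M) _

lemma tau_G0_aux {y : ℕ} (hy : 1 ≤ y) (M : ℕ) (hM : y ≤ M) :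
    ∑ i ∈ Finset.range M, tauT y i ≤ 2 * 5.387 * (1 / y - 1 / M) + Chebyshev.psi ((M - 1 : ℕ) : ℝ) / (M : ℝ) ^ 2 := by
  induction M, hM using Nat.le_induction with
  | base =>
    rw [Finset.sum_eq_zero]
    · have := Chebyshev.psi_nonneg ((y - 1 : ℕ) : ℝ)
      simp only [sub_self, mul_zero, zero_add]; positivity
    · intro i hi
      rw [tauT_nat, if_neg]; have := Finset.mem_range.1 hi; omega
  | succ M hM ih =>
    rw [Finset.sum_range_succ, tauT_nat, if_pos hM]
    obtain ⟨m, rfl⟩ : ∃ m, M = m + 1 := ⟨M - 1, by omega⟩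
    simp only [Nat.add_sub_cancel] at ih ⊢
    have h1 := psi_nat_succ m
    have h2 := psi_bd (show (0 : ℝ) ≤ ((m + 1 : ℕ) : ℝ) by positivity)
    set P := Chebyshev.psi ((m + 1 : ℕ) : ℝ)
    have e : Chebyshev.psi (m : ℝ) = P - vonMangoldt (m + 1) := by linarith
    rw [e] at ih
    set u : ℝ := ((m + 1 : ℕ) : ℝ) with hu
    have hu1 : 1 ≤ u := by rw [hu]; push_cast; linarith [(Nat.cast_nonneg m : (0 : ℝ) ≤ m)]
    have hu2 : ((m + 1 + 1 : ℕ) : ℝ) = u + 1 := by rw [hu]; push_cast; ring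
    rw [hu2]
    have h3 : P * (1 / u ^ 2 - 1 / (u + 1) ^ 2) ≤ 2 * 5.387 * (1 / u - 1 / (u + 1)) := by
      have e1 : 1 / u ^ 2 - 1 / (u + 1) ^ 2 = (2 * u + 1) / (u ^ 2 * (u + 1) ^ 2) := by field_simp; ring
      have e2 : 2 * 5.387 * (1 / u - 1 / (u + 1)) = 5.387 * u * ((2 * u + 2) / (u ^ 2 * (u + 1) ^ 2)) := by field_simp; ring
      rw [e1, e2]
      apply mul_le_mul h2 _ (by positivity) (by positivity)
      apply div_le_div_of_nonneg_right (by linarith) (by positivity)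
    have e3 : (P - vonMangoldt (m + 1)) / u ^ 2 = P / u ^ 2 - vonMangoldt (m + 1) * (u ^ 2)⁻¹ := by ring
    rw [e3] at ih
    have e4 : P * (1 / u ^ 2 - 1 / (u + 1) ^ 2) = P / u ^ 2 - P / (u + 1) ^ 2 := by ring
    linarith

lemma tau_G0 (y : ℕ) (hy : 1 ≤ y) : (y : ℝ) * tau y ≤ 10.78 := by
  have hy0 : (0 : ℝ) < y := by exact_mod_cast hy
  have h : tau y ≤ 2 * 5.387 / y := by
    refine le_of_tendsto (summable_tauT (y : ℝ)).hasSum.tendsto_sum_nat ?_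
    filter_upwards [eventually_ge_atTop (max y 1)] with M hM
    have hM1 : 1 ≤ M := (le_max_right _ _).trans hM
    have hM0 : (0 : ℝ) < M := by exact_mod_cast hM1
    refine (tau_G0_aux hy M ((le_max_left _ _).trans hM)).trans ?_
    have h2 := psi_bd (show (0 : ℝ) ≤ ((M - 1 : ℕ) : ℝ) by positivity)
    have h3 : ((M - 1 : ℕ) : ℝ) ≤ M := by exact_mod_cast Nat.sub_le _ _
    have h4 : Chebyshev.psi ((M - 1 : ℕ) : ℝ) / (M : ℝ) ^ 2 ≤ 5.387 * M / (M : ℝ) ^ 2 :=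
      div_le_div_of_nonneg_right (by linarith) (by positivity)
    have h5 : 5.387 * M / (M : ℝ) ^ 2 = 5.387 / M := by field_simp
    have h6 : 0 ≤ 5.387 / (M : ℝ) := by positivity
    have h7 : 2 * 5.387 * (1 / (y : ℝ) - 1 / M) = 2 * 5.387 / y - 2 * (5.387 / M) := by ring
    linarith
  rw [le_div_iff₀ hy0] at h
  linarith

lemma log_div_bd {n x : ℕ} {l : ℝ} (hn : 3 ≤ n) (hnx : n ≤ x) (hl : Real.log n ≤ l * n) : Real.log x / x ≤ l := by
  have hn0 : (0 : ℝ) < n := by exact_mod_cast (by omega : 0 < n)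
  have he : Real.exp 1 ≤ (n : ℝ) := by
    have := Real.exp_one_lt_d9
    have : (3 : ℝ) ≤ n := by exact_mod_cast hn
    linarith
  have hx : (n : ℝ) ≤ x := by exact_mod_cast hnx
  have := Real.log_div_self_antitoneOn (show (n : ℝ) ∈ {x | Real.exp 1 ≤ x} from he)
    (show (x : ℝ) ∈ {x | Real.exp 1 ≤ x} from he.trans hx) hx
  refine this.trans ?_
  rwa [div_le_iff₀ hn0]

lemma cA_num {x : ℕ} (hx : 18 ≤ x) {K l r : ℝ} (hK : ∀ y : ℕ, x ≤ 1000 * y → (y : ℝ) * tau y ≤ K)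
    (hl : Real.log x / x ≤ l)
    (hr : 29.248199 + K * 3.13455255 + 126 * (5.387 / 1994 + l) ≤ 30 * r) (hK0 : 0 ≤ K) : x * tau x ≤ r := by
  have h := cA_step hx hK (psi_bd (by positivity))
  have ht : 0 ≤ (x : ℝ) * tau x := mul_nonneg (by positivity) (tau_nonneg _)
  norm_num at h hr ⊢
  linarith

lemma tau_ge18 {x : ℕ} (hx : 18 ≤ x) : x * tau x ≤ 2.79 := by
  refine cA_num hx (K := 10.78) (l := 0.161) (fun y hy => tau_G0 y (by omega)) ?_ (by norm_num) (by norm_num)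
  refine log_div_bd (n := 18) (by norm_num) hx ?_
  push_cast; rw [log18_eq]; linarith [log2_hi, log3_hi]

lemma tau_G1 (y : ℕ) (hy : 1 ≤ y) : (y : ℝ) * tau y ≤ 2.83 := by
  have t18 : tau (18 : ℕ) ≤ 0.155 := by
    have := tau_ge18 (x := 18) le_rfl
    push_cast at this ⊢; linarith
  have t17 : tau (17 : ℕ) ≤ 0.16482 := by
    have := tau_le_succ (y := 17) (log_ub (n := 17) (a := 2835300000000) (by norm_num) (by decide +kernel)) t18
    norm_num at this ⊢; linarith
  have t16 : tau (16 : ℕ) ≤ 0.17566 := by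
    have := tau_le_succ (y := 16) (log_ub (n := 16) (a := 2772800000000) (by norm_num) (by decide +kernel)) t17
    norm_num at this ⊢; linarith
  have t15 : tau (15 : ℕ) ≤ 0.18770 := by
    have := tau_le_succ (y := 15) (log_ub (n := 15) (a := 2708200000000) (by norm_num) (by decide +kernel)) t16
    norm_num at this ⊢; linarith
  have t14 : tau (14 : ℕ) ≤ 0.20117 := by
    have := tau_le_succ (y := 14) (log_ub (n := 14) (a := 2639200000000) (by norm_num) (by decide +kernel)) t15
    norm_num at this ⊢; linarith
  have t13 : tau (13 : ℕ) ≤ 0.21637 := by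
    have := tau_le_succ (y := 13) (log_ub (n := 13) (a := 2568500000000) (by norm_num) (by decide +kernel)) t14
    norm_num at this ⊢; linarith
  have t12 : tau (12 : ℕ) ≤ 0.23363 := by
    have := tau_le_succ (y := 12) (log_ub (n := 12) (a := 2485100000000) (by norm_num) (by decide +kernel)) t13
    norm_num at this ⊢; linarith
  have t11 : tau (11 : ℕ) ≤ 0.25349 := by
    have := tau_le_succ (y := 11) (log_ub (n := 11) (a := 2402800000000) (by norm_num) (by decide +kernel)) t12
    norm_num at this ⊢; linarith
  have t10 : tau (10 : ℕ) ≤ 0.27652 := by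
    have := tau_le_succ (y := 10) (log_ub (n := 10) (a := 2302700000000) (by norm_num) (by decide +kernel)) t11
    norm_num at this ⊢; linarith
  have t9 : tau (9 : ℕ) ≤ 0.30365 := by
    have := tau_le_succ (y := 9) (log_ub (n := 9) (a := 2197400000000) (by norm_num) (by decide +kernel)) t10
    norm_num at this ⊢; linarith
  have t8 : tau (8 : ℕ) ≤ 0.33615 := by
    have := tau_le_succ (y := 8) (log_ub (n := 8) (a := 2079600000000) (by norm_num) (by decide +kernel)) t9
    norm_num at this ⊢; linarith
  have t7 : tau (7 : ℕ) ≤ 0.37587 := by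
    have := tau_le_succ (y := 7) (log_ub (n := 7) (a := 1946000000000) (by norm_num) (by decide +kernel)) t8
    norm_num at this ⊢; linarith
  have t6 : tau (6 : ℕ) ≤ 0.42565 := by
    have := tau_le_succ (y := 6) (log_ub (n := 6) (a := 1791900000000) (by norm_num) (by decide +kernel)) t7
    norm_num at this ⊢; linarith
  have t5 : tau (5 : ℕ) ≤ 0.49003 := by
    have := tau_le_succ (y := 5) (log_ub (n := 5) (a := 1609500000000) (by norm_num) (by decide +kernel)) t6
    norm_num at this ⊢; linarith
  have t4 : tau (4 : ℕ) ≤ 0.57669 := by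
    have := tau_le_succ (y := 4) (log_ub (n := 4) (a := 1386400000000) (by norm_num) (by decide +kernel)) t5
    norm_num at this ⊢; linarith
  have t3 : tau (3 : ℕ) ≤ 0.69877 := by
    have := tau_le_succ (y := 3) (log_ub (n := 3) (a := 1098700000000) (by norm_num) (by decide +kernel)) t4
    norm_num at this ⊢; linarith
  have t2 : tau (2 : ℕ) ≤ 0.87207 := by
    have := tau_le_succ (y := 2) (log_ub (n := 2) (a := 693200000000) (by norm_num) (by decide +kernel)) t3
    norm_num at this ⊢; linarith
  have t1 : tau (1 : ℕ) ≤ 0.87208 := by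
    have := tau_le_succ (y := 1) (log_ub (n := 1) (a := 100) (by norm_num) (by decide +kernel)) t2
    norm_num at this ⊢; linarith
  rcases Nat.lt_or_ge y 18 with h | h
  · interval_cases y
    · push_cast at t1 ⊢; linarith
    · push_cast at t2 ⊢; linarith
    · push_cast at t3 ⊢; linarith
    · push_cast at t4 ⊢; linarith
    · push_cast at t5 ⊢; linarith
    · push_cast at t6 ⊢; linarith
    · push_cast at t7 ⊢; linarith
    · push_cast at t8 ⊢; linarith
    · push_cast at t9 ⊢; linarith
    · push_cast at t10 ⊢; linarith
    · push_cast at t11 ⊢; linarith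
    · push_cast at t12 ⊢; linarith
    · push_cast at t13 ⊢; linarith
    · push_cast at t14 ⊢; linarith
    · push_cast at t15 ⊢; linarith
    · push_cast at t16 ⊢; linarith
    · push_cast at t17 ⊢; linarith
  · linarith [tau_ge18 h]

lemma tau_ge61 {x : ℕ} (hx : 61 ≤ x) : x * tau x ≤ 1.575 := by
  refine cA_num (by omega) (K := 2.83) (l := 0.0685) (fun y hy => tau_G1 y (by omega)) ?_ (by norm_num) (by norm_num)
  refine log_div_bd (n := 61) (by norm_num) hx ?_
  have := log_ub (n := 61) (a := 4112000000000) (by norm_num) (by decide +kernel)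
  norm_num at this ⊢; linarith

lemma tau_ge403 {x : ℕ} (hx : 403 ≤ x) : x * tau x ≤ 1.346 := by
  refine cA_num (by omega) (K := 2.83) (l := 0.0149) (fun y hy => tau_G1 y (by omega)) ?_ (by norm_num) (by norm_num)
  refine log_div_bd (n := 403) (by norm_num) hx ?_
  have := log_ub (n := 403) (a := 6000000000000) (by norm_num) (by decide +kernel)
  norm_num at this ⊢; linarith

lemma log403000 : Real.log 403000 ≤ 13 := by
  have := log_ub (n := 403) (a := 6000000000000) (by norm_num) (by decide +kernel)
  rw [show (403000 : ℝ) = 403 * 10 ^ 3 by norm_num, Real.log_mul (by norm_num) (by norm_num), Real.log_pow, log10_eq]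
  norm_num at this ⊢
  linarith [log2_hi, log5_hi]

lemma tau_ge403000 {x : ℕ} (hx : 403000 ≤ x) : x * tau x ≤ 1.129 := by
  refine cA_num (by omega) (K := 1.346) (l := 0.0001) (fun y hy => tau_ge403 (by omega)) ?_ (by norm_num) (by norm_num)
  refine log_div_bd (n := 403000) (by norm_num) hx ?_
  push_cast; linarith [log403000]

end PNT
end

section
open Filter Topology Set ArithmeticFunction

namespace PNT

lemma log_div_anti {a b : ℝ} (ha : 3 ≤ a) (hab : a ≤ b) : Real.log b / b ≤ Real.log a / a := by
  have := Real.exp_one_lt_d9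
  exact Real.log_div_self_antitoneOn (show a ∈ {x | Real.exp 1 ≤ x} from by simp only [Set.mem_ofPred_eq]; linarith)
    (show b ∈ {x | Real.exp 1 ≤ x} from by simp only [Set.mem_ofPred_eq]; linarith) hab

lemma log_ten_pow (n : ℕ) : Real.log ((10 : ℝ) ^ n) ≤ n * 2.303 := by
  rw [Real.log_pow, log10_eq]
  have : Real.log 2 + Real.log 5 ≤ 2.303 := by linarith [log2_hi, log5_hi]
  gcongr

lemma psi_bd2 {t : ℝ} (ht : 10 ^ 16 ≤ t) : Chebyshev.psi t ≤ 1.39 * t := by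
  have h := Chebyshev.psi_le (x := t) (by linarith)
  have ht0 : 0 < t := by linarith
  have hs : (10 : ℝ) ^ 8 ≤ √t := by
    apply Real.le_sqrt_of_sq_le; norm_num at ht ⊢; exact ht
  have hs2 : √t * √t = t := Real.mul_self_sqrt ht0.le
  have h1 := log_div_anti (by norm_num) hs
  have h2 := log_ten_pow 8
  have h3 : Real.log √t / √t ≤ 0.0005 := by
    refine h1.trans ?_
    rw [div_le_iff₀ (by positivity)]
    push_cast at h2
    refine h2.trans (by norm_num)
  rw [div_le_iff₀ (by linarith)] at h3
  have h4 : Real.log t = 2 * Real.log √t := by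
    conv_lhs => rw [← hs2, Real.log_mul (by positivity) (by positivity)]
    ring
  have h5 : √t * Real.log √t ≤ √t * (0.0005 * √t) := by gcongr
  have h6 : Real.log 4 * t ≤ 1.3863 * t := by
    apply mul_le_mul_of_nonneg_right _ ht0.le
    rw [log4_eq]; linarith [log2_hi]
  rw [h4] at h
  nlinarith

lemma cB_num {x : ℕ} (hx : 10 ^ 20 ≤ x) {K r : ℝ} (hK : ∀ y : ℕ, x ≤ 6000 * y → (y : ℝ) * tau y ≤ K)
    (hr : 96329.9448 + K * 5773.8378 + 5540058 * (1.39 / 11850 + 0.000000001) ≤ 100104 * r) (hK0 : 0 ≤ K) :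
    x * tau x ≤ r := by
  have hx' : (10 : ℝ) ^ 20 ≤ x := by exact_mod_cast hx
  have h := cB_step (le_trans (by norm_num) hx) hK (psi_bd2 (t := x / 6000) (by rw [le_div_iff₀ (by norm_num)]; linarith))
  have ht : 0 ≤ (x : ℝ) * tau x := mul_nonneg (by positivity) (tau_nonneg _)
  have hl : Real.log x / x ≤ 0.000000001 := by
    refine (log_div_anti (by norm_num) hx').trans ?_
    rw [div_le_iff₀ (by positivity)]
    have h2 := log_ten_pow 20
    push_cast at h2
    refine h2.trans (by norm_num)
  norm_num at h hr hl ⊢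
  linarith

lemma tau_ge20 {x : ℕ} (hx : 10 ^ 20 ≤ x) : x * tau x ≤ 1.034 :=
  cB_num hx (K := 1.129) (fun y hy => tau_ge403000 (by omega)) (by norm_num) (by norm_num)

lemma tau_ge24 {x : ℕ} (hx : 10 ^ 24 ≤ x) : x * tau x ≤ 1.0286 :=
  cB_num (le_trans (by norm_num) hx) (K := 1.034) (fun y hy => tau_ge20 (by omega)) (by norm_num) (by norm_num)

lemma need_of {L b v l : ℝ} (hL : 3 ≤ L) (hLb : L ≤ b) (hl : l ≤ Real.log b) (hv : v ≤ 1 + 2 * l / b) :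
    v ≤ 1 + 2 * Real.log L / L := by
  have h := log_div_anti hL hLb
  have h1 : l / b ≤ Real.log b / b := by
    apply div_le_div_of_nonneg_right hl (by linarith)
  have e1 : 2 * l / b = 2 * (l / b) := by ring
  have e2 : 2 * Real.log L / L = 2 * (Real.log L / L) := by ring
  linarith

lemma tau_main {x : ℕ} (hx : 61 ≤ x) : x * tau x ≤ 1 + 2 * Real.log (Real.log x) / Real.log x := by
  have hx' : (61 : ℝ) ≤ x := by exact_mod_cast hx
  have hx0 : (0 : ℝ) < x := by linarith
  have hL3 : 3 ≤ Real.log x := by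
    have h1 : Real.log (2 ^ 5) ≤ Real.log x := Real.log_le_log (by norm_num) (by linarith)
    rw [Real.log_pow] at h1
    push_cast at h1
    linarith [log2_lo]
  have hup : ∀ {N : ℕ} {b : ℝ}, x < N → Real.log N ≤ b → Real.log x ≤ b := fun {N b} h hb =>
    (Real.log_le_log hx0 (by exact_mod_cast h.le)).trans hb
  rcases Nat.lt_or_ge x 403 with h | h
  · refine (tau_ge61 hx).trans (need_of (b := 6) hL3 (hup h ?_) (l := 1.79) ?_ (by norm_num))
    · have := log_ub (n := 403) (a := 6000000000000) (by norm_num) (by decide +kernel)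
      norm_num at this ⊢; linarith
    · rw [show (6 : ℝ) = 2 * 3 by norm_num, Real.log_mul (by norm_num) (by norm_num)]
      linarith [log2_lo, log3_lo]
  rcases Nat.lt_or_ge x 403000 with h' | h'
  · refine (tau_ge403 h).trans (need_of (b := 13) hL3 (hup h' (by exact_mod_cast log403000)) (l := 2.4) ?_ (by norm_num))
    have h1 : Real.log 12 ≤ Real.log 13 := Real.log_le_log (by norm_num) (by norm_num)
    rw [log12_eq] at h1
    linarith [log2_lo, log3_lo]
  rcases Nat.lt_or_ge x (10 ^ 20) with h2 | h2
  · refine (tau_ge403000 h').trans (need_of (b := 48) hL3 (hup h2 ?_) (l := 3.4) ?_ (by norm_num))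
    · have := log_ten_pow 20
      push_cast at this ⊢; linarith
    · have h1 : Real.log (2 ^ 5) ≤ Real.log 48 := Real.log_le_log (by norm_num) (by norm_num)
      rw [Real.log_pow] at h1
      push_cast at h1
      linarith [log2_lo]
  rcases Nat.lt_or_ge x (10 ^ 24) with h3 | h3
  · refine (tau_ge20 h2).trans (need_of (b := 56) hL3 (hup h3 ?_) (l := 3.4) ?_ (by norm_num))
    · have := log_ten_pow 24
      push_cast at this ⊢; linarith
    · have h1 : Real.log (2 ^ 5) ≤ Real.log 56 := Real.log_le_log (by norm_num) (by norm_num)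
      rw [Real.log_pow] at h1
      push_cast at h1
      linarith [log2_lo]
  rcases le_total (Real.log x) 400 with h4 | h4
  · refine (tau_ge24 h3).trans (need_of hL3 h4 (l := 5.9) ?_ (by norm_num))
    have h1 : Real.log (2 ^ 7 * 3) ≤ Real.log 400 := Real.log_le_log (by norm_num) (by norm_num)
    rw [Real.log_mul (by norm_num) (by norm_num), Real.log_pow] at h1
    push_cast at h1
    linarith [log2_lo, log3_lo]
  · have := tau_large h4
    rwa [Real.exp_log hx0] at this

end PNT
end

section
open Filter Topology Set ArithmeticFunction

namespace PNT

/-- the term `1 / n ^ 2` restricted to primes `n ≥ q` -/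
noncomputable def prT (q n : ℕ) : ℝ := if n.Prime ∧ q ≤ n then ((n : ℝ) ^ 2)⁻¹ else 0

lemma summable_inv_sqN : Summable fun n : ℕ => ((n : ℝ) ^ 2)⁻¹ :=
  Real.summable_nat_pow_inv.2 one_lt_two

lemma prT_nonneg (q n : ℕ) : 0 ≤ prT q n := by
  unfold prT; split_ifs
  · positivity
  · exact le_rfl

lemma summable_prT (q : ℕ) : Summable (prT q) := by
  refine Summable.of_nonneg_of_le (prT_nonneg q) (fun n => ?_) summable_inv_sqN
  unfold prT; split_ifs
  · exact le_rfl
  · positivity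

lemma prT_step {q q' : ℕ} {t r : ℝ} (h : ∀ n, q < n → n < q' → ¬ n.Prime)
    (ht : ∑' n, prT q' n ≤ t) (hr : ((q : ℝ) ^ 2)⁻¹ + t ≤ r) : ∑' n, prT q n ≤ r := by
  have h1 : Summable fun n => if n = q then ((q : ℝ) ^ 2)⁻¹ else 0 := (hasSum_ite_eq q _).summable
  have h2 : ∑' n, prT q n ≤ ∑' n, ((if n = q then ((q : ℝ) ^ 2)⁻¹ else 0) + prT q' n) := by
    refine (summable_prT q).tsum_le_tsum (fun n => ?_) (h1.add (summable_prT q'))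
    have h0 := prT_nonneg q' n
    have h00 : 0 ≤ if n = q then ((q : ℝ) ^ 2)⁻¹ else 0 := by split_ifs <;> positivity
    by_cases hn : n.Prime ∧ q ≤ n
    · rcases eq_or_ne n q with e | e
      · have : prT q n = ((q : ℝ) ^ 2)⁻¹ := by unfold prT; rw [if_pos hn, e]
        rw [this, if_pos e]; linarith
      · have hlt : q < n := lt_of_le_of_ne hn.2 e.symm
        have hq' : q' ≤ n := by
          by_contra hc
          exact h n hlt (by omega) hn.1
        have : prT q n = prT q' n := by unfold prT; rw [if_pos hn, if_pos ⟨hn.1, hq'⟩]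
        linarith
    · have : prT q n = 0 := by unfold prT; rw [if_neg hn]
      linarith
  rw [h1.tsum_add (summable_prT q'), tsum_ite_eq] at h2
  linarith

lemma prT_large {q : ℕ} (hq : 3 ≤ q) : ∑' n, prT q n ≤ tau q / Real.log q := by
  have hq1 : (1 : ℝ) < q := by exact_mod_cast (by omega : 1 < q)
  have hL : 0 < Real.log q := Real.log_pos hq1
  rw [le_div_iff₀ hL, ← tsum_mul_right]
  refine ((summable_prT q).mul_right _).tsum_le_tsum (fun n => ?_) (summable_tauT (q : ℝ))
  by_cases hn : n.Prime ∧ q ≤ n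
  · rw [tauT_nat, if_pos hn.2, vonMangoldt_apply_prime hn.1]
    unfold prT
    rw [if_pos hn, mul_comm]
    have : Real.log q ≤ Real.log n := Real.log_le_log (by linarith) (by exact_mod_cast hn.2)
    gcongr
  · unfold prT
    rw [if_neg hn, zero_mul]
    exact tauT_nonneg _ _

/-- the target bound for the sum of `1 / p ^ 2` -/
noncomputable def tgt (q : ℕ) : ℝ :=
  1 / ((q : ℝ) * Real.log q) * (1 + 2 * Real.log (Real.log q) / Real.log q)

lemma tgt_big {q : ℕ} (hq : 61 ≤ q) : ∑' n, prT q n ≤ tgt q := by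
  refine (prT_large (by omega)).trans ?_
  have h := tau_main hq
  have hq1 : (1 : ℝ) < q := by exact_mod_cast (by omega : 1 < q)
  have hL : 0 < Real.log q := Real.log_pos hq1
  have hq0 : (0 : ℝ) < q := by linarith
  have e : tau q / Real.log q = 1 / ((q : ℝ) * Real.log q) * (q * tau q) := by field_simp
  unfold tgt
  rw [e]
  exact mul_le_mul_of_nonneg_left h (by positivity)

lemma tgt_of {q : ℕ} {U r v : ℝ} (hq : 3 ≤ q) (hU : Real.log q ≤ U) (hS : ∑' n, prT q n ≤ r) (hr : 0 ≤ r)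
    (hv : v ≤ 1 + 2 * Real.log (Real.log q) / Real.log q) (h : q * r * U ≤ v) :
    ∑' n, prT q n ≤ tgt q := by
  refine hS.trans ?_
  have hq1 : (1 : ℝ) < q := by exact_mod_cast (by omega : 1 < q)
  have hL : 0 < Real.log q := Real.log_pos hq1
  have hq0 : (0 : ℝ) < q := by linarith
  unfold tgt
  rw [div_mul_eq_mul_div, one_mul, le_div_iff₀ (by positivity)]
  have : (q * r) * Real.log q ≤ (q * r) * U := mul_le_mul_of_nonneg_left hU (by positivity)
  linarith

lemma tgt_small {q : ℕ} {r U : ℝ} (hq : 3 ≤ q) (hU : Real.log q ≤ U) (hS : ∑' n, prT q n ≤ r) (hr : 0 ≤ r)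
    (h : q * r * U ≤ 1) : ∑' n, prT q n ≤ tgt q := by
  refine tgt_of hq hU hS hr (v := 1) ?_ h
  have hq3 : (3 : ℝ) ≤ q := by exact_mod_cast hq
  have h1 : Real.log 3 ≤ Real.log q := Real.log_le_log (by norm_num) hq3
  have h2 : 1 ≤ Real.log q := by linarith [log3_lo]
  have h3 := Real.log_nonneg h2
  have : 0 ≤ 2 * Real.log (Real.log q) / Real.log q := by positivity
  linarith

lemma tgt_mid {q : ℕ} {r : ℝ} (hq : 23 ≤ q) (hq2 : q ≤ 59) (hS : ∑' n, prT q n ≤ r) (hr : 0 ≤ r)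
    (h : q * r * 4.2 ≤ 1.65) : ∑' n, prT q n ≤ tgt q := by
  have hq1 : (23 : ℝ) ≤ q := by exact_mod_cast hq
  have hq3 : (q : ℝ) ≤ 59 := by exact_mod_cast hq2
  have hU : Real.log q ≤ 4.2 := by
    have h1 : Real.log q ≤ Real.log (2 ^ 6) := Real.log_le_log (by linarith) (by linarith)
    rw [Real.log_pow] at h1
    push_cast at h1
    linarith [log2_hi]
  refine tgt_of (by omega) hU hS hr (v := 1.65) ?_ h
  refine need_of (b := 4.2) ?_ hU (l := 1.38) ?_ (by norm_num)
  · have h1 : Real.log (7 * 3) ≤ Real.log q := Real.log_le_log (by norm_num) (by linarith)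
    rw [Real.log_mul (by norm_num) (by norm_num)] at h1
    have h7 : Real.log (2 * 3) ≤ Real.log 7 := Real.log_le_log (by norm_num) (by norm_num)
    linarith [log3_lo, log7_lo]
  · have h1 : Real.log (2 ^ 2) ≤ Real.log 4.2 := Real.log_le_log (by norm_num) (by norm_num)
    rw [Real.log_pow] at h1
    push_cast at h1
    linarith [log2_lo]

lemma tgt_all {q : ℕ} (hq : q.Prime) (hq3 : 3 ≤ q) : ∑' n, prT q n ≤ tgt q := by
  rcases Nat.lt_or_ge q 61 with hlt | hge
  swap
  · exact tgt_big hge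
  have s61 : ∑' n, prT 61 n ≤ 0.00634 := by
    refine (prT_large (by norm_num)).trans ?_
    have h1 := tau_ge61 (x := 61) le_rfl
    have h2 : (4.08 : ℝ) ≤ Real.log 61 := by
      have h1 : Real.log (2 * 30) ≤ Real.log 61 := Real.log_le_log (by norm_num) (by norm_num)
      rw [Real.log_mul (by norm_num) (by norm_num), log30_eq] at h1
      rw [log10_eq] at h1
      linarith [log2_lo, log3_lo, log5_lo]
    push_cast at h1 ⊢
    rw [div_le_iff₀ (by linarith)]
    linarith
  have s59 : ∑' n, prT 59 n ≤ 0.00663 := prT_step (by intro n h1 h2; interval_cases n <;> norm_num) s61 (by norm_num)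
  have s53 : ∑' n, prT 53 n ≤ 0.0070 := prT_step (by intro n h1 h2; interval_cases n <;> norm_num) s59 (by norm_num)
  have s47 : ∑' n, prT 47 n ≤ 0.0075 := prT_step (by intro n h1 h2; interval_cases n <;> norm_num) s53 (by norm_num)
  have s43 : ∑' n, prT 43 n ≤ 0.0081 := prT_step (by intro n h1 h2; interval_cases n <;> norm_num) s47 (by norm_num)
  have s41 : ∑' n, prT 41 n ≤ 0.0087 := prT_step (by intro n h1 h2; interval_cases n <;> norm_num) s43 (by norm_num)
  have s37 : ∑' n, prT 37 n ≤ 0.0095 := prT_step (by intro n h1 h2; interval_cases n <;> norm_num) s41 (by norm_num)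
  have s31 : ∑' n, prT 31 n ≤ 0.0106 := prT_step (by intro n h1 h2; interval_cases n <;> norm_num) s37 (by norm_num)
  have s29 : ∑' n, prT 29 n ≤ 0.0118 := prT_step (by intro n h1 h2; interval_cases n <;> norm_num) s31 (by norm_num)
  have s23 : ∑' n, prT 23 n ≤ 0.0137 := prT_step (by intro n h1 h2; interval_cases n <;> norm_num) s29 (by norm_num)
  have s19 : ∑' n, prT 19 n ≤ 0.0165 := prT_step (by intro n h1 h2; interval_cases n <;> norm_num) s23 (by norm_num)
  have s17 : ∑' n, prT 17 n ≤ 0.02 := prT_step (by intro n h1 h2; interval_cases n <;> norm_num) s19 (by norm_num)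
  have s13 : ∑' n, prT 13 n ≤ 0.026 := prT_step (by intro n h1 h2; interval_cases n <;> norm_num) s17 (by norm_num)
  have s11 : ∑' n, prT 11 n ≤ 0.0343 := prT_step (by intro n h1 h2; interval_cases n <;> norm_num) s13 (by norm_num)
  have s7 : ∑' n, prT 7 n ≤ 0.0548 := prT_step (by intro n h1 h2; interval_cases n <;> norm_num) s11 (by norm_num)
  have s5 : ∑' n, prT 5 n ≤ 0.0949 := prT_step (by intro n h1 h2; interval_cases n <;> norm_num) s7 (by norm_num)
  have s3 : ∑' n, prT 3 n ≤ 0.2061 := prT_step (by intro n h1 h2; interval_cases n <;> norm_num) s5 (by norm_num)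
  have hU : ∀ {q : ℕ}, 3 ≤ q → q ≤ 20 → Real.log q ≤ 3 := fun {q} h1 h2 => by
    have h3 : Real.log q ≤ Real.log (2 * 10) := Real.log_le_log (by exact_mod_cast (by omega : 0 < q)) (by norm_num; exact_mod_cast h2)
    rw [Real.log_mul (by norm_num) (by norm_num), log10_eq] at h3
    linarith [log2_hi, log5_hi]
  have hU2 : ∀ {q : ℕ}, 3 ≤ q → q ≤ 8 → Real.log q ≤ 2.1 := fun {q} h1 h2 => by
    have h3 : Real.log q ≤ Real.log 8 := Real.log_le_log (by exact_mod_cast (by omega : 0 < q)) (by exact_mod_cast h2)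
    rw [log8_eq] at h3
    linarith [log2_hi]
  have hU1 : Real.log (3 : ℕ) ≤ 1.1 := by push_cast; linarith [log3_hi]
  have hU11 : Real.log (11 : ℕ) ≤ 2.5 := by
    push_cast
    have h3 : Real.log 11 ≤ Real.log 12 := Real.log_le_log (by norm_num) (by norm_num)
    rw [log12_eq] at h3
    linarith [log2_hi, log3_hi]
  have hU13 : Real.log (13 : ℕ) ≤ 2.8 := by
    push_cast
    have h3 : Real.log 13 ≤ Real.log 16 := Real.log_le_log (by norm_num) (by norm_num)
    rw [log16_eq] at h3
    linarith [log2_hi]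
  have hU17 : Real.log (17 : ℕ) ≤ 2.9 := by
    push_cast
    have h3 : Real.log 17 ≤ Real.log 18 := Real.log_le_log (by norm_num) (by norm_num)
    rw [log18_eq] at h3
    linarith [log2_hi, log3_hi]
  have key : q ∈ [3, 5, 7, 11, 13, 17, 19, 23, 29, 31, 37, 41, 43, 47, 53, 59] := by
    revert hq; clear * - hlt hq3
    interval_cases q <;> norm_num
  fin_cases key
  · exact tgt_small (by norm_num) hU1 s3 (by norm_num) (by norm_num)
  · exact tgt_small (by norm_num) (hU2 (by norm_num) (by norm_num)) s5 (by norm_num) (by norm_num)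
  · exact tgt_small (by norm_num) (hU2 (by norm_num) (by norm_num)) s7 (by norm_num) (by norm_num)
  · exact tgt_small (by norm_num) hU11 s11 (by norm_num) (by norm_num)
  · exact tgt_small (by norm_num) hU13 s13 (by norm_num) (by norm_num)
  · exact tgt_small (by norm_num) hU17 s17 (by norm_num) (by norm_num)
  · exact tgt_small (by norm_num) (hU (by norm_num) (by norm_num)) s19 (by norm_num) (by norm_num)
  · exact tgt_mid (by norm_num) (by norm_num) s23 (by norm_num) (by norm_num)
  · exact tgt_mid (by norm_num) (by norm_num) s29 (by norm_num) (by norm_num)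
  · exact tgt_mid (by norm_num) (by norm_num) s31 (by norm_num) (by norm_num)
  · exact tgt_mid (by norm_num) (by norm_num) s37 (by norm_num) (by norm_num)
  · exact tgt_mid (by norm_num) (by norm_num) s41 (by norm_num) (by norm_num)
  · exact tgt_mid (by norm_num) (by norm_num) s43 (by norm_num) (by norm_num)
  · exact tgt_mid (by norm_num) (by norm_num) s47 (by norm_num) (by norm_num)
  · exact tgt_mid (by norm_num) (by norm_num) s53 (by norm_num) (by norm_num)
  · exact tgt_mid (by norm_num) (by norm_num) s59 (by norm_num) (by norm_num)

/-- the excess term -/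
noncomputable def exT (q n : ℕ) : ℝ := if q ≤ n then ((n : ℝ) ^ 2 * ((n : ℝ) ^ 2 - 1))⁻¹ else 0

lemma exT_nonneg {q : ℕ} (hq : 3 ≤ q) (n : ℕ) : 0 ≤ exT q n := by
  unfold exT; split_ifs with h
  · have : (3 : ℝ) ≤ n := by exact_mod_cast hq.trans h
    have : 0 ≤ (n : ℝ) ^ 2 - 1 := by nlinarith
    positivity
  · exact le_rfl

lemma summable_exT {q : ℕ} (hq : 3 ≤ q) : Summable (exT q) := by
  refine Summable.of_nonneg_of_le (exT_nonneg hq) (fun n => ?_) summable_inv_sqN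
  unfold exT; split_ifs with h
  · have : (3 : ℝ) ≤ n := by exact_mod_cast hq.trans h
    apply inv_anti₀ (by positivity)
    have : 1 ≤ (n : ℝ) ^ 2 - 1 := by nlinarith
    nlinarith
  · positivity

lemma exT_sum {q : ℕ} (hq : 3 ≤ q) : ∑' n, exT q n ≤ 4 / (q : ℝ) ^ 3 := by
  have hq3 : (3 : ℝ) ≤ q := by exact_mod_cast hq
  have hq2 : 0 < (q : ℝ) ^ 2 - 1 := by nlinarith
  have h := tail_le (f := fun n : ℕ => ((n : ℝ) ^ 2 * ((n : ℝ) ^ 2 - 1))⁻¹) (j := q)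
    (g := fun n : ℕ => 1 / ((q : ℝ) ^ 2 - 1) * (1 / ((n : ℝ) - 1))) (summable_exT hq) ?_ ?_
  · refine h.trans ?_
    rw [div_mul_div_comm, one_mul, div_le_div_iff₀ (mul_pos hq2 (by linarith)) (by positivity)]
    obtain ⟨t, ht⟩ : ∃ t : ℝ, (q : ℝ) = t + 3 := ⟨q - 3, by ring⟩
    have ht0 : 0 ≤ t := by linarith
    rw [ht]
    have := pow_nonneg ht0 3
    nlinarith [mul_nonneg ht0 ht0]
  · have : Tendsto (fun n : ℕ => 1 / ((n : ℝ) - 1)) atTop (𝓝 0) := by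
      simp only [one_div]
      exact (tendsto_natCast_atTop_atTop.atTop_add (tendsto_const_nhds (x := (-1 : ℝ)))).inv_tendsto_atTop
    have h2 := this.const_mul (1 / ((q : ℝ) ^ 2 - 1))
    rwa [mul_zero] at h2
  · intro n hn
    have hnq : (q : ℝ) ≤ n := by exact_mod_cast hn
    have e : 1 / ((n : ℝ) - 1) - 1 / (((n + 1 : ℕ) : ℝ) - 1) = 1 / (((n : ℝ) - 1) * n) := by
      have : (n : ℝ) - 1 ≠ 0 := by linarith
      have : (n : ℝ) ≠ 0 := by linarith
      push_cast; rw [add_sub_cancel_right]; field_simp; ring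
    rw [← mul_sub, e, div_mul_div_comm, one_mul, ← one_div]
    have h1 : 0 < (n : ℝ) - 1 := by linarith
    apply one_div_le_one_div_of_le (mul_pos hq2 (mul_pos h1 (by linarith)))
    have h2 : (q : ℝ) ^ 2 - 1 ≤ (n : ℝ) ^ 2 - 1 := by nlinarith
    rw [mul_comm]
    apply mul_le_mul _ h2 hq2.le (by positivity)
    nlinarith

end PNT
end

theorem stmt_7 (q : ℕ) (hq : q.Prime) (hqodd : Odd q)
    (E : ℝ) (hE : E = ∏' p : {p : ℕ // p.Prime ∧ q ≤ p},
      ((p : ℕ) : ℝ) ^ 2 / (((p : ℕ) : ℝ) ^ 2 - 1)) :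
    Real.log E ≤ 1 / ((q : ℝ) * Real.log q) * (1 + 2 * Real.log (Real.log q) / Real.log q)
      + 4 / (q : ℝ) ^ 3 := by
  have hq3 : 3 ≤ q := by
    have := hq.two_le
    rcases hqodd with ⟨k, hk⟩
    omega
  have hp3 : ∀ p : {p : ℕ // p.Prime ∧ q ≤ p}, (3 : ℝ) ≤ ((p : ℕ) : ℝ) := fun p => by
    exact_mod_cast hq3.trans p.2.2
  have hp1 : ∀ p : {p : ℕ // p.Prime ∧ q ≤ p}, 0 < ((p : ℕ) : ℝ) ^ 2 - 1 := fun p => by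
    nlinarith [hp3 p]
  have hpos : ∀ p : {p : ℕ // p.Prime ∧ q ≤ p}, 0 < ((p : ℕ) : ℝ) ^ 2 / (((p : ℕ) : ℝ) ^ 2 - 1) := fun p => by
    have := hp1 p
    have := hp3 p
    positivity
  have hnn : ∀ p : {p : ℕ // p.Prime ∧ q ≤ p}, 0 ≤ Real.log (((p : ℕ) : ℝ) ^ 2 / (((p : ℕ) : ℝ) ^ 2 - 1)) := fun p => by
    apply Real.log_nonneg
    rw [one_le_div (hp1 p)]; linarith
  have hle : ∀ p : {p : ℕ // p.Prime ∧ q ≤ p}, Real.log (((p : ℕ) : ℝ) ^ 2 / (((p : ℕ) : ℝ) ^ 2 - 1))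
      ≤ PNT.prT q p + PNT.exT q p := fun p => by
    have h1 := Real.log_le_sub_one_of_pos (hpos p)
    refine h1.trans (le_of_eq ?_)
    unfold PNT.prT PNT.exT
    rw [if_pos p.2, if_pos p.2.2]
    have h2 := (hp1 p).ne'
    have h3 : ((p : ℕ) : ℝ) ≠ 0 := by linarith [hp3 p]
    field_simp
    ring
  have hsum : Summable fun n => PNT.prT q n + PNT.exT q n := (PNT.summable_prT q).add (PNT.summable_exT hq3)
  have hsub : Summable fun p : {p : ℕ // p.Prime ∧ q ≤ p} => PNT.prT q p + PNT.exT q p :=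
    hsum.comp_injective Subtype.val_injective
  have hlog := Summable.of_nonneg_of_le hnn hle hsub
  rw [hE, ← Real.rexp_tsum_eq_tprod hpos hlog, Real.log_exp]
  refine (hlog.tsum_le_tsum hle hsub).trans ?_
  have h1 : ∑' p : {p : ℕ // p.Prime ∧ q ≤ p}, (PNT.prT q p + PNT.exT q p) ≤ ∑' n, (PNT.prT q n + PNT.exT q n) :=
    hsub.tsum_le_tsum_of_inj Subtype.val Subtype.val_injective
      (fun n _ => add_nonneg (PNT.prT_nonneg q n) (PNT.exT_nonneg hq3 n)) (fun _ => le_rfl) hsum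
  refine h1.trans ?_
  rw [(PNT.summable_prT q).tsum_add (PNT.summable_exT hq3)]
  exact add_le_add (PNT.tgt_all hq hq3) (PNT.exT_sum hq3)
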